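/- Suppose (L₀,p) is a Brascamp–Lieb datum with finite Brascamp–Lieb constant. Then there exist N ∈ ℕ and δ₀ > 0 and a neighbourhood of L₀ (in the space of m-tuples of linear maps) such that for every δ ∈ (0,δ₀) and every m-tuple L of linear surjections in that neighbourhood, the supremum of BL_g(L,p;A) over all m-tuples A = (A_j) of positive definite n_j × n_j matrices satisfying ‖A_j‖ < δ^{-N} and ‖A_j^{-1}‖ < δ^{-N} for all j is at least (1−δ) · BL(L,p). -/

import Mathlib

open MeasureTheory
open scoped ENNReal Matrix

/-- The `ℓ² → ℓ²` operator norm of a matrix. -/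
noncomputable def matOpNorm {a b : ℕ} (A : Matrix (Fin a) (Fin b) ℝ) : ℝ :=
  ‖LinearMap.toContinuousLinearMap (Matrix.toEuclideanLin A)‖

/-- The Brascamp–Lieb constant of a datum given by matrices `L_j : ℝ^n → ℝ^{n_j}` and
exponents `p_j`. -/
noncomputable def matBL {m n : ℕ} (nj : Fin m → ℕ)
    (L : ∀ j, Matrix (Fin (nj j)) (Fin n) ℝ) (p : Fin m → ℝ) : ℝ≥0∞ :=
  sInf {C : ℝ≥0∞ | ∀ f : ∀ j, EuclideanSpace ℝ (Fin (nj j)) → ℝ≥0∞,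
    (∀ j, Measurable (f j)) →
    ∫⁻ x : EuclideanSpace ℝ (Fin n), ∏ j, (f j (Matrix.toEuclideanLin (L j) x)) ^ (p j)
      ≤ C * ∏ j, (∫⁻ xj, f j xj) ^ (p j)}

/-- The gaussian Brascamp–Lieb constant
`BL_g(L,p;A) = ∏_j det(A_j)^{p_j/2} / det(∑_j p_j L_j* A_j L_j)^{1/2}`. -/
noncomputable def matBLg {m n : ℕ} (nj : Fin m → ℕ)
    (L : ∀ j, Matrix (Fin (nj j)) (Fin n) ℝ) (p : Fin m → ℝ)
    (A : ∀ j, Matrix (Fin (nj j)) (Fin (nj j)) ℝ) : ℝ :=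
  (∏ j, (A j).det ^ (p j / 2)) / (∑ j, p j • ((L j)ᴴ * A j * L j)).det ^ ((1 : ℝ) / 2)

/-- Third order upper bound for the logarithm. -/
theorem log_one_add_le_cubic {y : ℝ} (hy : -1 < y) :
    Real.log (1 + y) ≤ y - y ^ 2 / 2 + y ^ 3 / 3 := by
  let f : ℝ → ℝ := fun y => y - y ^ 2 / 2 + y ^ 3 / 3 - Real.log (1 + y)
  have hd : ∀ t : ℝ, -1 < t → HasDerivAt f (1 - t + t ^ 2 - 1 / (1 + t)) t := by
    intro t ht
    have h1 : HasDerivAt (fun y : ℝ => Real.log (1 + y)) (1 / (1 + t)) t :=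
      ((hasDerivAt_id t).const_add 1).log (by simp; linarith)
    have h2 : HasDerivAt (fun y : ℝ => y - y ^ 2 / 2 + y ^ 3 / 3) (1 - t + t ^ 2) t := by
      have := ((hasDerivAt_id t).sub (((hasDerivAt_id t).pow 2).div_const 2)).add
        (((hasDerivAt_id t).pow 3).div_const 3)
      convert! this using 1
      simp
    exact h2.sub h1
  have hd' : ∀ t : ℝ, -1 < t → 1 - t + t ^ 2 - 1 / (1 + t) = t ^ 3 / (1 + t) := by
    intro t ht
    have : 1 + t ≠ 0 := by linarith
    field_simp; ring
  have hf0 : f 0 = 0 := by simp [f]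
  suffices 0 ≤ f y by simp only [f] at this; linarith
  rw [← hf0]
  rcases le_total 0 y with h | h
  · have : MonotoneOn f (Set.Ici 0) := by
      apply monotoneOn_of_deriv_nonneg (convex_Ici 0)
      · intro t ht
        exact (hd t (by simp at ht; linarith)).continuousAt.continuousWithinAt
      · intro t ht
        simp at ht
        exact (hd t (by linarith)).differentiableAt.differentiableWithinAt
      · intro t ht
        simp at ht
        rw [(hd t (by linarith)).deriv, hd' t (by linarith)]
        positivity
    exact this (by simp) h h
  · have : AntitoneOn f (Set.Ioc (-1) 0) := by
      apply antitoneOn_of_deriv_nonpos (convex_Ioc _ _)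
      · intro t ht
        exact (hd t ht.1).continuousAt.continuousWithinAt
      · intro t ht
        rw [interior_Ioc] at ht
        exact (hd t ht.1).differentiableAt.differentiableWithinAt
      · intro t ht
        rw [interior_Ioc] at ht
        rw [(hd t ht.1).deriv, hd' t ht.1]
        apply div_nonpos_of_nonpos_of_nonneg _ (by linarith [ht.1])
        exact (Odd.pow_nonpos (by decide) ht.2.le)
    exact this ⟨hy, h⟩ (by simp) h

/-- Third order upper bound for the exponential, for exponents `l ≤ min Y B`. -/
theorem exp_le_cubic {l Y B : ℝ} (hB : 0 ≤ B) (hl : l ≤ Y) (hlB : l ≤ B) :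
    Real.exp l ≤ 1 + Y + Y ^ 2 / 2 + Real.exp (B + 1) * |Y| ^ 3 := by
  have taylor : ∀ t : ℝ, Real.exp t ≤ 1 + t + t ^ 2 / 2 + |t| ^ 3 * Real.exp |t| := by
    intro t
    have h := Complex.norm_exp_sub_sum_le_norm_mul_exp (t : ℂ) 3
    have h2 : Complex.exp t - ∑ k ∈ Finset.range 3, (t : ℂ) ^ k / (k.factorial : ℂ)
        = ((Real.exp t - (1 + t + t ^ 2 / 2) : ℝ) : ℂ) := by
      simp [Finset.sum_range_succ]
    rw [h2, Complex.norm_real, Complex.norm_real, Real.norm_eq_abs, Real.norm_eq_abs] at h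
    linarith [le_abs_self (Real.exp t - (1 + t + t ^ 2 / 2))]
  have key : ∀ t : ℝ, t ≤ B →
      Real.exp t ≤ 1 + t + t ^ 2 / 2 + Real.exp (B + 1) * |t| ^ 3 := by
    intro t ht
    rcases le_or_gt (-1) t with h | h
    · have h3 : |t| ≤ B + 1 := abs_le.2 ⟨by linarith, by linarith⟩
      have h4 := mul_le_mul_of_nonneg_left (Real.exp_le_exp.2 h3) (by positivity : 0 ≤ |t| ^ 3)
      linarith [taylor t]
    · have h1 : Real.exp t ≤ 1 := Real.exp_le_one_iff.2 (by linarith)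
      have h2 : 1 ≤ Real.exp (B + 1) := Real.one_le_exp (by linarith)
      have h3 : 1 ≤ |t| := by rw [abs_of_neg (by linarith)]; linarith
      have h4 : |t| ≤ |t| ^ 3 := le_self_pow₀ h3 (by norm_num)
      have h5 : |t| ^ 3 ≤ Real.exp (B + 1) * |t| ^ 3 := le_mul_of_one_le_left (by positivity) h2
      nlinarith [neg_abs_le t, sq_nonneg t]
  rcases le_or_gt Y B with h | h
  · exact (Real.exp_le_exp.2 hl).trans (key Y h)
  · have hY : 0 ≤ Y := hB.trans h.le
    have h1 := (Real.exp_le_exp.2 hlB).trans (key B le_rfl)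
    rw [abs_of_nonneg hB] at h1
    rw [abs_of_nonneg hY]
    have : B ^ 2 ≤ Y ^ 2 := by gcongr
    have : Real.exp (B + 1) * B ^ 3 ≤ Real.exp (B + 1) * Y ^ 3 := by gcongr
    linarith

/-- Second order upper bound, with cubic error, for the logarithm of a number close to `1`. -/
theorem log_le_second_order {C h s a b r : ℝ} (hC : 1 ≤ C) (h0 : 0 ≤ h) (h1 : h ≤ 1) (hs : 1 ≤ s)
    (hr : 0 < r) (ha : |a| ≤ C * s) (hb : |b| ≤ C * s ^ 2)
    (hrem : |r - 1 - h * a - h ^ 2 / 2 * b| ≤ C * h ^ 3 * s ^ 3) :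
    Real.log r ≤ h * a + h ^ 2 / 2 * (b - a ^ 2) + 20 * C ^ 3 * h ^ 3 * s ^ 9 := by
  have hs0 : 0 ≤ s := by linarith
  have hC0 : 0 ≤ C := by linarith
  have hspow : ∀ {i k : ℕ}, i ≤ k → s ^ i ≤ s ^ k := fun hik => pow_le_pow_right₀ hs hik
  set y := r - 1 with hy
  have hly : Real.log (r) ≤ y - y ^ 2 / 2 + y ^ 3 / 3 := by
    have := log_one_add_le_cubic (y := y) (by linarith [hr])
    rwa [hy, add_sub_cancel] at this
  set e1 := y - h * a with he1
  have hrem' := abs_le.1 (hrem)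
  have hb' := abs_le.1 (hb)
  have hh3 : h ^ 3 * s ^ 3 ≤ h ^ 2 * s ^ 3 :=
    mul_le_mul_of_nonneg_right (pow_le_pow_of_le_one h0 h1 (by norm_num)) (by positivity)
  have hh2 : h ^ 2 * s ^ 2 ≤ h ^ 2 * s ^ 3 :=
    mul_le_mul_of_nonneg_left (hspow (by norm_num)) (by positivity)
  have hCh : C * h ^ 3 * s ^ 3 ≤ C * (h ^ 2 * s ^ 3) := by
    rw [mul_assoc]; exact mul_le_mul_of_nonneg_left hh3 hC0
  have hCb : h ^ 2 / 2 * |b| ≤ C / 2 * (h ^ 2 * s ^ 3) := by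
    calc h ^ 2 / 2 * |b| ≤ h ^ 2 / 2 * (C * s ^ 2) :=
          mul_le_mul_of_nonneg_left (hb) (by positivity)
      _ = C / 2 * (h ^ 2 * s ^ 2) := by ring
      _ ≤ _ := mul_le_mul_of_nonneg_left hh2 (by positivity)
  have he1b : |e1| ≤ 3 / 2 * C * h ^ 2 * s ^ 3 := by
    have h5 : |h ^ 2 / 2 * b| ≤ C / 2 * (h ^ 2 * s ^ 3) := by
      rw [abs_mul, abs_of_nonneg (by positivity : 0 ≤ h ^ 2 / 2)]; exact hCb
    have h6 := abs_le.1 h5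
    rw [abs_le]
    constructor <;> linarith [hrem'.1, hrem'.2, h6.1, h6.2]
  have hab : |h * a| ≤ C * h * s := by
    rw [abs_mul, abs_of_nonneg h0]
    nlinarith [mul_le_mul_of_nonneg_left (ha) h0]
  have hyb : |y| ≤ 5 / 2 * C * h * s ^ 3 := by
    have h5 : y = h * a + e1 := by ring
    have h6 : C * h * s ≤ C * h * s ^ 3 :=
      mul_le_mul_of_nonneg_left (by simpa using hspow (i := 1) (k := 3) (by norm_num))
        (by positivity)
    have h7 : C * h ^ 2 * s ^ 3 ≤ C * h * s ^ 3 := by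
      have : h ^ 2 ≤ h := by nlinarith
      gcongr
    have h8 := abs_add_le (h * a) e1
    rw [← h5] at h8
    nlinarith
  have hy3 : y ^ 3 ≤ 16 * C ^ 3 * h ^ 3 * s ^ 9 := by
    have h5 : y ^ 3 ≤ |y| ^ 3 := by rw [← abs_pow]; exact le_abs_self _
    have h6 : |y| ^ 3 ≤ (5 / 2 * C * h * s ^ 3) ^ 3 := by gcongr
    have h7 : (5 / 2 * C * h * s ^ 3) ^ 3 = 125 / 8 * (C ^ 3 * h ^ 3 * s ^ 9) := by ring
    have h8 : 0 ≤ C ^ 3 * h ^ 3 * s ^ 9 := by positivity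
    linarith
  have hy2 : h ^ 2 * a ^ 2 - 3 * C ^ 2 * h ^ 3 * s ^ 4 ≤ y ^ 2 := by
    have h5 : y ^ 2 = h ^ 2 * a ^ 2 + 2 * (h * a * e1) + e1 ^ 2 := by rw [he1]; ring
    have h6 : |h * a * e1| ≤ (C * h * s) * (3 / 2 * C * h ^ 2 * s ^ 3) := by
      rw [abs_mul]; gcongr
    have h7 : (C * h * s) * (3 / 2 * C * h ^ 2 * s ^ 3) = 3 / 2 * C ^ 2 * h ^ 3 * s ^ 4 := by ring
    have h8 := neg_abs_le (h * a * e1)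
    nlinarith [sq_nonneg e1]
  have hyr : y ≤ h * a + h ^ 2 / 2 * b + C * h ^ 3 * s ^ 3 := by linarith [hrem'.2]
  have t1 : C * h ^ 3 * s ^ 3 ≤ C ^ 3 * h ^ 3 * s ^ 9 := by
    have := hspow (i := 3) (k := 9) (by norm_num)
    have hCC : C ≤ C ^ 3 := le_self_pow₀ hC (by norm_num)
    gcongr
  have t2 : C ^ 2 * h ^ 3 * s ^ 4 ≤ C ^ 3 * h ^ 3 * s ^ 9 := by
    have := hspow (i := 4) (k := 9) (by norm_num)
    have hCC : C ^ 2 ≤ C ^ 3 := pow_le_pow_right₀ hC (by norm_num)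
    gcongr
  have h9 : 0 ≤ C ^ 3 * h ^ 3 * s ^ 9 := by positivity
  linarith

/-- Second order expansion, with cubic error, of a product of powers of numbers close to `1`. -/
theorem prod_rpow_le_second_order {m : ℕ} (p : Fin m → ℝ) (hp : ∀ j, 0 ≤ p j) {C : ℝ} (hC : 1 ≤ C) :
    ∃ D : ℝ, 0 ≤ D ∧ ∀ (h s : ℝ) (a b r : Fin m → ℝ), 0 ≤ h → h ≤ 1 → 1 ≤ s →
      (∀ j, 0 < r j) → (∀ j, r j ≤ C) → (∀ j, |a j| ≤ C * s) → (∀ j, |b j| ≤ C * s ^ 2) →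
      (∀ j, |r j - 1 - h * a j - h ^ 2 / 2 * b j| ≤ C * h ^ 3 * s ^ 3) →
      ∏ j, r j ^ p j ≤ 1 + h * ∑ j, p j * a j
        + h ^ 2 / 2 * (∑ j, p j * (b j - a j ^ 2) + (∑ j, p j * a j) ^ 2) + D * h ^ 3 * s ^ 27 := by
  set P := ∑ j, p j with hP
  have hP0 : 0 ≤ P := Finset.sum_nonneg fun j _ => hp j
  set c1 : ℝ := 20 * C ^ 3 with hc1
  set c2 : ℝ := P * (C + C ^ 2 + c1) with hc2
  refine ⟨P * c1 + (P * C * c2 + c2 ^ 2) + Real.exp (P * C + 1) * (P * C + c2) ^ 3, by positivity, ?_⟩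
  intro h s a b r h0 h1 hs hr hrC ha hb hrem
  have hs0 : 0 ≤ s := by linarith
  have hC0 : 0 ≤ C := by linarith
  have hspow : ∀ {i k : ℕ}, i ≤ k → s ^ i ≤ s ^ k := fun hik => pow_le_pow_right₀ hs hik
  -- the logarithm of each factor
  have hlog : ∀ j, Real.log (r j) ≤ h * a j + h ^ 2 / 2 * (b j - a j ^ 2) + c1 * h ^ 3 * s ^ 9 :=
    fun j => log_le_second_order hC h0 h1 hs (hr j) (ha j) (hb j) (hrem j)
  set α := ∑ j, p j * a j with hα
  set β := ∑ j, p j * (b j - a j ^ 2) with hβ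
  have hαb : |α| ≤ P * C * s := by
    calc |α| ≤ ∑ j, |p j * a j| := Finset.abs_sum_le_sum_abs _ _
      _ ≤ ∑ j, p j * (C * s) := Finset.sum_le_sum fun j _ => by
          rw [abs_mul, abs_of_nonneg (hp j)]; exact mul_le_mul_of_nonneg_left (ha j) (hp j)
      _ = P * C * s := by rw [← Finset.sum_mul, mul_assoc]
  have hβb : |β| ≤ P * (C + C ^ 2) * s ^ 2 := by
    calc |β| ≤ ∑ j, |p j * (b j - a j ^ 2)| := Finset.abs_sum_le_sum_abs _ _
      _ ≤ ∑ j, p j * ((C + C ^ 2) * s ^ 2) := Finset.sum_le_sum fun j _ => by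
          rw [abs_mul, abs_of_nonneg (hp j)]
          refine mul_le_mul_of_nonneg_left ?_ (hp j)
          have h2 : |a j ^ 2| ≤ (C * s) ^ 2 := by
            rw [abs_pow]; exact pow_le_pow_left₀ (abs_nonneg _) (ha j) 2
          have := abs_sub (b j) (a j ^ 2)
          nlinarith [hb j]
      _ = P * (C + C ^ 2) * s ^ 2 := by rw [← Finset.sum_mul, mul_assoc]
  set e := β / 2 + P * c1 * h * s ^ 9 with he
  have heb : |e| ≤ c2 * s ^ 9 := by
    have h2 : |e| ≤ |β / 2| + |P * c1 * h * s ^ 9| := abs_add_le _ _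
    rw [abs_div, abs_two, abs_of_nonneg (by positivity : 0 ≤ P * c1 * h * s ^ 9)] at h2
    have h3 : P * (C + C ^ 2) * s ^ 2 ≤ P * (C + C ^ 2) * s ^ 9 :=
      mul_le_mul_of_nonneg_left (hspow (by norm_num)) (by positivity)
    have h4 : P * c1 * h * s ^ 9 ≤ P * c1 * 1 * s ^ 9 := by gcongr
    have h5 : 0 ≤ P * (C + C ^ 2) * s ^ 9 := by positivity
    rw [hc2]
    nlinarith
  set Y := h * α + h ^ 2 * e with hY
  have hprod : ∏ j, r j ^ p j = Real.exp (∑ j, p j * Real.log (r j)) := by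
    rw [Real.exp_sum]
    refine Finset.prod_congr rfl fun j _ => ?_
    rw [Real.rpow_def_of_pos (hr j), mul_comm]
  have hl1 : ∑ j, p j * Real.log (r j) ≤ Y := by
    calc ∑ j, p j * Real.log (r j)
        ≤ ∑ j, p j * (h * a j + h ^ 2 / 2 * (b j - a j ^ 2) + c1 * h ^ 3 * s ^ 9) :=
          Finset.sum_le_sum fun j _ => mul_le_mul_of_nonneg_left (hlog j) (hp j)
      _ = Y := by
          have : ∀ j, p j * (h * a j + h ^ 2 / 2 * (b j - a j ^ 2) + c1 * h ^ 3 * s ^ 9)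
              = h * (p j * a j) + h ^ 2 / 2 * (p j * (b j - a j ^ 2))
                + p j * (c1 * h ^ 3 * s ^ 9) := fun j => by ring
          simp_rw [this, Finset.sum_add_distrib, ← Finset.mul_sum, ← Finset.sum_mul]
          rw [← hα, ← hβ, ← hP, hY, he]; ring
  have hl2 : ∑ j, p j * Real.log (r j) ≤ P * C := by
    rw [hP, Finset.sum_mul]
    refine Finset.sum_le_sum fun j _ => mul_le_mul_of_nonneg_left ?_ (hp j)
    linarith [Real.log_le_sub_one_of_pos (hr j), hrC j]
  rw [hprod]
  refine (exp_le_cubic (by positivity) hl1 hl2).trans ?_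
  have hYb : |Y| ≤ h * ((P * C + c2) * s ^ 9) := by
    have h2 : |Y| ≤ |h * α| + |h ^ 2 * e| := abs_add_le _ _
    rw [abs_mul, abs_mul, abs_of_nonneg h0, abs_of_nonneg (sq_nonneg h)] at h2
    have h3 : |α| ≤ P * C * s ^ 9 := hαb.trans
      (mul_le_mul_of_nonneg_left (by simpa using hspow (i := 1) (k := 9) (by norm_num))
        (by positivity))
    have h4 : h * |α| ≤ h * (P * C * s ^ 9) := by gcongr
    have h5 : h ^ 2 * |e| ≤ h * (c2 * s ^ 9) := by
      have : h ^ 2 ≤ h := by nlinarith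
      gcongr
    linarith
  have hY3 : |Y| ^ 3 ≤ h ^ 3 * ((P * C + c2) ^ 3 * s ^ 27) := by
    calc |Y| ^ 3 ≤ (h * ((P * C + c2) * s ^ 9)) ^ 3 := by gcongr
      _ = _ := by ring
  have hY2 : Y ^ 2 ≤ h ^ 2 * α ^ 2 + 2 * (h ^ 3 * ((P * C * c2 + c2 ^ 2) * s ^ 27)) := by
    have h2 : Y ^ 2 = h ^ 2 * α ^ 2 + 2 * (h ^ 3 * (α * e)) + h ^ 4 * e ^ 2 := by rw [hY]; ring
    have h3 : α * e ≤ P * C * c2 * s ^ 27 := by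
      calc α * e ≤ |α * e| := le_abs_self _
        _ ≤ (P * C * s) * (c2 * s ^ 9) := by rw [abs_mul]; gcongr
        _ = P * C * c2 * s ^ 10 := by ring
        _ ≤ _ := mul_le_mul_of_nonneg_left (hspow (by norm_num)) (by positivity)
    have h4 : h ^ 4 * e ^ 2 ≤ h ^ 3 * (c2 ^ 2 * s ^ 27) := by
      have h5 : e ^ 2 ≤ c2 ^ 2 * s ^ 27 := by
        calc e ^ 2 = |e| ^ 2 := (sq_abs e).symm
          _ ≤ (c2 * s ^ 9) ^ 2 := by gcongr
          _ = c2 ^ 2 * s ^ 18 := by ring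
          _ ≤ _ := mul_le_mul_of_nonneg_left (hspow (by norm_num)) (by positivity)
      have h6 : h ^ 4 ≤ h ^ 3 := pow_le_pow_of_le_one h0 h1 (by norm_num)
      gcongr
    have h7 := mul_le_mul_of_nonneg_left h3 (by positivity : 0 ≤ h ^ 3)
    have h8 : 0 ≤ h ^ 3 * (c2 ^ 2 * s ^ 27) := by positivity
    linarith
  have hK := mul_le_mul_of_nonneg_left hY3 (Real.exp_pos (P * C + 1)).le
  have hlast : P * c1 * h ^ 3 * s ^ 9 ≤ P * c1 * h ^ 3 * s ^ 27 :=
    mul_le_mul_of_nonneg_left (hspow (by norm_num)) (by positivity)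
  have hYe : Y = h * α + h ^ 2 / 2 * β + P * c1 * h ^ 3 * s ^ 9 := by rw [hY, he]; ring
  linarith

section TaylorExpansion
open ProbabilityTheory InnerProductSpace

variable {E : Type*} [NormedAddCommGroup E] [InnerProductSpace ℝ E] [FiniteDimensional ℝ E]
  [MeasurableSpace E] [BorelSpace E]

theorem integrable_one_add_norm_pow_stdGaussian (k : ℕ) :
    Integrable (fun z : E => (1 + ‖z‖) ^ k) (stdGaussian E) := by
  have h0 : MemLp (id : E → E) k (stdGaussian E) :=
    IsGaussian.memLp_id (stdGaussian E) k (by simp)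
  have h1 : MemLp ((fun _ : E => (1 : ℝ)) + fun z : E => ‖z‖) k (stdGaussian E) :=
    MemLp.add (memLp_const 1) h0.norm
  refine h1.integrable_norm_pow'.congr (ae_of_all _ fun z => ?_)
  simp only [Pi.add_apply, Real.norm_eq_abs]
  rw [abs_of_nonneg (by positivity)]

theorem integrable_stdGaussian_of_abs_le {f : E → ℝ} (hf : Continuous f) (K : ℝ) (k : ℕ)
    (hb : ∀ z, |f z| ≤ K * (1 + ‖z‖) ^ k) : Integrable f (stdGaussian E) :=
  ((integrable_one_add_norm_pow_stdGaussian k).const_mul K).mono'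
    hf.aestronglyMeasurable (ae_of_all _ hb)

theorem integral_inner_stdGaussian (v : E) : ∫ z, inner ℝ v z ∂(stdGaussian E) = 0 :=
  integral_strongDual_stdGaussian (innerSL ℝ v)

theorem integral_inner_sq_stdGaussian (v : E) :
    ∫ z, (inner ℝ v z) ^ 2 ∂(stdGaussian E) = ‖v‖ ^ 2 := by
  have h := variance_dual_stdGaussian (E := E) (innerSL ℝ v)
  rw [variance_of_integral_eq_zero (by fun_prop) (integral_strongDual_stdGaussian _)] at h
  simpa using h

/-- Uniformly bounded functions with a uniform second order Taylor expansion. -/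
def HasTaylorTwo (C : ℝ) (U : E → ℝ) : Prop :=
  Continuous U ∧ (∀ x, C⁻¹ ≤ U x) ∧ (∀ x, U x ≤ C) ∧
    ∃ (g : E → E) (H : E → E →L[ℝ] E →L[ℝ] ℝ), Continuous g ∧ Continuous H ∧
      (∀ x, ‖g x‖ ≤ C) ∧ (∀ x, ‖H x‖ ≤ C) ∧
      ∀ x v, |U (x + v) - U x - inner ℝ (g x) v - H x v v / 2| ≤ C * ‖v‖ ^ 3

/-- The average of `U` against a centred gaussian of standard deviation `h`. -/
noncomputable def gaussAvg (h : ℝ) (U : E → ℝ) (x : E) : ℝ :=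
  ∫ z, U (x + h • z) ∂(stdGaussian E)

theorem HasTaylorTwo.gaussAvg {C : ℝ} {U : E → ℝ} (hU : HasTaylorTwo C U) (h : ℝ) :
    HasTaylorTwo C (gaussAvg h U) := by
  obtain ⟨hc, hl, hu, g, H, hg, hH, hgC, hHC, hT⟩ := hU
  have hUb : ∀ x, ‖U x‖ ≤ |C⁻¹| + |C| := fun x => by
    rw [Real.norm_eq_abs, abs_le]
    constructor
    · linarith [hl x, neg_abs_le C⁻¹, abs_nonneg C]
    · linarith [hu x, le_abs_self C, abs_nonneg C⁻¹]
  have iU : ∀ x, Integrable (fun z => U (x + h • z)) (stdGaussian E) := fun x =>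
    Integrable.of_bound (by fun_prop) _ (ae_of_all _ fun z => hUb _)
  have ig : ∀ x, Integrable (fun z => g (x + h • z)) (stdGaussian E) := fun x =>
    Integrable.of_bound (by fun_prop) _ (ae_of_all _ fun z => hgC _)
  let _ : NormedAddCommGroup (E →L[ℝ] E →L[ℝ] ℝ) := ContinuousLinearMap.toNormedAddCommGroup
  have iH : ∀ x, Integrable (fun z => H (x + h • z)) (stdGaussian E) := fun x =>
    Integrable.of_bound (by fun_prop) _ (ae_of_all _ fun z => hHC _)
  have cst : ∀ c : ℝ, ∫ _, c ∂(stdGaussian E) = c := fun c => by simp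
  refine ⟨?_, ?_, ?_, fun x => ∫ z, g (x + h • z) ∂(stdGaussian E),
    fun x => ∫ z, H (x + h • z) ∂(stdGaussian E), ?_, ?_, ?_, ?_, ?_⟩
  · exact continuous_of_dominated (fun x => by fun_prop)
      (fun x => ae_of_all _ fun z => hUb _) (integrable_const _) (ae_of_all _ fun z => by fun_prop)
  · intro x
    rw [← cst C⁻¹]
    exact integral_mono (integrable_const _) (iU x) fun z => hl _
  · intro x
    conv_rhs => rw [← cst C]
    exact integral_mono (iU x) (integrable_const _) fun z => hu _
  · exact continuous_of_dominated (fun x => by fun_prop)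
      (fun x => ae_of_all _ fun z => hgC _) (integrable_const _) (ae_of_all _ fun z => by fun_prop)
  · exact continuous_of_dominated (fun x => by fun_prop)
      (fun x => ae_of_all _ fun z => hHC _) (integrable_const _) (ae_of_all _ fun z => by fun_prop)
  · intro x
    simpa using norm_integral_le_of_norm_le_const (μ := stdGaussian E) (ae_of_all _ fun z => hgC (x + h • z))
  · intro x
    simpa using norm_integral_le_of_norm_le_const (μ := stdGaussian E) (ae_of_all _ fun z => hHC (x + h • z))
  · intro x v
    have e1 : inner ℝ (∫ z, g (x + h • z) ∂(stdGaussian E)) v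
        = ∫ z, inner ℝ (g (x + h • z)) v ∂(stdGaussian E) := by
      rw [real_inner_comm, ← integral_inner (ig x)]
      simp_rw [real_inner_comm]
    have e2 : (∫ z, H (x + h • z) ∂(stdGaussian E)) v v
        = ∫ z, H (x + h • z) v v ∂(stdGaussian E) := by
      rw [ContinuousLinearMap.integral_apply (iH x),
        ContinuousLinearMap.integral_apply ((iH x).apply_continuousLinearMap v)]
    have i1 : Integrable (fun z => inner ℝ (g (x + h • z)) v) (stdGaussian E) :=
      (ig x).inner_const v
    have i2 : Integrable (fun z => H (x + h • z) v v) (stdGaussian E) :=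
      ((iH x).apply_continuousLinearMap v).apply_continuousLinearMap v
    have e3 : _root_.gaussAvg h U (x + v) - _root_.gaussAvg h U x
        - inner ℝ (∫ z, g (x + h • z) ∂(stdGaussian E)) v
        - (∫ z, H (x + h • z) ∂(stdGaussian E)) v v / 2
        = ∫ z, (U (x + h • z + v) - U (x + h • z) - inner ℝ (g (x + h • z)) v
            - H (x + h • z) v v / 2) ∂(stdGaussian E) := by
      rw [e1, e2, integral_sub, integral_sub, integral_sub, integral_div]
      · simp only [_root_.gaussAvg, add_right_comm]
      · simpa only [add_right_comm] using iU (x + v)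
      · exact iU x
      · exact (by simpa only [add_right_comm] using iU (x + v) : Integrable (fun z => U (x + h • z + v)) _).sub (iU x)
      · exact i1
      · exact ((by simpa only [add_right_comm] using iU (x + v) : Integrable (fun z => U (x + h • z + v)) _).sub (iU x)).sub i1
      · exact i2.div_const 2
    rw [e3, ← Real.norm_eq_abs]
    have hb : ∀ z, ‖U (x + h • z + v) - U (x + h • z) - inner ℝ (g (x + h • z)) v
        - H (x + h • z) v v / 2‖ ≤ C * ‖v‖ ^ 3 := fun z => by
      rw [Real.norm_eq_abs]; exact hT (x + h • z) v
    simpa using norm_integral_le_of_norm_le_const (μ := stdGaussian E) (ae_of_all _ hb)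

end TaylorExpansion

theorem norm_sum_adjoint_sq_le {E : Type*} [NormedAddCommGroup E] [InnerProductSpace ℝ E]
    [FiniteDimensional ℝ E] {m : ℕ} {F : Fin m → Type*} [∀ j, NormedAddCommGroup (F j)]
    [∀ j, InnerProductSpace ℝ (F j)] [∀ j, FiniteDimensional ℝ (F j)]
    (L : ∀ j, E →L[ℝ] F j) (p : Fin m → ℝ) (hp : ∀ j, 0 ≤ p j)
    (hLp : ∀ x, ∑ j, p j * ‖L j x‖ ^ 2 ≤ ‖x‖ ^ 2) (g : ∀ j, F j) :
    ‖∑ j, p j • (L j).adjoint (g j)‖ ^ 2 ≤ ∑ j, p j * ‖g j‖ ^ 2 := by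
  set v := ∑ j, p j • (L j).adjoint (g j) with hv
  have h1 : ‖v‖ ^ 2 = ∑ j, p j * inner ℝ (L j v) (g j) := by
    rw [← real_inner_self_eq_norm_sq]
    conv_lhs => rw [hv, sum_inner]
    refine Finset.sum_congr rfl fun j _ => ?_
    rw [← hv, real_inner_smul_left, ContinuousLinearMap.adjoint_inner_left, real_inner_comm]
  have h2 : ∀ j, p j * inner ℝ (L j v) (g j) ≤ p j * ‖L j v‖ ^ 2 / 2 + p j * ‖g j‖ ^ 2 / 2 := by
    intro j
    have := real_inner_le_norm (L j v) (g j)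
    nlinarith [hp j, sq_nonneg (‖L j v‖ - ‖g j‖), mul_nonneg (hp j) (sq_nonneg (‖L j v‖ - ‖g j‖)),
      mul_le_mul_of_nonneg_left this (hp j)]
  have h3 := Finset.sum_le_sum fun j (_ : j ∈ Finset.univ) => h2 j
  rw [← h1, Finset.sum_add_distrib, ← Finset.sum_div, ← Finset.sum_div] at h3
  linarith [hLp v]

theorem le_prod_rpow_of_second_order {m : ℕ} (p : Fin m → ℝ) (hp : ∀ j, 0 ≤ p j) {c K h : ℝ}
    (hc : 0 < c) (hK : 1 ≤ K) (h0 : 0 ≤ h) (h1 : h ≤ 1) (q β : Fin m → ℝ) (hq : ∀ j, c ≤ q j)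
    (hβ : ∀ j, |β j| ≤ K) (hr : ∀ j, |q j - 1 - h ^ 2 / 2 * β j| ≤ K * h ^ 3) :
    1 + h ^ 2 / 2 * ∑ j, p j * β j - (∑ j, p j) * (K + 4 * K ^ 2 / c) * h ^ 3
      ≤ ∏ j, q j ^ p j := by
  have hq0 : ∀ j, 0 < q j := fun j => hc.trans_le (hq j)
  have hlog : ∀ j, h ^ 2 / 2 * β j - (K + 4 * K ^ 2 / c) * h ^ 3 ≤ Real.log (q j) := by
    intro j
    have e1 := Real.one_sub_inv_le_log_of_pos (hq0 j)
    have e2 : 1 - (q j)⁻¹ = (q j - 1) - (q j - 1) ^ 2 / q j := by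
      have := (hq0 j).ne'
      field_simp; ring
    have h3 : h ^ 3 ≤ h ^ 2 := pow_le_pow_of_le_one h0 h1 (by norm_num)
    have h4 : h ^ 4 ≤ h ^ 3 := pow_le_pow_of_le_one h0 h1 (by norm_num)
    have e3 : |q j - 1| ≤ 2 * K * h ^ 2 := by
      have a1 := abs_le.1 (hr j)
      have a2 : |h ^ 2 / 2 * β j| ≤ h ^ 2 / 2 * K := by
        rw [abs_mul, abs_of_nonneg (by positivity)]
        exact mul_le_mul_of_nonneg_left (hβ j) (by positivity)
      have a2 := abs_le.1 a2
      rw [abs_le]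
      constructor <;> nlinarith [sq_nonneg h]
    have e4 : (q j - 1) ^ 2 / q j ≤ 4 * K ^ 2 / c * h ^ 3 := by
      have : (q j - 1) ^ 2 ≤ 4 * K ^ 2 * h ^ 3 := by
        rw [← sq_abs]
        calc |q j - 1| ^ 2 ≤ (2 * K * h ^ 2) ^ 2 := by gcongr
          _ = 4 * K ^ 2 * h ^ 4 := by ring
          _ ≤ _ := by gcongr
      calc (q j - 1) ^ 2 / q j ≤ 4 * K ^ 2 * h ^ 3 / c := by
            gcongr; exact hq j
        _ = _ := by ring
    have e5 := abs_le.1 (hr j)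
    linarith
  have : ∏ j, q j ^ p j = Real.exp (∑ j, p j * Real.log (q j)) := by
    rw [Real.exp_sum]
    exact Finset.prod_congr rfl fun j _ => by rw [Real.rpow_def_of_pos (hq0 j), mul_comm]
  rw [this]
  refine le_trans ?_ (Real.add_one_le_exp _)
  have : ∑ j, p j * (h ^ 2 / 2 * β j - (K + 4 * K ^ 2 / c) * h ^ 3)
      ≤ ∑ j, p j * Real.log (q j) :=
    Finset.sum_le_sum fun j _ => mul_le_mul_of_nonneg_left (hlog j) (hp j)
  have e : ∑ j, p j * (h ^ 2 / 2 * β j - (K + 4 * K ^ 2 / c) * h ^ 3)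
      = h ^ 2 / 2 * ∑ j, p j * β j - (∑ j, p j) * (K + 4 * K ^ 2 / c) * h ^ 3 := by
    simp only [mul_sub, Finset.sum_sub_distrib, Finset.mul_sum, Finset.sum_mul]
    congr 1 <;> exact Finset.sum_congr rfl fun j _ => by ring
  linarith

section SmallTimeEstimate
open ProbabilityTheory InnerProductSpace

variable {E : Type*} [NormedAddCommGroup E] [InnerProductSpace ℝ E] [FiniteDimensional ℝ E]
  [MeasurableSpace E] [BorelSpace E]

theorem map_stdGaussian_of_comp_adjoint {F : Type*} [NormedAddCommGroup F] [InnerProductSpace ℝ F]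
    [FiniteDimensional ℝ F] [MeasurableSpace F] [BorelSpace F] (L : E →L[ℝ] F)
    (hL : ∀ y, L (L.adjoint y) = y) : (stdGaussian E).map L = stdGaussian F := by
  apply Measure.ext_of_charFun
  ext t
  have hn : ‖L.adjoint t‖ = ‖t‖ := by
    have : ‖L.adjoint t‖ ^ 2 = ‖t‖ ^ 2 := by
      rw [← real_inner_self_eq_norm_sq, ContinuousLinearMap.adjoint_inner_left, hL,
        real_inner_self_eq_norm_sq]
    exact (sq_eq_sq₀ (norm_nonneg _) (norm_nonneg _)).1 this
  have : charFun ((stdGaussian E).map L) t = charFun (stdGaussian E) (L.adjoint t) := by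
    rw [charFun_apply, charFun_apply, integral_map (by fun_prop) (by fun_prop)]
    simp_rw [ContinuousLinearMap.adjoint_inner_right]
  rw [this, charFun_stdGaussian, charFun_stdGaussian, hn]

theorem gaussAvg_comp {F : Type*} [NormedAddCommGroup F] [InnerProductSpace ℝ F]
    [FiniteDimensional ℝ F] [MeasurableSpace F] [BorelSpace F] (L : E →L[ℝ] F)
    (hL : ∀ y, L (L.adjoint y) = y) {U : F → ℝ} (hU : Continuous U) (h : ℝ) (x : E) :
    gaussAvg h (fun x => U (L x)) x = gaussAvg h U (L x) := by
  rw [gaussAvg, gaussAvg, ← map_stdGaussian_of_comp_adjoint L hL,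
    integral_map (by fun_prop) (by fun_prop)]
  simp

theorem exists_gaussAvg_prod_le {m : ℕ} {F : Fin m → Type*} [∀ j, NormedAddCommGroup (F j)]
    [∀ j, InnerProductSpace ℝ (F j)] [∀ j, FiniteDimensional ℝ (F j)]
    [∀ j, MeasurableSpace (F j)] [∀ j, BorelSpace (F j)]
    (L : ∀ j, E →L[ℝ] F j) (hL : ∀ j y, L j ((L j).adjoint y) = y)
    (p : Fin m → ℝ) (hp : ∀ j, 0 ≤ p j)
    (hLp : ∀ x, ∑ j, p j * ‖L j x‖ ^ 2 ≤ ‖x‖ ^ 2) {C : ℝ} (hC : 1 ≤ C) :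
    ∃ D : ℝ, 0 ≤ D ∧ ∀ U : ∀ j, F j → ℝ, (∀ j, HasTaylorTwo C (U j)) →
      ∀ h : ℝ, 0 ≤ h → h ≤ 1 → ∀ x : E,
      gaussAvg h (fun x => ∏ j, U j (L j x) ^ p j) x
        ≤ (1 + D * h ^ 3) * ∏ j, gaussAvg h (U j) (L j x) ^ p j := by
  have hC2 : 1 ≤ C ^ 2 := one_le_pow₀ hC
  have hC0 : 0 < C := by linarith
  obtain ⟨D, hD0, hD⟩ := prod_rpow_le_second_order p hp hC2
  set M : ℝ := ∫ z : E, (1 + ‖z‖) ^ 27 ∂(stdGaussian E) with hM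
  have hMi := integrable_one_add_norm_pow_stdGaussian (E := E) 27
  have hM1 : 1 ≤ M := by
    have : ∫ _ : E, (1 : ℝ) ∂(stdGaussian E) = 1 := by simp
    rw [← this, hM]
    refine integral_mono (integrable_const _) hMi fun z => ?_
    exact one_le_pow₀ (by linarith [norm_nonneg z])
  set P := ∑ j, p j
  have hP : 0 ≤ P := Finset.sum_nonneg fun j _ => hp j
  set K := C ^ 2 * M
  have hK : 1 ≤ K := one_le_mul_of_one_le_of_one_le hC2 hM1
  set c0 := (C ^ 2)⁻¹
  have hc0 : 0 < c0 := by positivity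
  set D1 := D * M + P * (K + 4 * K ^ 2 / c0)
  have hD1 : 0 ≤ D1 := by positivity
  refine ⟨D1 / c0 ^ P, by positivity, fun U hU h h0 h1 x => ?_⟩
  have hcont := fun j => (hU j).1
  have hlow := fun j => (hU j).2.1
  have hup := fun j => (hU j).2.2.1
  choose g H hg hH hgC hHC hT using fun j => (hU j).2.2.2
  set u : Fin m → ℝ := fun j => U j (L j x)
  have hu0 : ∀ j, 0 < u j := fun j => (by positivity : 0 < C⁻¹).trans_le (hlow j _)
  have huinv : ∀ j, (u j)⁻¹ ≤ C := fun j => by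
    have := hlow j (L j x)
    rw [inv_le_comm₀ (hu0 j) hC0]; exact this
  have hLn : ∀ j z, ‖L j z‖ ≤ ‖z‖ := by
    intro j z
    have : ‖L j z‖ ^ 2 ≤ ‖z‖ * ‖L j z‖ := by
      have e : ‖(L j).adjoint (L j z)‖ ^ 2 = ‖L j z‖ ^ 2 := by
        rw [← real_inner_self_eq_norm_sq, ContinuousLinearMap.adjoint_inner_left, hL,
          real_inner_self_eq_norm_sq]
      have e' : ‖(L j).adjoint (L j z)‖ = ‖L j z‖ :=
        (sq_eq_sq₀ (norm_nonneg _) (norm_nonneg _)).1 e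
      calc ‖L j z‖ ^ 2 = inner ℝ z ((L j).adjoint (L j z)) := by
            rw [ContinuousLinearMap.adjoint_inner_right, real_inner_self_eq_norm_sq]
        _ ≤ ‖z‖ * ‖L j z‖ := by rw [← e']; exact real_inner_le_norm _ _
    nlinarith [norm_nonneg (L j z), norm_nonneg z]
  let v : Fin m → E := fun j => (u j)⁻¹ • (L j).adjoint (g j (L j x))
  let a : Fin m → E → ℝ := fun j z => inner ℝ (v j) z
  let b : Fin m → E → ℝ := fun j z => (u j)⁻¹ * H j (L j x) (L j z) (L j z)
  let r : Fin m → E → ℝ := fun j z => (u j)⁻¹ * U j (L j (x + h • z))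
  have ha : ∀ j z, a j z = (u j)⁻¹ * inner ℝ (g j (L j x)) (L j z) := fun j z => by
    simp only [a, v, real_inner_smul_left, ContinuousLinearMap.adjoint_inner_left]
  have ha_le : ∀ j z, |a j z| ≤ C ^ 2 * (1 + ‖z‖) := by
    intro j z
    rw [ha, abs_mul, abs_of_pos (inv_pos.2 (hu0 j)), pow_two, mul_assoc]
    have := (abs_real_inner_le_norm (g j (L j x)) (L j z)).trans
      (mul_le_mul (hgC j _) (hLn j z) (norm_nonneg _) hC0.le)
    refine mul_le_mul (huinv j) (this.trans ?_) (abs_nonneg _) hC0.le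
    gcongr; linarith
  have hb_le : ∀ j z, |b j z| ≤ C ^ 2 * (1 + ‖z‖) ^ 2 := by
    intro j z
    simp only [b]
    rw [abs_mul, abs_of_pos (inv_pos.2 (hu0 j)), pow_two C, mul_assoc]
    have e : |H j (L j x) (L j z) (L j z)| ≤ C * ‖z‖ ^ 2 := by
      rw [← Real.norm_eq_abs, pow_two, ← mul_assoc]
      refine ((H j (L j x)).le_opNorm₂ _ _).trans ?_
      gcongr
      · exact hHC j _
      · exact hLn j z
      · exact hLn j z
    refine mul_le_mul (huinv j) (e.trans ?_) (abs_nonneg _) hC0.le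
    gcongr; linarith
  have hr0 : ∀ j z, 0 < r j z := fun j z =>
    mul_pos (inv_pos.2 (hu0 j)) ((by positivity : 0 < C⁻¹).trans_le (hlow j _))
  have hrC : ∀ j z, r j z ≤ C ^ 2 := fun j z => by
    rw [pow_two]
    exact mul_le_mul (huinv j) (hup j _) ((by positivity : 0 < C⁻¹).le.trans (hlow j _)) hC0.le
  have hrem : ∀ j z, |r j z - 1 - h * a j z - h ^ 2 / 2 * b j z| ≤ C ^ 2 * h ^ 3 * (1 + ‖z‖) ^ 3 := by
    intro j z
    have e : r j z - 1 - h * a j z - h ^ 2 / 2 * b j z = (u j)⁻¹ * (U j (L j x + L j (h • z))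
        - U j (L j x) - inner ℝ (g j (L j x)) (L j (h • z))
        - H j (L j x) (L j (h • z)) (L j (h • z)) / 2) := by
      rw [ha]
      simp only [r, b, map_add, map_smul, real_inner_smul_right, smul_eq_mul,
        smul_apply]
      have := (hu0 j).ne'
      have e1 : (1 : ℝ) = (u j)⁻¹ * U j (L j x) := by
        rw [inv_mul_cancel₀]; exact this
      linear_combination -e1
    rw [e, abs_mul, abs_of_pos (inv_pos.2 (hu0 j)), pow_two, mul_assoc, mul_assoc]
    refine mul_le_mul (huinv j) ((hT j _ _).trans ?_) (abs_nonneg _) hC0.le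
    have : ‖L j (h • z)‖ ≤ h * (1 + ‖z‖) := by
      refine (hLn j _).trans ?_
      rw [norm_smul, Real.norm_of_nonneg h0]
      gcongr; linarith
    rw [← mul_pow]
    gcongr
  have hac : ∀ j, Continuous (a j) := fun j => by fun_prop
  have hbc : ∀ j, Continuous (b j) := fun j => by fun_prop
  have hrc : ∀ j, Continuous (r j) := fun j => by
    have := hcont j
    fun_prop
  have hai : ∀ j, Integrable (a j) (stdGaussian E) := fun j =>
    integrable_stdGaussian_of_abs_le (hac j) (C ^ 2) 1 (by simpa using ha_le j)
  have hbi : ∀ j, Integrable (b j) (stdGaussian E) := fun j =>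
    integrable_stdGaussian_of_abs_le (hbc j) (C ^ 2) 2 (hb_le j)
  have hri : ∀ j, Integrable (r j) (stdGaussian E) := fun j =>
    integrable_stdGaussian_of_abs_le (hrc j) (C ^ 2) 0 fun z => by
      rw [abs_of_pos (hr0 j z)]; simpa using hrC j z
  have ha2i : ∀ w : E, Integrable (fun z => (inner ℝ w z) ^ 2) (stdGaussian E) := fun w =>
    integrable_stdGaussian_of_abs_le (by fun_prop) (‖w‖ ^ 2) 2 fun z => by
      rw [abs_pow, ← mul_pow]
      refine pow_le_pow_left₀ (abs_nonneg _) ((abs_real_inner_le_norm w z).trans ?_) 2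
      gcongr; linarith
  set β : Fin m → ℝ := fun j => ∫ z, b j z ∂(stdGaussian E)
  set q : Fin m → ℝ := fun j => ∫ z, r j z ∂(stdGaussian E)
  have hmom : ∀ k ≤ 27, ∫ z : E, (1 + ‖z‖) ^ k ∂(stdGaussian E) ≤ M := fun k hk =>
    integral_mono (integrable_one_add_norm_pow_stdGaussian k) hMi fun z =>
      pow_le_pow_right₀ (by linarith [norm_nonneg z]) hk
  have hβK : ∀ j, |β j| ≤ K := by
    intro j
    have h1 : |β j| ≤ ∫ z : E, C ^ 2 * (1 + ‖z‖) ^ 2 ∂(stdGaussian E) := by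
      rw [← Real.norm_eq_abs]
      exact norm_integral_le_of_norm_le
        ((integrable_one_add_norm_pow_stdGaussian 2).const_mul _) (ae_of_all _ (hb_le j))
    rw [integral_const_mul] at h1
    exact h1.trans (mul_le_mul_of_nonneg_left (hmom 2 (by norm_num)) (by positivity))
  have hint_a : ∀ j, ∫ z, a j z ∂(stdGaussian E) = 0 := fun j => integral_inner_stdGaussian _
  have hqK : ∀ j, |q j - 1 - h ^ 2 / 2 * β j| ≤ K * h ^ 3 := by
    intro j
    have e : q j - 1 - h ^ 2 / 2 * β j
        = ∫ z, (r j z - 1 - h * a j z - h ^ 2 / 2 * b j z) ∂(stdGaussian E) := by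
      have k1 : Integrable (fun z => r j z - 1) (stdGaussian E) := (hri j).sub (integrable_const 1)
      have k2 : Integrable (fun z => r j z - 1 - h * a j z) (stdGaussian E) :=
        k1.sub ((hai j).const_mul h)
      rw [integral_sub k2 ((hbi j).const_mul _), integral_sub k1 ((hai j).const_mul h),
        integral_sub (hri j) (integrable_const 1), integral_const_mul h,
        integral_const_mul (h ^ 2 / 2), hint_a]
      simp [q, β]
    have h1 : |q j - 1 - h ^ 2 / 2 * β j|
        ≤ ∫ z : E, C ^ 2 * h ^ 3 * (1 + ‖z‖) ^ 3 ∂(stdGaussian E) := by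
      rw [e, ← Real.norm_eq_abs]
      exact norm_integral_le_of_norm_le
        ((integrable_one_add_norm_pow_stdGaussian 3).const_mul _) (ae_of_all _ (hrem j))
    rw [integral_const_mul] at h1
    have := mul_le_mul_of_nonneg_left (hmom 3 (by norm_num)) (by positivity : 0 ≤ C ^ 2 * h ^ 3)
    simp only [K]
    linarith
  have hqc : ∀ j, c0 ≤ q j := by
    intro j
    have : ∫ _ : E, c0 ∂(stdGaussian E) = c0 := by simp
    rw [← this]
    refine integral_mono (integrable_const _) (hri j) fun z => ?_
    have h1 : C⁻¹ ≤ (u j)⁻¹ := inv_anti₀ (hu0 j) (hup j _)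
    simp only [c0, r, pow_two, mul_inv]
    exact mul_le_mul h1 (hlow j _) (by positivity) (inv_pos.2 (hu0 j)).le
  have hlower := le_prod_rpow_of_second_order p hp hc0 hK h0 h1 q β hqc hβK hqK
  have hq0 : ∀ j, 0 < q j := fun j => hc0.trans_le (hqc j)
  have hqprod : c0 ^ P ≤ ∏ j, q j ^ p j := by
    rw [Real.rpow_sum_of_pos hc0]
    exact Finset.prod_le_prod (fun j _ => by positivity) fun j _ =>
      Real.rpow_le_rpow hc0.le (hqc j) (hp j)
  -- the second order term
  have hsum : ∫ z, (∑ j, p j * a j z) ^ 2 ∂(stdGaussian E)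
      ≤ ∑ j, p j * ∫ z, (a j z) ^ 2 ∂(stdGaussian E) := by
    have e : ∀ z, ∑ j, p j * a j z = inner ℝ (∑ j, p j • v j) z := fun z => by
      simp [sum_inner, real_inner_smul_left, a]
    simp_rw [e, a, integral_inner_sq_stdGaussian]
    have := norm_sum_adjoint_sq_le L p hp hLp fun j => (u j)⁻¹ • g j (L j x)
    simp only [map_smul] at this
    refine this.trans (le_of_eq (Finset.sum_congr rfl fun j _ => ?_))
    congr 1
    simp only [v]
    rw [← map_smul, ← real_inner_self_eq_norm_sq ((L j).adjoint _),
      ContinuousLinearMap.adjoint_inner_left, hL, real_inner_self_eq_norm_sq]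
  have hupper : ∫ z, ∏ j, r j z ^ p j ∂(stdGaussian E)
      ≤ 1 + h ^ 2 / 2 * ∑ j, p j * β j + D * M * h ^ 3 := by
    have hi1 : Integrable (fun z => ∑ j, p j * a j z) (stdGaussian E) :=
      integrable_finsetSum _ fun j _ => (hai j).const_mul _
    have hba : ∀ j, Integrable (fun z => p j * (b j z - a j z ^ 2)) (stdGaussian E) := fun j =>
      ((hbi j).sub (ha2i (v j))).const_mul _
    have hi2 : Integrable (fun z => ∑ j, p j * (b j z - a j z ^ 2)) (stdGaussian E) :=
      integrable_finsetSum _ fun j _ => hba j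
    have hi3 : Integrable (fun z => (∑ j, p j * a j z) ^ 2) (stdGaussian E) := by
      have e : ∀ z, ∑ j, p j * a j z = inner ℝ (∑ j, p j • v j) z := fun z => by
        simp [sum_inner, real_inner_smul_left, a]
      simp_rw [e]
      exact ha2i _
    have hprodi : Integrable (fun z => ∏ j, r j z ^ p j) (stdGaussian E) := by
      refine integrable_stdGaussian_of_abs_le
        (continuous_finsetProd _ fun j _ => (hrc j).rpow_const fun z => Or.inl (hr0 j z).ne')
        (∏ j, (C ^ 2) ^ p j) 0 fun z => ?_
      rw [Finset.abs_prod, pow_zero, mul_one]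
      refine Finset.prod_le_prod (fun j _ => abs_nonneg _) fun j _ => ?_
      rw [abs_of_nonneg (Real.rpow_nonneg (hr0 j z).le _)]
      exact Real.rpow_le_rpow (hr0 j z).le (hrC j z) (hp j)
    have hpt : ∀ z, ∏ j, r j z ^ p j ≤ 1 + h * ∑ j, p j * a j z
        + h ^ 2 / 2 * (∑ j, p j * (b j z - a j z ^ 2) + (∑ j, p j * a j z) ^ 2)
        + D * h ^ 3 * (1 + ‖z‖) ^ 27 := fun z =>
      hD h (1 + ‖z‖) (fun j => a j z) (fun j => b j z) (fun j => r j z) h0 h1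
        (by linarith [norm_nonneg z]) (fun j => hr0 j z) (fun j => hrC j z)
        (fun j => ha_le j z) (fun j => hb_le j z) (fun j => hrem j z)
    have k1 : Integrable (fun z => 1 + h * ∑ j, p j * a j z) (stdGaussian E) :=
      (integrable_const 1).add (hi1.const_mul h)
    have k2 : Integrable (fun z => ∑ j, p j * (b j z - a j z ^ 2) + (∑ j, p j * a j z) ^ 2)
      (stdGaussian E) := hi2.add hi3
    have k3 : Integrable (fun z => 1 + h * ∑ j, p j * a j z
        + h ^ 2 / 2 * (∑ j, p j * (b j z - a j z ^ 2) + (∑ j, p j * a j z) ^ 2)) (stdGaussian E) :=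
      k1.add (k2.const_mul _)
    refine (integral_mono hprodi (k3.add (hMi.const_mul _)) hpt).trans ?_
    have e1 : ∫ z, ∑ j, p j * a j z ∂(stdGaussian E) = 0 := by
      rw [integral_finsetSum _ fun j _ => (hai j).const_mul _]
      simp [integral_const_mul, hint_a]
    have e2 : ∫ z, ∑ j, p j * (b j z - a j z ^ 2) ∂(stdGaussian E)
        = ∑ j, p j * β j - ∑ j, p j * ∫ z, (a j z) ^ 2 ∂(stdGaussian E) := by
      rw [integral_finsetSum _ fun j _ => hba j,
        ← Finset.sum_sub_distrib]
      refine Finset.sum_congr rfl fun j _ => ?_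
      rw [integral_const_mul, integral_sub (hbi j) (ha2i (v j)), mul_sub]
    simp only [Pi.add_apply]
    rw [integral_add k3 (hMi.const_mul _), integral_add k1 (k2.const_mul _),
      integral_add (integrable_const 1) (hi1.const_mul h), integral_const_mul, integral_const_mul,
      integral_const_mul, integral_add hi2 hi3, e1, e2]
    simp only [integral_const, probReal_univ, smul_eq_mul, one_mul]
    rw [← hM]
    nlinarith [mul_le_mul_of_nonneg_left hsum (by positivity : 0 ≤ h ^ 2 / 2)]
  have hkey : ∫ z, ∏ j, r j z ^ p j ∂(stdGaussian E)
      ≤ (1 + D1 / c0 ^ P * h ^ 3) * ∏ j, q j ^ p j := by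
    have h3 : D1 * h ^ 3 ≤ D1 / c0 ^ P * h ^ 3 * ∏ j, q j ^ p j := by
      have hcp : 0 < c0 ^ P := by positivity
      calc D1 * h ^ 3 = D1 / c0 ^ P * h ^ 3 * c0 ^ P := by field_simp
        _ ≤ _ := by gcongr
    simp only [D1] at h3 ⊢
    linarith
  -- scale back
  have hfac : ∀ z, ∏ j, U j (L j (x + h • z)) ^ p j = (∏ j, u j ^ p j) * ∏ j, r j z ^ p j := by
    intro z
    rw [← Finset.prod_mul_distrib]
    refine Finset.prod_congr rfl fun j _ => ?_
    rw [← Real.mul_rpow (hu0 j).le (hr0 j z).le]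
    simp only [r]
    rw [mul_inv_cancel_left₀ (hu0 j).ne']
  have hfacq : ∀ j, gaussAvg h (U j) (L j x) = u j * q j := by
    intro j
    rw [← gaussAvg_comp (L j) (hL j) (hcont j)]
    simp only [q, r, gaussAvg]
    rw [integral_const_mul, mul_inv_cancel_left₀ (hu0 j).ne']
  have hlhs : gaussAvg h (fun x => ∏ j, U j (L j x) ^ p j) x
      = (∏ j, u j ^ p j) * ∫ z, ∏ j, r j z ^ p j ∂(stdGaussian E) := by
    rw [gaussAvg, ← integral_const_mul]
    exact integral_congr_ae (ae_of_all _ hfac)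
  rw [hlhs]
  simp_rw [hfacq, fun j => Real.mul_rpow (z := p j) (hu0 j).le (hq0 j).le]
  rw [Finset.prod_mul_distrib, mul_left_comm]
  exact mul_le_mul_of_nonneg_left hkey
    (Finset.prod_nonneg fun j _ => Real.rpow_nonneg (hu0 j).le _)

end SmallTimeEstimate

section Semigroup
open ProbabilityTheory InnerProductSpace

variable {E : Type*} [NormedAddCommGroup E] [InnerProductSpace ℝ E] [FiniteDimensional ℝ E]
  [MeasurableSpace E] [BorelSpace E]

theorem gaussAvg_gaussAvg {U : E → ℝ} (hU : Continuous U) {B : ℝ} (hB : ∀ x, |U x| ≤ B)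
    {h k c : ℝ} (hc : c ^ 2 = h ^ 2 + k ^ 2) (x : E) :
    gaussAvg h (gaussAvg k U) x = gaussAvg c U x := by
  have hmeas : ((stdGaussian E).map (h • ·)) ∗ ((stdGaussian E).map (k • ·))
      = (stdGaussian E).map (c • ·) := by
    have : IsProbabilityMeasure ((stdGaussian E).map (h • ·)) :=
      Measure.isProbabilityMeasure_map (by fun_prop)
    have : IsProbabilityMeasure ((stdGaussian E).map (k • ·)) :=
      Measure.isProbabilityMeasure_map (by fun_prop)
    have : IsProbabilityMeasure ((stdGaussian E).map (c • ·)) :=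
      Measure.isProbabilityMeasure_map (by fun_prop)
    apply Measure.ext_of_charFun
    ext t
    rw [charFun_conv, charFun_map_smul, charFun_map_smul, charFun_map_smul, charFun_stdGaussian,
      charFun_stdGaussian, charFun_stdGaussian, ← Complex.exp_add]
    congr 1
    simp only [norm_smul, Real.norm_eq_abs, Complex.ofReal_mul, mul_pow]
    norm_cast
    rw [sq_abs, sq_abs, sq_abs, hc]
    ring
  have e : gaussAvg c U x = ∫ z, U (x + z) ∂((stdGaussian E).map (c • ·)) := by
    rw [integral_map (by fun_prop) (by fun_prop)]; rfl
  have i1 : IsProbabilityMeasure ((stdGaussian E).map (h • ·)) :=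
      Measure.isProbabilityMeasure_map (by fun_prop)
  have i2 : IsProbabilityMeasure ((stdGaussian E).map (k • ·)) :=
      Measure.isProbabilityMeasure_map (by fun_prop)
  rw [e, ← hmeas, integral_conv
    (Integrable.of_bound (by fun_prop) B (ae_of_all _ fun z => hB _)), gaussAvg]
  have hc2 : Continuous fun y : E => ∫ w, U (x + (y + w)) ∂((stdGaussian E).map (k • ·)) :=
    continuous_of_dominated (fun x => by fun_prop)
      (fun x => ae_of_all _ fun z => hB _) (integrable_const _) (ae_of_all _ fun z => by fun_prop)
  rw [integral_map (by fun_prop) hc2.aestronglyMeasurable]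
  refine integral_congr_ae (ae_of_all _ fun z => ?_)
  simp only [gaussAvg]
  rw [integral_map (by fun_prop) (by fun_prop)]
  simp only [add_assoc]

theorem continuous_gaussAvg {U : E → ℝ} (hU : Continuous U) {B : ℝ} (hB : ∀ x, |U x| ≤ B) (h : ℝ) :
    Continuous (gaussAvg h U) :=
  continuous_of_dominated (fun x => by fun_prop)
    (fun x => ae_of_all _ fun z => hB _) (integrable_const _) (ae_of_all _ fun z => by fun_prop)

theorem abs_gaussAvg_le {U : E → ℝ} {B : ℝ} (hB : ∀ x, |U x| ≤ B) (h : ℝ) (x : E) :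
    |gaussAvg h U x| ≤ B := by
  have hb : ∀ᵐ z ∂(stdGaussian E), ‖U (x + h • z)‖ ≤ B := ae_of_all _ fun z => hB _
  simpa [gaussAvg] using norm_integral_le_of_norm_le_const hb

theorem integrable_gaussAvg {U : E → ℝ} (hU : Continuous U) {B : ℝ} (hB : ∀ x, |U x| ≤ B) (h : ℝ)
    (x : E) : Integrable (fun z => U (x + h • z)) (stdGaussian E) :=
  Integrable.of_bound (by fun_prop) B (ae_of_all _ fun z => hB _)

theorem HasTaylorTwo.abs_le {V : Type*} [NormedAddCommGroup V] [InnerProductSpace ℝ V] {C : ℝ}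
    {U : V → ℝ} (hC : 1 ≤ C) (hU : HasTaylorTwo C U) (x : V) : |U x| ≤ C := by
  have := hU.2.1 x
  have : 0 < C⁻¹ := by positivity
  rw [abs_of_pos (by linarith)]
  exact hU.2.2.1 x

theorem gaussAvg_prod_le {m : ℕ} {F : Fin m → Type*} [∀ j, NormedAddCommGroup (F j)]
    [∀ j, InnerProductSpace ℝ (F j)] [∀ j, FiniteDimensional ℝ (F j)]
    [∀ j, MeasurableSpace (F j)] [∀ j, BorelSpace (F j)]
    (L : ∀ j, E →L[ℝ] F j) (hL : ∀ j y, L j ((L j).adjoint y) = y)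
    (p : Fin m → ℝ) (hp : ∀ j, 0 ≤ p j)
    (hLp : ∀ x, ∑ j, p j * ‖L j x‖ ^ 2 ≤ ‖x‖ ^ 2) {C : ℝ} (hC : 1 ≤ C)
    (U : ∀ j, F j → ℝ) (hU : ∀ j, HasTaylorTwo C (U j)) :
    ∫ z, ∏ j, U j (L j z) ^ p j ∂(stdGaussian E)
      ≤ ∏ j, (∫ y, U j y ∂(stdGaussian (F j))) ^ p j := by
  obtain ⟨D, hD0, hD⟩ := exists_gaussAvg_prod_le L hL p hp hLp hC
  have hprodc : ∀ U : ∀ j, F j → ℝ, (∀ j, HasTaylorTwo C (U j)) →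
      Continuous (fun z => ∏ j, U j (L j z) ^ p j) ∧
      ∀ z, |∏ j, U j (L j z) ^ p j| ≤ ∏ j, C ^ p j := by
    intro U hU
    have hpos : ∀ j z, 0 < U j z := fun j z =>
      (by positivity : 0 < C⁻¹).trans_le ((hU j).2.1 z)
    refine ⟨continuous_finsetProd _ fun j _ => ?_, fun z => ?_⟩
    · exact ((hU j).1.comp (L j).continuous).rpow_const fun z => Or.inl (hpos j _).ne'
    · rw [Finset.abs_prod]
      refine Finset.prod_le_prod (fun j _ => abs_nonneg _) fun j _ => ?_
      rw [abs_of_nonneg (Real.rpow_nonneg (hpos j _).le _)]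
      exact Real.rpow_le_rpow (hpos j _).le ((hU j).2.2.1 _) (hp j)
  have hiter : ∀ h : ℝ, 0 ≤ h → h ≤ 1 → ∀ k : ℕ, ∀ x,
      gaussAvg (√k * h) (fun x => ∏ j, U j (L j x) ^ p j) x
        ≤ (1 + D * h ^ 3) ^ k * ∏ j, gaussAvg (√k * h) (U j) (L j x) ^ p j := by
    intro h h0 h1 k
    induction k with
    | zero => intro x; simp [gaussAvg]
    | succ k ih =>
      intro x
      have hs : (√((k + 1 : ℕ) : ℝ) * h) ^ 2 = h ^ 2 + (√(k : ℝ) * h) ^ 2 := by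
        rw [mul_pow, mul_pow, Real.sq_sqrt (by positivity), Real.sq_sqrt (by positivity)]
        push_cast; ring
      have hV : ∀ j, HasTaylorTwo C (gaussAvg (√(k : ℝ) * h) (U j)) := fun j => (hU j).gaussAvg _
      rw [← gaussAvg_gaussAvg (hprodc U hU).1 (hprodc U hU).2 hs]
      have step : gaussAvg h (gaussAvg (√(k : ℝ) * h) fun x => ∏ j, U j (L j x) ^ p j) x
          ≤ (1 + D * h ^ 3) ^ k *
            gaussAvg h (fun x => ∏ j, gaussAvg (√(k : ℝ) * h) (U j) (L j x) ^ p j) x := by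
        simp only [gaussAvg.eq_1 h]
        rw [← integral_const_mul]
        have h1' := integrable_gaussAvg (continuous_gaussAvg (hprodc U hU).1 (hprodc U hU).2
          (√(k : ℝ) * h)) (abs_gaussAvg_le (hprodc U hU).2 _) h x
        exact integral_mono h1'
          ((integrable_gaussAvg (hprodc _ hV).1 (hprodc _ hV).2 h x).const_mul _) fun z => ih _
      refine step.trans ?_
      have := hD _ hV h h0 h1 x
      rw [pow_succ (1 + D * h ^ 3), mul_assoc]
      refine mul_le_mul_of_nonneg_left (this.trans (le_of_eq ?_)) (by positivity)
      congr 1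
      refine Finset.prod_congr rfl fun j _ => ?_
      rw [gaussAvg_gaussAvg (hU j).1 ((hU j).abs_le hC) hs]
  have hk : ∀ k : ℕ, 0 < k → ∫ z, ∏ j, U j (L j z) ^ p j ∂(stdGaussian E)
      ≤ Real.exp (D * (√(k : ℝ))⁻¹) * ∏ j, (∫ y, U j y ∂(stdGaussian (F j))) ^ p j := by
    intro k hk
    have hk1 : (1 : ℝ) ≤ √(k : ℝ) := by
      rw [Real.one_le_sqrt]; exact_mod_cast hk
    have := hiter (√(k : ℝ))⁻¹ (by positivity) (inv_le_one_of_one_le₀ hk1) k 0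
    rw [mul_inv_cancel₀ (by positivity)] at this
    simp only [gaussAvg, zero_add, one_smul, map_zero] at this
    refine this.trans (mul_le_mul_of_nonneg_right ?_ (Finset.prod_nonneg fun j _ =>
      Real.rpow_nonneg (integral_nonneg fun y => ?_) _))
    · calc (1 + D * (√(k : ℝ))⁻¹ ^ 3) ^ k ≤ (Real.exp (D * (√(k : ℝ))⁻¹ ^ 3)) ^ k := by
            gcongr
            rw [add_comm]; exact Real.add_one_le_exp _
        _ = Real.exp (D * (√(k : ℝ))⁻¹) := by
            rw [← Real.exp_nat_mul]
            congr 1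
            have : (k : ℝ) = √(k : ℝ) ^ 2 := (Real.sq_sqrt (by positivity)).symm
            rw [show (k : ℝ) * (D * (√(k : ℝ))⁻¹ ^ 3) = √(k : ℝ) ^ 2 * (D * (√(k : ℝ))⁻¹ ^ 3) by
              rw [← this]]
            field_simp
    · exact (by positivity : 0 ≤ C⁻¹).trans ((hU j).2.1 y)
  have hlim : Filter.Tendsto (fun k : ℕ => Real.exp (D * (√(k : ℝ))⁻¹) *
      ∏ j, (∫ y, U j y ∂(stdGaussian (F j))) ^ p j) Filter.atTop
      (nhds (Real.exp (D * 0) * ∏ j, (∫ y, U j y ∂(stdGaussian (F j))) ^ p j)) := by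
    refine ((Real.continuous_exp.tendsto _).comp (Filter.Tendsto.const_mul D ?_)).mul_const _
    exact tendsto_inv_atTop_zero.comp (Real.tendsto_sqrt_atTop.comp tendsto_natCast_atTop_atTop)
  rw [mul_zero, Real.exp_zero, one_mul] at hlim
  exact ge_of_tendsto hlim (Filter.eventually_atTop.2 ⟨1, fun k hk' => hk k hk'⟩)

end Semigroup

section Density
open ProbabilityTheory InnerProductSpace Filter Topology
open scoped ContDiff

theorem exists_fderiv_bound_of_hasCompactSupport {F G : Type*} [NormedAddCommGroup F]
    [NormedSpace ℝ F] [FiniteDimensional ℝ F] [NormedAddCommGroup G] [NormedSpace ℝ G]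
    {f : F → G} (hf : ContDiff ℝ ∞ f) (hs : HasCompactSupport f) :
    ∃ C : ℝ, 0 ≤ C ∧ (∀ x, ‖fderiv ℝ f x‖ ≤ C) ∧
      ∀ x y, ‖fderiv ℝ f x - fderiv ℝ f y‖ ≤ C * ‖x - y‖ := by
  have hd : ContDiff ℝ ∞ (fderiv ℝ f) := hf.fderiv_right (by norm_cast)
  obtain ⟨C, hC⟩ := (hs.fderiv ℝ).exists_bound_of_continuous hd.continuous
  obtain ⟨K, hK⟩ := ContDiff.lipschitzWith_of_hasCompactSupport (hs.fderiv ℝ) hd (by simp)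
  have hC0 : 0 ≤ C := (norm_nonneg _).trans (hC 0)
  have hK0 : (0 : ℝ) ≤ K := K.2
  refine ⟨C + K, by positivity, fun x => (hC x).trans (by linarith), fun x y => ?_⟩
  refine (hK.norm_sub_le x y).trans ?_
  gcongr
  linarith

theorem exists_hasTaylorTwo_of_contDiff {F : Type*} [NormedAddCommGroup F]
    [InnerProductSpace ℝ F] [FiniteDimensional ℝ F] {u : F → ℝ} (hu : ContDiff ℝ ∞ u)
    (hs : HasCompactSupport u) (h0 : ∀ x, 0 ≤ u x) {ε : ℝ} (hε : 0 < ε) :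
    ∃ C, 1 ≤ C ∧ HasTaylorTwo C (fun x => u x + ε) := by
  have hd1 : ContDiff ℝ ∞ (fderiv ℝ u) := hu.fderiv_right (by norm_cast)
  have hd2 : ContDiff ℝ ∞ (fderiv ℝ (fderiv ℝ u)) := hd1.fderiv_right (by norm_cast)
  obtain ⟨C0, hC0⟩ := hs.exists_bound_of_continuous hu.continuous
  obtain ⟨C1, n1, hC1, -⟩ := exists_fderiv_bound_of_hasCompactSupport hu hs
  obtain ⟨C2, n2, hC2, hC3⟩ := exists_fderiv_bound_of_hasCompactSupport hd1 (hs.fderiv ℝ)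
  have n0 : 0 ≤ C0 := (norm_nonneg _).trans (hC0 0)
  have n4 : 0 < ε⁻¹ := by positivity
  set C := 1 + C0 + C1 + C2 + ε + ε⁻¹ with hC
  refine ⟨C, by linarith, by fun_prop, fun x => ?_, fun x => ?_,
    fun x => (toDual ℝ F).symm (fderiv ℝ u x), fderiv ℝ (fderiv ℝ u), ?_, hd2.continuous,
    fun x => ?_, fun x => ?_, fun x v => ?_⟩
  · have : C⁻¹ ≤ ε := by
      rw [inv_le_comm₀ (by linarith) hε]; linarith
    linarith [h0 x]
  · have := (le_abs_self _).trans (hC0 x)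
    linarith
  · exact (toDual ℝ F).symm.continuous.comp hd1.continuous
  · rw [LinearIsometryEquiv.norm_map]
    linarith [hC1 x]
  · linarith [hC2 x]
  · rw [toDual_symm_apply]
    have hline : ∀ t : ℝ, HasDerivAt (fun t : ℝ => x + t • v) v t := fun t => by
      simpa using ((hasDerivAt_id t).smul_const v).const_add x
    let φ : ℝ → ℝ := fun t => u (x + t • v) - t * fderiv ℝ u x v
      - t ^ 2 / 2 * fderiv ℝ (fderiv ℝ u) x v v
    let φ' : ℝ → ℝ := fun t => fderiv ℝ u (x + t • v) v - fderiv ℝ u x v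
      - t * fderiv ℝ (fderiv ℝ u) x v v
    let φ'' : ℝ → ℝ := fun t => fderiv ℝ (fderiv ℝ u) (x + t • v) v v
      - fderiv ℝ (fderiv ℝ u) x v v
    have hφ : ∀ t, HasDerivAt φ (φ' t) t := fun t => by
      have e1 : HasDerivAt (fun t : ℝ => u (x + t • v)) (fderiv ℝ u (x + t • v) v) t :=
        ((hu.differentiable (by simp) _).hasFDerivAt).comp_hasDerivAt t (hline t)
      have e2 := (e1.sub ((hasDerivAt_id t).mul_const (fderiv ℝ u x v))).sub
        ((((hasDerivAt_id t).pow 2).div_const 2).mul_const (fderiv ℝ (fderiv ℝ u) x v v))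
      convert! e2 using 1
      simp [φ']
    have hφ' : ∀ t, HasDerivAt φ' (φ'' t) t := fun t => by
      have e1 : HasDerivAt (fun t : ℝ => fderiv ℝ u (x + t • v))
          (fderiv ℝ (fderiv ℝ u) (x + t • v) v) t :=
        ((hd1.differentiable (by simp) _).hasFDerivAt).comp_hasDerivAt t (hline t)
      have e2 := ((e1.clm_apply (hasDerivAt_const t v)).sub_const (fderiv ℝ u x v)).sub
        ((hasDerivAt_id t).mul_const (fderiv ℝ (fderiv ℝ u) x v v))
      convert! e2 using 1
      simp [φ'']
    have b2 : ∀ t ∈ Set.Icc (0 : ℝ) 1, ‖φ'' t‖ ≤ C2 * ‖v‖ ^ 3 := by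
      intro t ht
      have e : φ'' t = (fderiv ℝ (fderiv ℝ u) (x + t • v) - fderiv ℝ (fderiv ℝ u) x) v v := by
        simp [φ'']
      rw [e]
      refine (ContinuousLinearMap.le_opNorm₂ _ _ _).trans ?_
      have := hC3 (x + t • v) x
      rw [add_sub_cancel_left, norm_smul, Real.norm_of_nonneg ht.1] at this
      calc _ ≤ (C2 * (t * ‖v‖)) * ‖v‖ * ‖v‖ := by gcongr
        _ ≤ (C2 * (1 * ‖v‖)) * ‖v‖ * ‖v‖ := by gcongr; exact ht.2
        _ = _ := by ring
    have b1 : ∀ t ∈ Set.Icc (0 : ℝ) 1, ‖φ' t‖ ≤ C2 * ‖v‖ ^ 3 := by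
      intro t ht
      have := norm_image_sub_le_of_norm_deriv_le_segment' (f := φ') (f' := φ'') (a := 0) (b := t)
        (fun s _ => (hφ' s).hasDerivWithinAt)
        (fun s hs' => b2 s ⟨hs'.1, hs'.2.le.trans ht.2⟩) t ⟨ht.1, le_rfl⟩
      have z : φ' 0 = 0 := by simp [φ']
      rw [z, sub_zero, sub_zero] at this
      refine this.trans (mul_le_of_le_one_right (by positivity) ht.2)
    have b0 := norm_image_sub_le_of_norm_deriv_le_segment_01' (f := φ) (f' := φ')
      (fun s _ => (hφ s).hasDerivWithinAt) (fun s hs' => b1 s ⟨hs'.1, hs'.2.le⟩)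
    have e : u (x + v) + ε - (u x + ε) - fderiv ℝ u x v - fderiv ℝ (fderiv ℝ u) x v v / 2
        = φ 1 - φ 0 := by
      simp [φ]; ring
    rw [e, ← Real.norm_eq_abs]
    refine b0.trans ?_
    gcongr
    linarith

theorem exists_contDiff_seq_tendsto {F : Type*} [NormedAddCommGroup F]
    [InnerProductSpace ℝ F] [FiniteDimensional ℝ F] [MeasurableSpace F] [BorelSpace F]
    {μ : Measure F} [IsFiniteMeasure μ] {w : F → ℝ} (hw : MemLp w 2 μ) :
    ∃ (V : ℕ → F → ℝ) (e : ℕ → ℝ≥0∞), (∀ n, ContDiff ℝ ∞ (V n)) ∧ (∀ n, HasCompactSupport (V n)) ∧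
      (∀ᵐ x ∂μ, Tendsto (fun n => V n x) atTop (𝓝 (w x))) ∧ Tendsto e atTop (𝓝 0) ∧
      ∀ n, eLpNorm (V n) 2 μ ≤ eLpNorm w 2 μ + e n := by
  have h := fun n : ℕ => hw.exist_eLpNorm_sub_le (by simp) (by norm_num)
    (ε := 1 / ((n : ℝ) + 1)) (by positivity)
  choose V hV1 hV2 hV3 using h
  have he : Tendsto (fun n : ℕ => ENNReal.ofReal (1 / ((n : ℝ) + 1))) atTop (𝓝 0) := by
    rw [← ENNReal.ofReal_zero]
    exact (ENNReal.continuous_ofReal.tendsto _).comp tendsto_one_div_add_atTop_nhds_zero_nat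
  have hm : TendstoInMeasure μ V atTop w := by
    refine tendstoInMeasure_of_tendsto_eLpNorm (p := 2) (by norm_num)
      (fun n => (hV2 n).continuous.aestronglyMeasurable) hw.1 ?_
    refine tendsto_of_tendsto_of_tendsto_of_le_of_le tendsto_const_nhds he (fun n => zero_le) ?_
    intro n
    beta_reduce
    rw [eLpNorm_sub_comm]
    exact hV3 n
  obtain ⟨ns, hns, hae⟩ := hm.exists_seq_tendsto_ae
  refine ⟨fun n => V (ns n), fun n => ENNReal.ofReal (1 / ((ns n : ℝ) + 1)), fun n => hV2 _,
    fun n => hV1 _, hae, he.comp hns.tendsto_atTop, fun n => ?_⟩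
  beta_reduce
  have e : V (ns n) = w - (w - V (ns n)) := by simp
  conv_lhs => rw [e]
  refine (eLpNorm_sub_le hw.1 (hw.1.sub (hV2 _).continuous.aestronglyMeasurable)
    (by norm_num)).trans ?_
  gcongr
  exact hV3 _

theorem lintegral_ofReal_sq {F : Type*} [MeasurableSpace F] {μ : Measure F} (v : F → ℝ) :
    ∫⁻ x, ENNReal.ofReal (v x ^ 2) ∂μ = eLpNorm v 2 μ ^ 2 := by
  have h := eLpNorm_nnreal_pow_eq_lintegral (f := v) (μ := μ) (p := 2) (by norm_num)
  norm_num at h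
  rw [h]
  refine lintegral_congr fun x => ?_
  rw [Real.enorm_eq_ofReal_abs, ← ENNReal.ofReal_pow (abs_nonneg _), sq_abs]

variable {E : Type*} [NormedAddCommGroup E] [InnerProductSpace ℝ E] [FiniteDimensional ℝ E]
  [MeasurableSpace E] [BorelSpace E]

/-- The gaussian Brascamp–Lieb inequality of a geometric (sub-)datum. -/
theorem lintegral_stdGaussian_prod_le {m : ℕ} {F : Fin m → Type*} [∀ j, NormedAddCommGroup (F j)]
    [∀ j, InnerProductSpace ℝ (F j)] [∀ j, FiniteDimensional ℝ (F j)]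
    [∀ j, MeasurableSpace (F j)] [∀ j, BorelSpace (F j)]
    (L : ∀ j, E →L[ℝ] F j) (hL : ∀ j y, L j ((L j).adjoint y) = y)
    (p : Fin m → ℝ) (hp : ∀ j, 0 ≤ p j)
    (hLp : ∀ x, ∑ j, p j * ‖L j x‖ ^ 2 ≤ ‖x‖ ^ 2)
    (w : ∀ j, F j → ℝ) (hw : ∀ j, MemLp (w j) 2 (stdGaussian (F j))) :
    ∫⁻ z, ∏ j, ENNReal.ofReal (w j (L j z) ^ 2) ^ p j ∂(stdGaussian E)
      ≤ ∏ j, (∫⁻ y, ENNReal.ofReal (w j y ^ 2) ∂(stdGaussian (F j))) ^ p j := by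
  choose V e hV1 hV2 hV3 he hVe using fun j => exists_contDiff_seq_tendsto (hw j)
  let ε : ℕ → ℝ := fun n => 1 / ((n : ℝ) + 1)
  have hε : ∀ n, 0 < ε n := fun n => by positivity
  have hεt : Tendsto ε atTop (𝓝 0) := tendsto_one_div_add_atTop_nhds_zero_nat
  have key : ∀ n, ∫⁻ z, ∏ j, ENNReal.ofReal (V j n (L j z) ^ 2 + ε n) ^ p j ∂(stdGaussian E)
      ≤ ∏ j, ((eLpNorm (w j) 2 (stdGaussian (F j)) + e j n) ^ 2 + ENNReal.ofReal (ε n)) ^ p j := by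
    intro n
    have hT := fun j => exists_hasTaylorTwo_of_contDiff (u := fun x => V j n x ^ 2)
      ((hV1 j n).pow 2) (by simpa only [pow_two] using! (hV2 j n).mul_left (f' := V j n)) (fun x => sq_nonneg _) (hε n)
    choose Cj hCj1 hCj2 using hT
    set C := 1 + ∑ j, Cj j
    have hCle : ∀ j, Cj j ≤ C := fun j => by
      have := Finset.single_le_sum (f := Cj) (fun i _ => by linarith [hCj1 i]) (Finset.mem_univ j)
      simp only [C]; linarith
    have hC : 1 ≤ C := by
      have := Finset.sum_nonneg (s := Finset.univ) (f := Cj) (fun i _ => by linarith [hCj1 i])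
      simp only [C]; linarith
    have hT : ∀ j, HasTaylorTwo C (fun x => V j n x ^ 2 + ε n) := fun j => by
      obtain ⟨a1, a2, a3, g, H, a4, a5, a6, a7, a8⟩ := hCj2 j
      refine ⟨a1, fun x => le_trans (inv_anti₀ (by linarith [hCj1 j]) (hCle j)) (a2 x),
        fun x => (a3 x).trans (hCle j), g, H, a4, a5, fun x => (a6 x).trans (hCle j),
        fun x => (a7 x).trans (hCle j), fun x v => (a8 x v).trans ?_⟩
      gcongr
      exact hCle j
    have main := gaussAvg_prod_le L hL p hp hLp hC _ hT
    have pos : ∀ j y, 0 < V j n y ^ 2 + ε n := fun j y => by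
      have := sq_nonneg (V j n y); linarith [hε n]
    have cont : ∀ j, Continuous (V j n) := fun j => (hV1 j n).continuous
    have hprodc : Continuous fun z => ∏ j, (V j n (L j z) ^ 2 + ε n) ^ p j :=
      continuous_finsetProd _ fun j _ => Continuous.rpow_const (by fun_prop) fun z =>
        Or.inl (pos j _).ne'
    have hint : Integrable (fun z => ∏ j, (V j n (L j z) ^ 2 + ε n) ^ p j) (stdGaussian E) := by
      refine Integrable.of_bound hprodc.aestronglyMeasurable (∏ j, C ^ p j)
        (ae_of_all _ fun z => ?_)
      rw [Real.norm_eq_abs, Finset.abs_prod]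
      refine Finset.prod_le_prod (fun j _ => abs_nonneg _) fun j _ => ?_
      rw [abs_of_nonneg (Real.rpow_nonneg (pos j _).le _)]
      exact Real.rpow_le_rpow (pos j _).le ((hT j).2.2.1 _) (hp j)
    have e1 : ∫⁻ z, ∏ j, ENNReal.ofReal (V j n (L j z) ^ 2 + ε n) ^ p j ∂(stdGaussian E)
        = ENNReal.ofReal (∫ z, ∏ j, (V j n (L j z) ^ 2 + ε n) ^ p j ∂(stdGaussian E)) := by
      rw [ofReal_integral_eq_lintegral_ofReal hint (ae_of_all _ fun z =>
        Finset.prod_nonneg fun j _ => Real.rpow_nonneg (pos j _).le _)]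
      refine lintegral_congr fun z => ?_
      rw [ENNReal.ofReal_prod_of_nonneg fun j _ => Real.rpow_nonneg (pos j _).le _]
      exact Finset.prod_congr rfl fun j _ => ENNReal.ofReal_rpow_of_nonneg (pos j _).le (hp j)
    rw [e1]
    refine (ENNReal.ofReal_le_ofReal main).trans ?_
    have ipos : ∀ j, 0 ≤ ∫ y, (V j n y ^ 2 + ε n) ∂(stdGaussian (F j)) := fun j =>
      integral_nonneg fun y => (pos j y).le
    rw [ENNReal.ofReal_prod_of_nonneg fun j _ => Real.rpow_nonneg (ipos j) _]
    refine Finset.prod_le_prod' fun j _ => ?_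
    rw [← ENNReal.ofReal_rpow_of_nonneg (ipos j) (hp j)]
    refine ENNReal.rpow_le_rpow ?_ (hp j)
    rw [ofReal_integral_eq_lintegral_ofReal (Integrable.of_bound (by fun_prop) C
      (ae_of_all _ fun z => (hT j).abs_le hC z)) (ae_of_all _ fun y => (pos j y).le)]
    simp_rw [fun y => ENNReal.ofReal_add (sq_nonneg (V j n y)) (hε n).le]
    rw [lintegral_add_right _ measurable_const, lintegral_ofReal_sq]
    simp only [lintegral_const, measure_univ, mul_one]
    gcongr
    exact hVe j n
  have hae : ∀ᵐ z ∂(stdGaussian E), ∀ j, Tendsto (fun n => V j n (L j z)) atTop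
      (𝓝 (w j (L j z))) := by
    rw [ae_all_iff]
    intro j
    have := hV3 j
    rw [← map_stdGaussian_of_comp_adjoint (L j) (hL j)] at this
    exact ae_of_ae_map (by fun_prop) this
  have hlim : ∀ᵐ z ∂(stdGaussian E), liminf (fun n => ∏ j, ENNReal.ofReal
      (V j n (L j z) ^ 2 + ε n) ^ p j) atTop = ∏ j, ENNReal.ofReal (w j (L j z) ^ 2) ^ p j := by
    filter_upwards [hae] with z hz
    refine Tendsto.liminf_eq (ENNReal.tendsto_finsetProd_of_ne_top _ (fun j _ => ?_)
      fun j _ => ENNReal.rpow_ne_top_of_nonneg (hp j) ENNReal.ofReal_ne_top)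
    refine ((ENNReal.continuous_rpow_const).tendsto _).comp
      ((ENNReal.continuous_ofReal.tendsto _).comp ?_)
    simpa using ((hz j).pow 2).add hεt
  rw [← lintegral_congr_ae hlim]
  refine (lintegral_liminf_le fun n => ?_).trans ?_
  · refine Finset.measurable_prod _ fun j _ => ?_
    have := (hV1 j n).continuous
    exact Measurable.pow_const (by fun_prop) _
  refine (liminf_le_liminf (Eventually.of_forall key)).trans (le_of_eq ?_)
  refine Tendsto.liminf_eq (ENNReal.tendsto_finsetProd_of_ne_top _ (fun j _ => ?_) fun j _ => ?_)
  · refine ((ENNReal.continuous_rpow_const).tendsto _).comp ?_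
    rw [lintegral_ofReal_sq]
    have h1 := ((he j).const_add (eLpNorm (w j) 2 (stdGaussian (F j))))
    have h2 := ((ENNReal.continuous_pow 2).tendsto _).comp h1
    have h3 := (ENNReal.continuous_ofReal.tendsto _).comp hεt
    simpa using h2.add h3
  · rw [lintegral_ofReal_sq]
    exact ENNReal.rpow_ne_top_of_nonneg (hp j) (ENNReal.pow_ne_top (hw j).2.ne)

end Density

section CauchyBinet

/-- Expansion of the determinant of a product along the rows of the first factor. -/
theorem det_mul_eq_sum_prod_mul_det {a n : ℕ} (A : Matrix (Fin a) (Fin n) ℝ)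
    (B : Matrix (Fin n) (Fin a) ℝ) :
    (A * B).det = ∑ σ : Fin a → Fin n, (∏ i, A i (σ i)) * (B.submatrix σ id).det := by
  have h : (A * B) = fun i => ∑ l, A i l • B l := by
    ext i j; simp [Matrix.mul_apply]
  change Matrix.detRowAlternating (A * B) = _
  rw [h]
  erw [(Matrix.detRowAlternating (n := Fin a) (R := ℝ)).toMultilinearMap.map_sum]
  refine Finset.sum_congr rfl fun σ _ => ?_
  erw [(Matrix.detRowAlternating (n := Fin a) (R := ℝ)).toMultilinearMap.map_smul_univ]
  rfl

/-- The Cauchy–Binet formula, with the sum running over all functions. -/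
theorem factorial_mul_det_mul {a n : ℕ} (A : Matrix (Fin a) (Fin n) ℝ)
    (B : Matrix (Fin n) (Fin a) ℝ) :
    (a.factorial : ℝ) * (A * B).det
      = ∑ σ : Fin a → Fin n, (A.submatrix id σ).det * (B.submatrix σ id).det := by
  have key : ∀ τ : Equiv.Perm (Fin a), (A * B).det
      = ∑ σ : Fin a → Fin n, ((Equiv.Perm.sign τ : ℤ) : ℝ) * (∏ i, A i (σ (τ i)))
          * (B.submatrix σ id).det := by
    intro τ
    rw [det_mul_eq_sum_prod_mul_det,
      ← Equiv.sum_comp (Equiv.arrowCongr τ⁻¹ (Equiv.refl (Fin n)))]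
    refine Finset.sum_congr rfl fun σ _ => ?_
    have e : (Equiv.arrowCongr τ⁻¹ (Equiv.refl (Fin n))) σ = σ ∘ τ := by
      ext i; simp [Equiv.arrowCongr]; rfl
    rw [e]
    have := Matrix.det_permute τ (B.submatrix σ id)
    rw [show B.submatrix (σ ∘ τ) id = (B.submatrix σ id).submatrix τ id by rfl, this]
    simp only [Function.comp]
    ring
  have h2 : (a.factorial : ℝ) * (A * B).det = ∑ _τ : Equiv.Perm (Fin a), (A * B).det := by
    simp [Fintype.card_perm]
  rw [h2, Finset.sum_congr rfl fun τ _ => key τ, Finset.sum_comm]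
  refine Finset.sum_congr rfl fun σ _ => ?_
  rw [← Finset.sum_mul]
  congr 1
  rw [← Matrix.det_transpose, Matrix.det_apply']
  rfl

theorem factorial_mul_det_mul_diagonal {a n : ℕ} (W : Matrix (Fin a) (Fin n) ℝ) (x : Fin n → ℝ) :
    (a.factorial : ℝ) * (W * Matrix.diagonal x * Wᵀ).det
      = ∑ σ : Fin a → Fin n, (∏ i, x (σ i)) * (W.submatrix id σ).det ^ 2 := by
  rw [factorial_mul_det_mul]
  refine Finset.sum_congr rfl fun σ _ => ?_
  have h1 : (W * Matrix.diagonal x).submatrix id σ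
      = W.submatrix id σ * Matrix.diagonal (fun i => x (σ i)) := by
    ext i j; simp [Matrix.mul_diagonal]
  have h2 : (Wᵀ).submatrix σ id = (W.submatrix id σ)ᵀ := rfl
  rw [h1, h2, Matrix.det_mul, Matrix.det_diagonal, Matrix.det_transpose]
  ring

end CauchyBinet

section Exchange

/-- The number of values of `σ` that are smaller than `k`. -/
def countLT {a n : ℕ} (σ : Fin a → Fin n) (k : ℕ) : ℕ :=
  (Finset.univ.filter fun i => (σ i : ℕ) < k).card

theorem countLT_update {a n : ℕ} (σ : Fin a → Fin n) (i : Fin a) (l : Fin n) (k : ℕ)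
    (h : ¬ (σ i : ℕ) < k) (hl : (l : ℕ) < k) :
    countLT (Function.update σ i l) k = countLT σ k + 1 := by
  classical
  have : (Finset.univ.filter fun i' => ((Function.update σ i l) i' : ℕ) < k)
      = insert i (Finset.univ.filter fun i => (σ i : ℕ) < k) := by
    ext j
    by_cases hj : j = i
    · subst hj; simp [hl]
    · simp [hj]
  rw [countLT, this, Finset.card_insert_of_notMem (by simpa using h), countLT]

theorem countLT_le_update {a n : ℕ} (σ : Fin a → Fin n) (i : Fin a) (l : Fin n) (k : ℕ)
    (h : l ≤ σ i) : countLT σ k ≤ countLT (Function.update σ i l) k := by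
  classical
  refine Finset.card_le_card fun j hj => ?_
  simp only [Finset.mem_filter, Finset.mem_univ, true_and] at hj ⊢
  by_cases hji : j = i
  · subst hji; simp only [Function.update_self]; exact lt_of_le_of_lt (by exact_mod_cast h) hj
  · simpa [hji] using hj

theorem countLT_le {a n : ℕ} (σ : Fin a → Fin n) (k : ℕ) : countLT σ k ≤ a := by
  simpa [countLT] using Finset.card_filter_le (Finset.univ : Finset (Fin a)) (fun i => (σ i : ℕ) < k)

theorem countLT_self {a n : ℕ} (σ : Fin a → Fin n) : countLT σ n = a := by
  simp [countLT]

theorem abs_mulVec_le {a b : ℕ} (M : Matrix (Fin a) (Fin b) ℝ) {B v : ℝ} (u : Fin b → ℝ)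
    (hM : ∀ i j, |M i j| ≤ B) (hu : ∀ j, |u j| ≤ v) (hB : 0 ≤ B) (i : Fin a) :
    |(M *ᵥ u) i| ≤ b * (B * v) := by
  calc |(M *ᵥ u) i| ≤ ∑ j, |M i j * u j| := by
        simp only [Matrix.mulVec, dotProduct]; exact Finset.abs_sum_le_sum_abs _ _
    _ ≤ ∑ _j : Fin b, B * v := by
        refine Finset.sum_le_sum fun j _ => ?_
        rw [abs_mul]
        exact mul_le_mul (hM i j) (hu j) (abs_nonneg _) hB
    _ = _ := by simp

theorem abs_det_le {a : ℕ} (M : Matrix (Fin a) (Fin a) ℝ) {B : ℝ} (hM : ∀ i j, |M i j| ≤ B) :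
    |M.det| ≤ a.factorial * B ^ a := by
  have := Matrix.det_le (A := M) (abv := AbsoluteValue.abs) (x := B) (fun i j => hM i j)
  simpa [nsmul_eq_mul] using this

theorem abs_adjugate_le {a : ℕ} (M : Matrix (Fin a) (Fin a) ℝ) {B : ℝ} (hB : 1 ≤ B)
    (hM : ∀ i j, |M i j| ≤ B) (i j : Fin a) :
    |M.adjugate i j| ≤ a.factorial * B ^ a := by
  rw [Matrix.adjugate_apply]
  refine abs_det_le _ fun i' j' => ?_
  rw [Matrix.updateRow_apply]
  split_ifs
  · rw [Pi.single_apply]; split_ifs <;> simp <;> linarith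
  · exact hM i' j'

theorem submatrix_update {a n : ℕ} (W : Matrix (Fin a) (Fin n) ℝ) (σ : Fin a → Fin n)
    (i : Fin a) (l : Fin n) :
    W.submatrix id (Function.update σ i l)
      = (W.submatrix id σ).updateCol i (fun r => W r l) := by
  ext r c
  by_cases h : c = i
  · subst h; simp
  · simp [h]

theorem adjugate_mul_submatrix_apply {a n : ℕ} (W : Matrix (Fin a) (Fin n) ℝ)
    (σ τ : Fin a → Fin n) (i t : Fin a) :
    ((W.submatrix id σ).adjugate * W.submatrix id τ) i t
      = (W.submatrix id (Function.update σ i (τ t))).det := by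
  rw [submatrix_update, ← Matrix.cramer_apply, Matrix.cramer_eq_adjugate_mulVec]
  rfl

/-- The constant in the exchange lemma. -/
noncomputable def exchangeConst (a : ℕ) (B c : ℝ) : ℝ :=
  2 * (a * (a.factorial * B ^ a) * (a * B) * a) / c

/-- Quantitative Steinitz exchange: if a minor of `W` supported on `σ` has fewer columns among the
first `k` than a nondegenerate minor `τ`, then some column beyond `k` can be exchanged for one of
the first `k` without decreasing the minor by more than a constant factor. -/
theorem exists_abs_det_le_update {a n : ℕ} (W : Matrix (Fin a) (Fin n) ℝ) {B c : ℝ} (hB : 1 ≤ B)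
    (hW : ∀ i j, |W i j| ≤ B) (hc : 0 < c) (σ τ : Fin a → Fin n)
    (hτ : c ≤ |(W.submatrix id τ).det|) (k : ℕ) (hk : countLT σ k < countLT τ k) :
    ∃ (i : Fin a) (l : Fin n), ¬ (σ i : ℕ) < k ∧ (l : ℕ) < k ∧
      |(W.submatrix id σ).det| ≤ exchangeConst a B c *
        |(W.submatrix id (Function.update σ i l)).det| := by
  classical
  by_contra! hcon
  set P := W.submatrix id τ with hP
  set Q := W.submatrix id σ with hQ
  set M := Q.adjugate * P with hM
  have hB0 : 0 ≤ B := by linarith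
  let S := {i : Fin a // (σ i : ℕ) < k}
  let T := {i : Fin a // (τ i : ℕ) < k}
  have hcard : Fintype.card S < Fintype.card T := by
    simpa [S, T, Fintype.card_subtype, countLT] using hk
  let N : Matrix S T ℝ := M.submatrix Subtype.val Subtype.val
  have hker : LinearMap.ker (Matrix.mulVecLin N) ≠ ⊥ :=
    LinearMap.ker_ne_bot_of_finrank_lt (by simpa using hcard)
  obtain ⟨u, hu, hu0⟩ := Submodule.exists_mem_ne_zero_of_ne_bot hker
  have hNu : N *ᵥ u = 0 := by simpa using hu
  let v : Fin a → ℝ := fun t => if h : (τ t : ℕ) < k then u ⟨t, h⟩ else 0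
  have hv : ∀ t : T, v t = u t := fun t => by simp [v, t.2]
  have hv' : ∀ t, ¬ (τ t : ℕ) < k → v t = 0 := fun t ht => by simp [v, ht]
  have hv0 : v ≠ 0 := fun h => hu0 (by ext t; rw [← hv t, h]; rfl)
  have hMS : ∀ i, (σ i : ℕ) < k → (M *ᵥ v) i = 0 := by
    intro i hi
    have h1 := congrFun hNu ⟨i, hi⟩
    simp only [Matrix.mulVec, dotProduct] at h1 ⊢
    rw [← Fintype.sum_subtype_add_sum_subtype (fun t : Fin a => (τ t : ℕ) < k)]
    have h2 : ∑ t : {t : Fin a // ¬ (τ t : ℕ) < k}, M i t * v t = 0 :=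
      Finset.sum_eq_zero fun t _ => by rw [hv' t t.2, mul_zero]
    rw [h2, add_zero]
    simpa [hv, N] using h1
  obtain ⟨s0, hs0⟩ : ∃ t, v t ≠ 0 := by
    by_contra! h; exact hv0 (funext h)
  have : Nonempty (Fin a) := ⟨s0⟩
  obtain ⟨t0, ht0⟩ := Finite.exists_max fun t => |v t|
  set V := |v t0| with hV
  have hVpos : 0 < V := lt_of_lt_of_le (abs_pos.2 hs0) (ht0 s0)
  have ha : (0 : ℝ) < a := by exact_mod_cast Fin.pos_iff_nonempty.2 ⟨s0⟩
  have hf : (0 : ℝ) < a.factorial * B ^ a := by positivity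
  have hC : 0 < exchangeConst a B c := by unfold exchangeConst; positivity
  have hs0T : (τ s0 : ℕ) < k := by by_contra h; exact hs0 (hv' s0 h)
  obtain ⟨i0, hi0⟩ : ∃ i, ¬ (σ i : ℕ) < k := by
    by_contra! h
    have : countLT σ k = a := by simp [countLT, h]
    have := countLT_le τ k
    omega
  have hQ0 : 0 < |Q.det| :=
    lt_of_le_of_lt (by positivity) (hcon i0 (τ s0) (not_lt.1 hi0) hs0T)
  set ε := |Q.det| / exchangeConst a B c with hε
  have hε0 : 0 < ε := by positivity
  have hMv : ∀ i, |(M *ᵥ v) i| ≤ a * (ε * V) := by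
    intro i
    by_cases hi : (σ i : ℕ) < k
    · rw [hMS i hi, abs_zero]; positivity
    calc |(M *ᵥ v) i| ≤ ∑ t, |M i t * v t| := by
          simp only [Matrix.mulVec, dotProduct]; exact Finset.abs_sum_le_sum_abs _ _
      _ ≤ ∑ _t : Fin a, ε * V := by
          refine Finset.sum_le_sum fun t _ => ?_
          by_cases ht : (τ t : ℕ) < k
          · rw [abs_mul]
            refine mul_le_mul ?_ (ht0 t) (abs_nonneg _) hε0.le
            rw [hε, le_div_iff₀ hC, hM, adjugate_mul_submatrix_apply, mul_comm]
            exact (hcon i (τ t) (not_lt.1 hi) ht).le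
          · rw [hv' t ht, mul_zero, abs_zero]; positivity
      _ = _ := by simp
  have hQM : Q *ᵥ (M *ᵥ v) = Q.det • (P *ᵥ v) := by
    rw [hM, Matrix.mulVec_mulVec, ← Matrix.mul_assoc, Matrix.mul_adjugate, Matrix.smul_mul,
      Matrix.one_mul, Matrix.smul_mulVec]
  have hPv : ∀ i, |(P *ᵥ v) i| ≤ a * (B * (a * (ε * V))) / |Q.det| := by
    intro i
    rw [le_div_iff₀ hQ0, mul_comm, ← abs_mul]
    have := abs_mulVec_le Q (M *ᵥ v) (fun i j => hW i _) hMv hB0 i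
    rwa [hQM] at this
  have hadj : P.adjugate *ᵥ (P *ᵥ v) = P.det • v := by
    rw [Matrix.mulVec_mulVec, Matrix.adjugate_mul, Matrix.smul_mulVec, Matrix.one_mulVec]
  have hfin := abs_mulVec_le P.adjugate (P *ᵥ v)
    (abs_adjugate_le P hB fun i j => hW i _) hPv hf.le t0
  rw [hadj, Pi.smul_apply, smul_eq_mul, abs_mul, ← hV] at hfin
  have h3 : c * V ≤ |P.det| * V := by gcongr
  have h4 : (a : ℝ) * (a.factorial * B ^ a * (a * (B * (a * (ε * V))) / |Q.det|)) = c * V / 2 := by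
    rw [hε, exchangeConst]; field_simp
  have : 0 < c * V := by positivity
  linarith
end Exchange

section Gap

/-- The term of the Cauchy–Binet expansion of `det (W * diagonal x * Wᵀ)` indexed by `σ`. -/
noncomputable def minorTerm {a n : ℕ} (W : Matrix (Fin a) (Fin n) ℝ) (x : Fin n → ℝ)
    (σ : Fin a → Fin n) : ℝ :=
  (∏ i, x (σ i)) * (W.submatrix id σ).det ^ 2

/-- `a!` times the determinant of `W * diagonal x * Wᵀ`. -/
noncomputable def minorSum {a n : ℕ} (W : Matrix (Fin a) (Fin n) ℝ) (x : Fin n → ℝ) : ℝ :=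
  ∑ σ : Fin a → Fin n, minorTerm W x σ

/-- Multiply the first `k` coordinates of `x` by `s`. -/
def scaleFirst {n : ℕ} (k : ℕ) (s : ℝ) (x : Fin n → ℝ) : Fin n → ℝ :=
  fun i => if (i : ℕ) < k then s * x i else x i

theorem prod_scaleFirst {a n : ℕ} (σ : Fin a → Fin n) (k : ℕ) (s : ℝ) (x : Fin n → ℝ) :
    ∏ i, scaleFirst k s x (σ i) = s ^ countLT σ k * ∏ i, x (σ i) := by
  have : ∀ i, scaleFirst k s x (σ i) = (if (σ i : ℕ) < k then s else 1) * x (σ i) := by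
    intro i; simp only [scaleFirst]; split_ifs <;> simp
  simp_rw [this, Finset.prod_mul_distrib, Finset.prod_ite, countLT]
  simp

theorem minorTerm_scaleFirst {a n : ℕ} (W : Matrix (Fin a) (Fin n) ℝ) (σ : Fin a → Fin n) (k : ℕ)
    (s : ℝ) (x : Fin n → ℝ) :
    minorTerm W (scaleFirst k s x) σ = s ^ countLT σ k * minorTerm W x σ := by
  rw [minorTerm, prod_scaleFirst, minorTerm, mul_assoc]

theorem minorTerm_nonneg {a n : ℕ} (W : Matrix (Fin a) (Fin n) ℝ) {x : Fin n → ℝ}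
    (hx : ∀ i, 0 < x i) (σ : Fin a → Fin n) : 0 ≤ minorTerm W x σ :=
  mul_nonneg (Finset.prod_nonneg fun _ _ => (hx _).le) (sq_nonneg _)

theorem minorTerm_le_minorSum {a n : ℕ} (W : Matrix (Fin a) (Fin n) ℝ) {x : Fin n → ℝ}
    (hx : ∀ i, 0 < x i) (σ : Fin a → Fin n) : minorTerm W x σ ≤ minorSum W x :=
  Finset.single_le_sum (fun σ _ => minorTerm_nonneg W hx σ) (Finset.mem_univ σ)

theorem minorSum_nonneg {a n : ℕ} (W : Matrix (Fin a) (Fin n) ℝ) {x : Fin n → ℝ}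
    (hx : ∀ i, 0 < x i) : 0 ≤ minorSum W x :=
  Finset.sum_nonneg fun σ _ => minorTerm_nonneg W hx σ

theorem exchangeConst_nonneg (a : ℕ) {B c : ℝ} (hB : 1 ≤ B) (hc : 0 < c) :
    0 ≤ exchangeConst a B c := by
  unfold exchangeConst; positivity

/-- The exchange of one column in the presence of a gap of size `R / s` between the first `k` coordinates
of `x` and the others. -/
theorem exists_minorTerm_le_of_gap {a n : ℕ} (W : Matrix (Fin a) (Fin n) ℝ) {B c : ℝ} (hB : 1 ≤ B)
    (hW : ∀ i j, |W i j| ≤ B) (hc : 0 < c) (τ : Fin a → Fin n)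
    (hτ : c ≤ |(W.submatrix id τ).det|) (k : ℕ) {x : Fin n → ℝ} (hx : ∀ i, 0 < x i) {s R : ℝ}
    (hs : 0 < s) (hR : 0 < R)
    (hgap : ∀ i l : Fin n, ¬ (i : ℕ) < k → (l : ℕ) < k → R * x i ≤ s * x l)
    (σ : Fin a → Fin n) (hk : countLT σ k < countLT τ k) :
    ∃ σ', countLT σ' k = countLT σ k + 1 ∧
      minorTerm W x σ ≤ exchangeConst a B c ^ 2 / R * (s * minorTerm W x σ') := by
  obtain ⟨i, l, hi, hl, hle⟩ := exists_abs_det_le_update W hB hW hc σ τ hτ k hk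
  refine ⟨Function.update σ i l, countLT_update σ i l k hi hl, ?_⟩
  have hC := exchangeConst_nonneg a hB hc
  have h1 : (W.submatrix id σ).det ^ 2 ≤ exchangeConst a B c ^ 2 *
      (W.submatrix id (Function.update σ i l)).det ^ 2 := by
    rw [← mul_pow, ← sq_abs (Matrix.det _)]
    refine (pow_le_pow_left₀ (abs_nonneg _) hle 2).trans (le_of_eq ?_)
    rw [mul_pow, sq_abs, mul_pow]
  have h2 : R * ∏ j, x (σ j) ≤ s * ∏ j, x (Function.update σ i l j) := by
    classical
    rw [← Finset.mul_prod_erase _ _ (Finset.mem_univ i),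
      ← Finset.mul_prod_erase Finset.univ (fun j => x (Function.update σ i l j))
        (Finset.mem_univ i)]
    have : ∏ j ∈ Finset.univ.erase i, x (Function.update σ i l j)
        = ∏ j ∈ Finset.univ.erase i, x (σ j) :=
      Finset.prod_congr rfl fun j hj => by simp [Finset.ne_of_mem_erase hj]
    rw [this, ← mul_assoc, ← mul_assoc]
    simp only [Function.update_self]
    exact mul_le_mul_of_nonneg_right (hgap _ _ hi hl) (Finset.prod_nonneg fun j _ => (hx _).le)
  rw [minorTerm, minorTerm, div_mul_eq_mul_div, le_div_iff₀ hR]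
  have h0 : 0 ≤ s * ∏ j, x (Function.update σ i l j) :=
    mul_nonneg hs.le (Finset.prod_nonneg fun j _ => (hx _).le)
  calc (∏ j, x (σ j)) * (W.submatrix id σ).det ^ 2 * R
      = (R * ∏ j, x (σ j)) * (W.submatrix id σ).det ^ 2 := by ring
    _ ≤ (s * ∏ j, x (Function.update σ i l j)) * (exchangeConst a B c ^ 2 *
      (W.submatrix id (Function.update σ i l)).det ^ 2) :=
        mul_le_mul h2 h1 (sq_nonneg _) h0
    _ = _ := by ring

theorem pow_countLT_mul_minorTerm_le {a n : ℕ} (W : Matrix (Fin a) (Fin n) ℝ) {B c : ℝ}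
    (hB : 1 ≤ B) (hW : ∀ i j, |W i j| ≤ B) (hc : 0 < c) (τ : Fin a → Fin n)
    (hτ : c ≤ |(W.submatrix id τ).det|) (k : ℕ) {x : Fin n → ℝ} (hx : ∀ i, 0 < x i) {s R : ℝ}
    (hs : 0 < s) (hR : 0 < R) (hCR : exchangeConst a B c ^ 2 ≤ R)
    (hgap : ∀ i l : Fin n, ¬ (i : ℕ) < k → (l : ℕ) < k → R * x i ≤ s * x l)
    (e : ℕ) : ∀ σ : Fin a → Fin n, countLT σ k + e = countLT τ k →
      s ^ countLT σ k * minorTerm W x σ ≤ s ^ countLT τ k * minorSum W x ∧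
      (0 < e → s ^ countLT σ k * minorTerm W x σ ≤
        exchangeConst a B c ^ 2 / R * (s ^ countLT τ k * minorSum W x)) := by
  have hD := minorSum_nonneg W hx
  induction e with
  | zero =>
    intro σ hσ
    rw [add_zero] at hσ
    refine ⟨?_, fun h => absurd h (lt_irrefl _)⟩
    rw [hσ]
    exact mul_le_mul_of_nonneg_left (minorTerm_le_minorSum W hx σ) (by positivity)
  | succ e ih =>
    intro σ hσ
    obtain ⟨σ', hσ', hle⟩ := exists_minorTerm_le_of_gap W hB hW hc τ hτ k hx hs hR hgap σ (by omega)
    have h1 := (ih σ' (by omega)).1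
    have h2 : s ^ countLT σ k * minorTerm W x σ ≤
        exchangeConst a B c ^ 2 / R * (s ^ countLT τ k * minorSum W x) := by
      calc s ^ countLT σ k * minorTerm W x σ
          ≤ s ^ countLT σ k * (exchangeConst a B c ^ 2 / R * (s * minorTerm W x σ')) := by gcongr
        _ = exchangeConst a B c ^ 2 / R * (s ^ countLT σ' k * minorTerm W x σ') := by
            rw [hσ', pow_succ]; ring
        _ ≤ _ := by gcongr
    refine ⟨h2.trans ?_, fun _ => h2⟩
    have : exchangeConst a B c ^ 2 / R ≤ 1 := (div_le_one hR).2 hCR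
    exact mul_le_of_le_one_left (by positivity) this

/-- Shrinking a gap costs only a factor close to one. -/
theorem minorSum_scaleFirst_le {a n : ℕ} (W : Matrix (Fin a) (Fin n) ℝ) {B c : ℝ}
    (hB : 1 ≤ B) (hW : ∀ i j, |W i j| ≤ B) (hc : 0 < c) (τ : Fin a → Fin n)
    (hτ : c ≤ |(W.submatrix id τ).det|) (k : ℕ) {x : Fin n → ℝ} (hx : ∀ i, 0 < x i) {s R : ℝ}
    (hs : 0 < s) (hs1 : s ≤ 1) (hR : 0 < R) (hCR : exchangeConst a B c ^ 2 ≤ R)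
    (hgap : ∀ i l : Fin n, ¬ (i : ℕ) < k → (l : ℕ) < k → R * x i ≤ s * x l) :
    minorSum W (scaleFirst k s x)
      ≤ s ^ countLT τ k * ((1 + (n : ℝ) ^ a * exchangeConst a B c ^ 2 / R) * minorSum W x) := by
  have hD := minorSum_nonneg W hx
  have h : ∀ σ : Fin a → Fin n, minorTerm W (scaleFirst k s x) σ ≤
      s ^ countLT τ k * minorTerm W x σ +
        exchangeConst a B c ^ 2 / R * (s ^ countLT τ k * minorSum W x) := by
    intro σ
    have hσ0 := minorTerm_nonneg W hx σ
    rw [minorTerm_scaleFirst]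
    rcases le_or_gt (countLT τ k) (countLT σ k) with h | h
    · have := pow_le_pow_of_le_one hs.le hs1 h
      have : s ^ countLT σ k * minorTerm W x σ ≤ s ^ countLT τ k * minorTerm W x σ := by gcongr
      have : 0 ≤ exchangeConst a B c ^ 2 / R * (s ^ countLT τ k * minorSum W x) := by positivity
      linarith
    · have := (pow_countLT_mul_minorTerm_le W hB hW hc τ hτ k hx hs hR hCR hgap
        (countLT τ k - countLT σ k) σ (by omega)).2 (by omega)
      have : 0 ≤ s ^ countLT τ k * minorTerm W x σ := by positivity
      linarith
  refine (Finset.sum_le_sum fun σ _ => h σ).trans (le_of_eq ?_)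
  rw [Finset.sum_add_distrib, ← Finset.mul_sum, Finset.sum_const, Finset.card_univ,
    Fintype.card_fun, Fintype.card_fin, Fintype.card_fin, nsmul_eq_mul, ← minorSum]
  push_cast
  ring

end Gap

section Truncation

variable {m n : ℕ} {nj : Fin m → ℕ}

/-- The functional `∏ x / ∏ D_j(x)^{p_j}` in terms of minor sums. -/
noncomputable def minorRatio (W : ∀ j, Matrix (Fin (nj j)) (Fin n) ℝ) (p : Fin m → ℝ)
    (x : Fin n → ℝ) : ℝ :=
  (∏ i, x i) / ∏ j, minorSum (W j) x ^ p j

/-- The loss incurred by shrinking one gap to size `R`. -/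
noncomputable def gapLoss (nj : Fin m → ℕ) (n : ℕ) (p : Fin m → ℝ) (B c R : ℝ) : ℝ :=
  ∏ j, (1 + (n : ℝ) ^ nj j * exchangeConst (nj j) B c ^ 2 / R) ^ p j

theorem one_le_gapLoss {p : Fin m → ℝ} (hp : ∀ j, 0 ≤ p j) (nj : Fin m → ℕ) (n : ℕ) {B c R : ℝ}
    (hR : 0 < R) : 1 ≤ gapLoss nj n p B c R := by
  unfold gapLoss
  refine (Finset.prod_const_one (s := (Finset.univ : Finset (Fin m)))).symm.le.trans
    (Finset.prod_le_prod (fun _ _ => zero_le_one) fun j _ => Real.one_le_rpow ?_ (hp j))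
  have : 0 ≤ (n : ℝ) ^ nj j * exchangeConst (nj j) B c ^ 2 / R := by positivity
  linarith

theorem minorSum_pos {a : ℕ} (W : Matrix (Fin a) (Fin n) ℝ) {x : Fin n → ℝ}
    (hx : ∀ i, 0 < x i) {c : ℝ} (hc : 0 < c) {τ : Fin a → Fin n}
    (hτ : c ≤ |(W.submatrix id τ).det|) : 0 < minorSum W x := by
  refine lt_of_lt_of_le ?_ (minorTerm_le_minorSum W hx τ)
  have : (W.submatrix id τ).det ≠ 0 := abs_pos.1 (hc.trans_le hτ)
  have := Finset.prod_pos fun i (_ : i ∈ Finset.univ) => hx (τ i)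
  unfold minorTerm; positivity

/-- A family of column selections satisfying the rank conditions for the flags of the first `k`
coordinates. -/
def GoodSelection (p : Fin m → ℝ) (τ : ∀ j, Fin (nj j) → Fin n) : Prop :=
  ∀ k ≤ n, (k : ℝ) ≤ ∑ j, p j * countLT (τ j) k

theorem minorRatio_le_scaleFirst {p : Fin m → ℝ} (hp : ∀ j, 0 ≤ p j)
    (W : ∀ j, Matrix (Fin (nj j)) (Fin n) ℝ) {B c : ℝ} (hB : 1 ≤ B)
    (hW : ∀ j i l, |W j i l| ≤ B) (hc : 0 < c) {τ : ∀ j, Fin (nj j) → Fin n}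
    (hg : GoodSelection p τ) (hτ : ∀ j, c ≤ |((W j).submatrix id (τ j)).det|)
    {k : ℕ} (hk : k ≤ n) {x : Fin n → ℝ} (hx : ∀ i, 0 < x i) {s R : ℝ}
    (hs : 0 < s) (hs1 : s ≤ 1) (hR : 0 < R) (hCR : ∀ j, exchangeConst (nj j) B c ^ 2 ≤ R)
    (hgap : ∀ i l : Fin n, ¬ (i : ℕ) < k → (l : ℕ) < k → R * x i ≤ s * x l) :
    minorRatio W p x ≤ gapLoss nj n p B c R * minorRatio W p (scaleFirst k s x) := by
  have hx' : ∀ i, 0 < scaleFirst k s x i := by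
    intro i; unfold scaleFirst; split_ifs
    · exact mul_pos hs (hx i)
    · exact hx i
  have hD : ∀ j, 0 < minorSum (W j) x := fun j => minorSum_pos (W j) hx hc (hτ j)
  have hD' : ∀ j, 0 < minorSum (W j) (scaleFirst k s x) := fun j => minorSum_pos (W j) hx' hc (hτ j)
  have hprod : ∏ i, scaleFirst k s x i = s ^ k * ∏ i, x i := by
    have := prod_scaleFirst (id : Fin n → Fin n) k s x
    simp only [id] at this
    rw [this]
    congr 2
    simp only [countLT, id]
    have := Fin.card_filter_val_lt (n := n) (m := k)
    omega
  have hP : 0 < ∏ i, x i := Finset.prod_pos fun i _ => hx i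
  have hle : ∏ j, minorSum (W j) (scaleFirst k s x) ^ p j
      ≤ s ^ k * (gapLoss nj n p B c R * ∏ j, minorSum (W j) x ^ p j) := by
    calc ∏ j, minorSum (W j) (scaleFirst k s x) ^ p j
        ≤ ∏ j, (s ^ countLT (τ j) k *
          ((1 + (n : ℝ) ^ nj j * exchangeConst (nj j) B c ^ 2 / R) * minorSum (W j) x)) ^ p j := by
          refine Finset.prod_le_prod (fun j _ => Real.rpow_nonneg (hD' j).le _) fun j _ => ?_
          exact Real.rpow_le_rpow (hD' j).le
            (minorSum_scaleFirst_le (W j) hB (hW j) hc (τ j) (hτ j) k hx hs hs1 hR (hCR j) hgap)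
            (hp j)
      _ = s ^ (∑ j, p j * countLT (τ j) k) *
          (gapLoss nj n p B c R * ∏ j, minorSum (W j) x ^ p j) := by
          rw [Real.rpow_sum_of_pos hs, gapLoss, ← Finset.prod_mul_distrib,
            ← Finset.prod_mul_distrib]
          refine Finset.prod_congr rfl fun j _ => ?_
          rw [Real.mul_rpow (by positivity) (mul_nonneg (by positivity) (hD j).le),
            Real.mul_rpow (by positivity) (hD j).le, ← Real.rpow_natCast, ← Real.rpow_mul hs.le,
            mul_comm (p j)]
      _ ≤ _ := by
          refine mul_le_mul_of_nonneg_right ?_ (mul_nonneg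
            (zero_le_one.trans (one_le_gapLoss hp nj n hR))
            (Finset.prod_nonneg fun j _ => Real.rpow_nonneg (hD j).le _))
          rw [← Real.rpow_natCast s k]
          exact Real.rpow_le_rpow_of_exponent_ge hs hs1 (hg k hk)
  have h1 : 0 < ∏ j, minorSum (W j) (scaleFirst k s x) ^ p j :=
    Finset.prod_pos fun j _ => Real.rpow_pos_of_pos (hD' j) _
  have h2 : 0 < ∏ j, minorSum (W j) x ^ p j :=
    Finset.prod_pos fun j _ => Real.rpow_pos_of_pos (hD j) _
  rw [minorRatio, minorRatio, hprod, ← mul_div_assoc, div_le_div_iff₀ h2 h1]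
  calc (∏ i, x i) * ∏ j, minorSum (W j) (scaleFirst k s x) ^ p j
      ≤ (∏ i, x i) * (s ^ k * (gapLoss nj n p B c R * ∏ j, minorSum (W j) x ^ p j)) := by gcongr
    _ = _ := by ring

/-- All gaps can be shrunk to size `R` at the price of a factor close to one. -/
theorem exists_minorRatio_le_of_gaps {p : Fin m → ℝ} (hp : ∀ j, 0 ≤ p j)
    (W : ∀ j, Matrix (Fin (nj j)) (Fin n) ℝ) {B c : ℝ} (hB : 1 ≤ B)
    (hW : ∀ j i l, |W j i l| ≤ B) (hc : 0 < c) {τ : ∀ j, Fin (nj j) → Fin n}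
    (hg : GoodSelection p τ) (hτ : ∀ j, c ≤ |((W j).submatrix id (τ j)).det|)
    {R : ℝ} (hR : 1 ≤ R) (hCR : ∀ j, exchangeConst (nj j) B c ^ 2 ≤ R)
    {x : Fin n → ℝ} (hx : ∀ i, 0 < x i) (hanti : Antitone x) (k : ℕ) :
    ∃ y : Fin n → ℝ, (∀ i, 0 < y i) ∧ Antitone y ∧
      minorRatio W p x ≤ gapLoss nj n p B c R ^ k * minorRatio W p y ∧
      ∀ i (h : i + 1 < n), i < k → y ⟨i, by omega⟩ ≤ R * y ⟨i + 1, h⟩ := by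
  have hR0 : 0 < R := by linarith
  have hQ := one_le_gapLoss hp nj n (B := B) (c := c) hR0
  induction k with
  | zero => exact ⟨x, hx, hanti, by simp, fun i h hi => absurd hi (by omega)⟩
  | succ k ih =>
    obtain ⟨y, hy, hya, hle, hgap⟩ := ih
    have hH : 0 ≤ minorRatio W p y := by
      refine div_nonneg (Finset.prod_nonneg fun i _ => (hy i).le)
        (Finset.prod_nonneg fun j _ => Real.rpow_nonneg (minorSum_nonneg _ hy) _)
    by_cases hkn : k + 1 < n
    swap
    · refine ⟨y, hy, hya, hle.trans ?_, fun i h hi => hgap i h (by omega)⟩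
      exact mul_le_mul_of_nonneg_right (pow_le_pow_right₀ hQ (by omega)) hH
    by_cases hno : y ⟨k, by omega⟩ ≤ R * y ⟨k + 1, hkn⟩
    · refine ⟨y, hy, hya, hle.trans ?_, fun i h hi => ?_⟩
      · exact mul_le_mul_of_nonneg_right (pow_le_pow_right₀ hQ (by omega)) hH
      · rcases Nat.lt_succ_iff_lt_or_eq.1 hi with h1 | rfl
        · exact hgap i h h1
        · exact hno
    push Not at hno
    set s := R * y ⟨k + 1, hkn⟩ / y ⟨k, by omega⟩ with hs
    have hk0 := hy ⟨k, by omega⟩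
    have hk1 := hy ⟨k + 1, hkn⟩
    have hs0 : 0 < s := by positivity
    have hs1 : s ≤ 1 := (div_le_one hk0).2 hno.le
    have hsy : s * y ⟨k, by omega⟩ = R * y ⟨k + 1, hkn⟩ := by rw [hs]; field_simp
    have hg1 : ∀ i l : Fin n, ¬ (i : ℕ) < k + 1 → (l : ℕ) < k + 1 → R * y i ≤ s * y l := by
      intro i l hi hl
      calc R * y i ≤ R * y ⟨k + 1, hkn⟩ := by
            gcongr; exact hya (Fin.le_def.2 (by simp; omega))
        _ = s * y ⟨k, by omega⟩ := hsy.symm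
        _ ≤ s * y l := by gcongr; exact hya (Fin.le_def.2 (by simp; omega))
    have main := minorRatio_le_scaleFirst hp W hB hW hc hg hτ (k := k + 1) hkn.le hy hs0 hs1 hR0 hCR
      hg1
    refine ⟨scaleFirst (k + 1) s y, fun i => ?_, fun i l hil => ?_, ?_, fun i h hi => ?_⟩
    · unfold scaleFirst; split_ifs
      · exact mul_pos hs0 (hy i)
      · exact hy i
    · have hil' : (i : ℕ) ≤ l := hil
      unfold scaleFirst
      split_ifs with h1 h2 h2
      · exact mul_le_mul_of_nonneg_left (hya hil) hs0.le
      · omega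
      · refine le_trans ?_ (hg1 l i h1 h2)
        nlinarith [hy l]
      · exact hya hil
    · calc minorRatio W p x ≤ gapLoss nj n p B c R ^ k * minorRatio W p y := hle
        _ ≤ gapLoss nj n p B c R ^ k *
            (gapLoss nj n p B c R * minorRatio W p (scaleFirst (k + 1) s y)) := by
            gcongr
        _ = _ := by ring
    · unfold scaleFirst
      simp only
      rcases Nat.lt_succ_iff_lt_or_eq.1 hi with h1 | rfl
      · rw [if_pos hi, if_pos (by omega)]
        have := hgap i h h1
        nlinarith
      · rw [if_pos hi, if_neg (by omega)]
        exact hsy.le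

end Truncation

section Functional

variable {m n : ℕ} {nj : Fin m → ℕ}

/-- The functional `det X / ∏_j det(L_j X L_jᵀ)^{p_j}`, dual to the square of `matBLg`. -/
noncomputable def dualFunctional (L : ∀ j, Matrix (Fin (nj j)) (Fin n) ℝ) (p : Fin m → ℝ)
    (X : Matrix (Fin n) (Fin n) ℝ) : ℝ :=
  X.det / ∏ j, (L j * X * (L j)ᵀ).det ^ p j

theorem exists_eq_mul_diagonal_mul {X : Matrix (Fin n) (Fin n) ℝ} (hX : X.PosDef) :
    ∃ (U : Matrix (Fin n) (Fin n) ℝ) (x : Fin n → ℝ), U * Uᵀ = 1 ∧ (∀ i, 0 < x i) ∧ Antitone x ∧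
      X = U * Matrix.diagonal x * Uᵀ := by
  set V : Matrix (Fin n) (Fin n) ℝ := (hX.isHermitian.eigenvectorUnitary).val with hV
  have hVV : V * Vᵀ = 1 := by
    have := Unitary.coe_mul_star_self hX.isHermitian.eigenvectorUnitary
    simpa [Matrix.star_eq_conjTranspose] using this
  have hspec : X = V * Matrix.diagonal hX.isHermitian.eigenvalues * Vᵀ := by
    have := hX.isHermitian.spectral_theorem
    rw [Unitary.conjStarAlgAut_apply] at this
    simpa [Matrix.star_eq_conjTranspose, Function.comp_def] using this
  set e := hX.isHermitian.eigenvalues with he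
  set σ := Tuple.sort (fun i => - e i) with hσ
  have hanti : Antitone (e ∘ σ) := by
    have := Tuple.monotone_sort (fun i => - e i)
    intro i j hij
    have := this hij
    simp only [Function.comp] at this ⊢
    linarith
  refine ⟨V.submatrix id σ, e ∘ σ, ?_, fun i => hX.eigenvalues_pos _, hanti, ?_⟩
  · rw [← hVV]
    ext i j
    simp only [Matrix.mul_apply, Matrix.submatrix_apply, Matrix.transpose_apply, id]
    exact Equiv.sum_comp σ (fun l => V i l * V j l)
  · conv_lhs => rw [hspec]
    ext i j
    rw [Matrix.mul_apply, Matrix.mul_apply]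
    simp only [Matrix.mul_diagonal, Matrix.submatrix_apply, Matrix.transpose_apply, id,
      Function.comp]
    exact (Equiv.sum_comp σ (fun l => V i l * e l * V j l)).symm

theorem det_mul_conj_diagonal (U : Matrix (Fin n) (Fin n) ℝ) (hU : U * Uᵀ = 1) (x : Fin n → ℝ) :
    (U * Matrix.diagonal x * Uᵀ).det = ∏ i, x i := by
  have h : U.det * U.det = 1 := by
    have := congrArg Matrix.det hU
    rwa [Matrix.det_mul, Matrix.det_transpose, Matrix.det_one] at this
  rw [Matrix.det_mul, Matrix.det_mul, Matrix.det_transpose, Matrix.det_diagonal]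
  linear_combination (∏ i, x i) * h

theorem det_mul_conj_eq_minorSum {a : ℕ} (L : Matrix (Fin a) (Fin n) ℝ)
    (U : Matrix (Fin n) (Fin n) ℝ) (x : Fin n → ℝ) :
    (L * (U * Matrix.diagonal x * Uᵀ) * Lᵀ).det = (a.factorial : ℝ)⁻¹ * minorSum (L * U) x := by
  have h : L * (U * Matrix.diagonal x * Uᵀ) * Lᵀ = (L * U) * Matrix.diagonal x * (L * U)ᵀ := by
    simp only [Matrix.transpose_mul, Matrix.mul_assoc]
  have h2 := factorial_mul_det_mul_diagonal (L * U) x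
  have h3 : (a.factorial : ℝ) ≠ 0 := by positivity
  rw [h, minorSum]
  simp only [minorTerm]
  rw [← h2]
  field_simp

theorem dualFunctional_conj_diagonal (L : ∀ j, Matrix (Fin (nj j)) (Fin n) ℝ) (p : Fin m → ℝ)
    {U : Matrix (Fin n) (Fin n) ℝ} (hU : U * Uᵀ = 1) {x : Fin n → ℝ} (hx : ∀ i, 0 < x i) :
    dualFunctional L p (U * Matrix.diagonal x * Uᵀ)
      = (∏ j, ((nj j).factorial : ℝ) ^ p j) * minorRatio (fun j => L j * U) p x := by
  rw [dualFunctional, det_mul_conj_diagonal U hU, minorRatio]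
  simp_rw [det_mul_conj_eq_minorSum]
  simp_rw [fun j => Real.mul_rpow (z := p j) (inv_nonneg.2 (Nat.cast_nonneg (nj j).factorial))
    (minorSum_nonneg (L j * U) hx), fun j => Real.inv_rpow (Nat.cast_nonneg (nj j).factorial) (p j)]
  rw [Finset.prod_mul_distrib, Finset.prod_inv_distrib]
  rw [div_eq_mul_inv, mul_inv, inv_inv, div_eq_mul_inv]
  ring

theorem minorRatio_smul {p : Fin m → ℝ} (W : ∀ j, Matrix (Fin (nj j)) (Fin n) ℝ)
    (hdim : (n : ℝ) = ∑ j, p j * nj j) {a : ℝ} (ha : 0 < a) {x : Fin n → ℝ} (hx : ∀ i, 0 < x i) :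
    minorRatio W p (a • x) = minorRatio W p x := by
  have h1 : ∀ j, minorSum (W j) (a • x) = a ^ nj j * minorSum (W j) x := by
    intro j
    simp only [minorSum, minorTerm, Finset.mul_sum]
    refine Finset.sum_congr rfl fun σ _ => ?_
    simp [Finset.prod_mul_distrib, mul_assoc]
  have h2 : ∏ j, (a ^ nj j * minorSum (W j) x) ^ p j = a ^ n * ∏ j, minorSum (W j) x ^ p j := by
    rw [← Real.rpow_natCast a n, hdim, Real.rpow_sum_of_pos ha, ← Finset.prod_mul_distrib]
    refine Finset.prod_congr rfl fun j _ => ?_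
    rw [Real.mul_rpow (by positivity) (minorSum_nonneg _ hx), ← Real.rpow_natCast,
      ← Real.rpow_mul ha.le, mul_comm (p j)]
  simp_rw [minorRatio, h1, h2]
  simp only [Pi.smul_apply, smul_eq_mul, Finset.prod_mul_distrib, Finset.prod_const,
    Finset.card_univ, Fintype.card_fin]
  rw [mul_div_mul_left _ _ (pow_pos ha n).ne']

/-- Uniform nondegeneracy of a datum: in every orthonormal frame its entries are bounded by `B`
and it has a good selection of columns with minors at least `c`. -/
def UniformlyGood (L : ∀ j, Matrix (Fin (nj j)) (Fin n) ℝ) (p : Fin m → ℝ) (B c : ℝ) : Prop :=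
  ∀ U : Matrix (Fin n) (Fin n) ℝ, U * Uᵀ = 1 → (∀ j i l, |(L j * U) i l| ≤ B) ∧
    ∃ τ : ∀ j, Fin (nj j) → Fin n, GoodSelection p τ ∧
      ∀ j, c ≤ |((L j * U).submatrix id (τ j)).det|

theorem exists_dualFunctional_le {p : Fin m → ℝ} (hp : ∀ j, 0 ≤ p j)
    {L : ∀ j, Matrix (Fin (nj j)) (Fin n) ℝ} {B c : ℝ} (hB : 1 ≤ B) (hc : 0 < c)
    (hL : UniformlyGood L p B c) (hdim : (n : ℝ) = ∑ j, p j * nj j)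
    {R : ℝ} (hR : 1 ≤ R) (hCR : ∀ j, exchangeConst (nj j) B c ^ 2 ≤ R)
    {X : Matrix (Fin n) (Fin n) ℝ} (hX : X.PosDef) :
    ∃ (U : Matrix (Fin n) (Fin n) ℝ) (x : Fin n → ℝ), U * Uᵀ = 1 ∧ (∀ i, 1 ≤ x i) ∧
      (∀ i, x i ≤ R ^ n) ∧ dualFunctional L p X ≤
        gapLoss nj n p B c R ^ n * dualFunctional L p (U * Matrix.diagonal x * Uᵀ) := by
  obtain ⟨U, x, hU, hx, hanti, rfl⟩ := exists_eq_mul_diagonal_mul hX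
  obtain ⟨hW, τ, hg, hτ⟩ := hL U hU
  obtain ⟨y, hy, hya, hle, hgap⟩ := exists_minorRatio_le_of_gaps hp (fun j => L j * U) hB hW hc hg hτ
    hR hCR hx hanti n
  have hfac : 0 ≤ ∏ j, ((nj j).factorial : ℝ) ^ p j :=
    Finset.prod_nonneg fun j _ => Real.rpow_nonneg (Nat.cast_nonneg _) _
  rcases Nat.eq_zero_or_pos n with hn | hn
  · subst hn
    refine ⟨U, y, hU, fun i => i.elim0, fun i => i.elim0, ?_⟩
    rw [dualFunctional_conj_diagonal L p hU hx, dualFunctional_conj_diagonal L p hU hy,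
      mul_left_comm]
    exact mul_le_mul_of_nonneg_left hle hfac
  set last : Fin n := ⟨n - 1, by omega⟩ with hlast
  have hl0 := hy last
  have hchain : ∀ d i (h : i + d = n - 1), y ⟨i, by omega⟩ ≤ R ^ d * y last := by
    intro d
    induction d with
    | zero => intro i h; rw [pow_zero, one_mul]; exact le_of_eq (congrArg y (Fin.ext (by simpa using h)))
    | succ d ih =>
      intro i h
      calc y ⟨i, by omega⟩ ≤ R * y ⟨i + 1, by omega⟩ := hgap i (by omega) (by omega)
        _ ≤ R * (R ^ d * y last) := by gcongr; exact ih (i + 1) (by omega)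
        _ = _ := by ring
  refine ⟨U, (y last)⁻¹ • y, hU, fun i => ?_, fun i => ?_, ?_⟩
  · simp only [Pi.smul_apply, smul_eq_mul]
    rw [inv_mul_eq_div, one_le_div hl0]
    exact hya (Fin.le_def.2 (by simp [hlast]; omega))
  · simp only [Pi.smul_apply, smul_eq_mul]
    rw [inv_mul_eq_div, div_le_iff₀ hl0]
    refine (hchain (n - 1 - i) i (by omega)).trans ?_
    gcongr
    omega
  · have hz : ∀ i, 0 < ((y last)⁻¹ • y) i := fun i => mul_pos (inv_pos.2 hl0) (hy i)
    rw [dualFunctional_conj_diagonal L p hU hx, dualFunctional_conj_diagonal L p hU hz,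
      minorRatio_smul _ hdim (inv_pos.2 hl0) hy, mul_left_comm]
    exact mul_le_mul_of_nonneg_left hle hfac

/-- Lower bound for the Gram determinants. -/
theorem UniformlyGood.le_det {p : Fin m → ℝ} {L : ∀ j, Matrix (Fin (nj j)) (Fin n) ℝ} {B c : ℝ}
    (hc : 0 < c) (hL : UniformlyGood L p B c) {U : Matrix (Fin n) (Fin n) ℝ} (hU : U * Uᵀ = 1)
    {x : Fin n → ℝ} (hx : ∀ i, 1 ≤ x i) (j : Fin m) :
    ((nj j).factorial : ℝ)⁻¹ * c ^ 2 ≤ (L j * (U * Matrix.diagonal x * Uᵀ) * (L j)ᵀ).det := by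
  obtain ⟨-, τ, -, hτ⟩ := hL U hU
  rw [det_mul_conj_eq_minorSum]
  gcongr
  refine le_trans ?_ (minorTerm_le_minorSum _ (fun i => zero_lt_one.trans_le (hx i)) (τ j))
  unfold minorTerm
  have h1 : c ^ 2 ≤ ((L j * U).submatrix id (τ j)).det ^ 2 := by
    rw [← sq_abs (Matrix.det _)]; exact pow_le_pow_left₀ hc.le (hτ j) 2
  have h2 : 1 ≤ ∏ i, x (τ j i) :=
    (Finset.prod_const_one (s := (Finset.univ : Finset (Fin (nj j))))).symm.le.trans
      (Finset.prod_le_prod (fun _ _ => zero_le_one) fun i _ => hx _)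
  nlinarith [sq_nonneg c]

/-- The dual functional is bounded. -/
theorem exists_dualFunctional_bound {p : Fin m → ℝ} (hp : ∀ j, 0 ≤ p j)
    {L : ∀ j, Matrix (Fin (nj j)) (Fin n) ℝ} {B c : ℝ} (hB : 1 ≤ B) (hc : 0 < c)
    (hL : UniformlyGood L p B c) (hdim : (n : ℝ) = ∑ j, p j * nj j) :
    ∃ C, ∀ X : Matrix (Fin n) (Fin n) ℝ, X.PosDef → dualFunctional L p X ≤ C := by
  set R := 1 + ∑ j, exchangeConst (nj j) B c ^ 2 with hR
  have hS : ∀ j, exchangeConst (nj j) B c ^ 2 ≤ ∑ j, exchangeConst (nj j) B c ^ 2 := fun j =>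
    Finset.single_le_sum (f := fun j => exchangeConst (nj j) B c ^ 2)
      (fun _ _ => sq_nonneg _) (Finset.mem_univ j)
  have hR1 : 1 ≤ R := by
    have : 0 ≤ ∑ j, exchangeConst (nj j) B c ^ 2 := Finset.sum_nonneg fun _ _ => sq_nonneg _
    linarith
  have hQ := one_le_gapLoss hp nj n (B := B) (c := c) (zero_lt_one.trans_le hR1)
  refine ⟨gapLoss nj n p B c R ^ n * ((R ^ n) ^ n /
    ∏ j, (((nj j).factorial : ℝ)⁻¹ * c ^ 2) ^ p j), fun X hX => ?_⟩
  obtain ⟨U, x, hU, hx1, hxR, hle⟩ := exists_dualFunctional_le hp hB hc hL hdim hR1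
    (fun j => by linarith [hS j]) hX
  refine hle.trans (mul_le_mul_of_nonneg_left ?_ (by positivity))
  have hpos : ∀ j, 0 < (((nj j).factorial : ℝ)⁻¹ * c ^ 2) := fun j => by positivity
  rw [dualFunctional, det_mul_conj_diagonal U hU]
  refine div_le_div₀ (by positivity) ?_ (Finset.prod_pos fun j _ => Real.rpow_pos_of_pos (hpos j) _) ?_
  · calc ∏ i, x i ≤ ∏ _i : Fin n, R ^ n :=
        Finset.prod_le_prod (fun i _ => zero_le_one.trans (hx1 i)) fun i _ => hxR i
      _ = _ := by simp
  · exact Finset.prod_le_prod (fun j _ => Real.rpow_nonneg (hpos j).le _) fun j _ =>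
      Real.rpow_le_rpow (hpos j).le (hL.le_det hc hU hx1 j) (hp j)

end Functional

section Compactness

variable {m n : ℕ} {nj : Fin m → ℕ}

open Filter Topology

theorem abs_apply_le_matOpNorm {a b : ℕ} (A : Matrix (Fin a) (Fin b) ℝ) (i : Fin a) (j : Fin b) :
    |A i j| ≤ matOpNorm A := by
  have h1 : (Matrix.toEuclideanLin A (EuclideanSpace.single j 1)) i = A i j := by
    simp [Matrix.toLpLin_apply]
  have h2 := (LinearMap.toContinuousLinearMap (Matrix.toEuclideanLin A)).le_opNorm
    (EuclideanSpace.single j 1)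
  have h3 := PiLp.norm_apply_le (Matrix.toEuclideanLin A (EuclideanSpace.single j 1)) i
  rw [h1] at h3
  simp only [LinearMap.coe_toContinuousLinearMap', PiLp.norm_single, norm_one,
    mul_one] at h2
  exact h3.trans h2

theorem exists_max_countLT {a : ℕ} (W : Matrix (Fin a) (Fin n) ℝ)
    (h : ∃ σ : Fin a → Fin n, (W.submatrix id σ).det ≠ 0) :
    ∃ τ : Fin a → Fin n, (W.submatrix id τ).det ≠ 0 ∧
      ∀ σ : Fin a → Fin n, (W.submatrix id σ).det ≠ 0 → ∀ k ≤ n, countLT σ k ≤ countLT τ k := by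
  classical
  obtain ⟨σ₀, hσ₀⟩ := h
  obtain ⟨τ, hτ, hmax⟩ := Finset.exists_max_image
    (Finset.univ.filter fun σ : Fin a → Fin n => (W.submatrix id σ).det ≠ 0)
    (fun σ => ∑ k ∈ Finset.range (n + 1), countLT σ k) ⟨σ₀, by simpa using hσ₀⟩
  simp only [Finset.mem_filter, Finset.mem_univ, true_and] at hτ hmax
  refine ⟨τ, hτ, fun σ hσ k hk => ?_⟩
  by_contra! hlt
  set B := 1 + ∑ i, ∑ l, |W i l| with hB
  have hW : ∀ i l, |W i l| ≤ B := by
    intro i l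
    have h1 : |W i l| ≤ ∑ l, |W i l| :=
      Finset.single_le_sum (f := fun l => |W i l|) (fun _ _ => abs_nonneg _) (Finset.mem_univ l)
    have h2 : ∑ l, |W i l| ≤ ∑ i, ∑ l, |W i l| :=
      Finset.single_le_sum (f := fun i => ∑ l, |W i l|)
        (fun _ _ => Finset.sum_nonneg fun _ _ => abs_nonneg _) (Finset.mem_univ i)
    linarith
  have hB1 : 1 ≤ B := by
    have : 0 ≤ ∑ i, ∑ l, |W i l| :=
      Finset.sum_nonneg fun _ _ => Finset.sum_nonneg fun _ _ => abs_nonneg _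
    linarith
  obtain ⟨i, l, hi, hl, hle⟩ := exists_abs_det_le_update W hB1 hW (abs_pos.2 hσ) τ σ le_rfl k hlt
  have hne : (W.submatrix id (Function.update τ i l)).det ≠ 0 := by
    intro h0
    rw [h0, abs_zero, mul_zero] at hle
    exact hτ (abs_nonpos_iff.1 hle)
  have hlt2 : ∑ k ∈ Finset.range (n + 1), countLT τ k
      < ∑ k ∈ Finset.range (n + 1), countLT (Function.update τ i l) k := by
    refine Finset.sum_lt_sum (fun k' _ => countLT_le_update τ i l k' (Fin.le_def.2 (by omega)))
      ⟨k, by simp; omega, ?_⟩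
    rw [countLT_update τ i l k hi hl]
    omega
  exact absurd (hmax _ hne) (not_le.2 hlt2)

theorem abs_apply_le_one_of_mul_transpose {U : Matrix (Fin n) (Fin n) ℝ} (hU : U * Uᵀ = 1)
    (i j : Fin n) : |U i j| ≤ 1 := by
  have h1 : ∑ l, U i l ^ 2 = 1 := by
    have := congrFun (congrFun hU i) i
    simpa [Matrix.mul_apply, sq] using this
  have h2 : U i j ^ 2 ≤ ∑ l, U i l ^ 2 :=
    Finset.single_le_sum (f := fun l => U i l ^ 2) (fun _ _ => sq_nonneg _) (Finset.mem_univ j)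
  rw [h1] at h2
  exact (sq_le_one_iff_abs_le_one _).1 h2

theorem isCompact_setOf_mul_transpose_eq_one :
    IsCompact {U : Matrix (Fin n) (Fin n) ℝ | U * Uᵀ = 1} := by
  have hbox : IsCompact (Set.univ.pi fun _ : Fin n => Set.univ.pi fun _ : Fin n =>
      Set.Icc (-1 : ℝ) 1) :=
    isCompact_univ_pi fun _ => isCompact_univ_pi fun _ => isCompact_Icc
  refine IsCompact.of_isClosed_subset hbox ?_ ?_
  · exact isClosed_eq (by fun_prop) continuous_const
  · intro U hU i _ j _
    exact abs_le.1 (abs_apply_le_one_of_mul_transpose hU i j)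

theorem exists_uniformlyGood {p : Fin m → ℝ} (L₀ : ∀ j, Matrix (Fin (nj j)) (Fin n) ℝ)
    (h : ∀ U : Matrix (Fin n) (Fin n) ℝ, U * Uᵀ = 1 → ∃ τ : ∀ j, Fin (nj j) → Fin n,
      GoodSelection p τ ∧ ∀ j, ((L₀ j * U).submatrix id (τ j)).det ≠ 0) :
    ∃ B c η : ℝ, 1 ≤ B ∧ 0 < c ∧ 0 < η ∧ ∀ L : ∀ j, Matrix (Fin (nj j)) (Fin n) ℝ,
      (∀ j, matOpNorm (L j - L₀ j) < η) → UniformlyGood L p B c := by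
  have hev : ∀ᶠ q in 𝓝 (L₀, (0 : ℝ)), ∀ U ∈ {U : Matrix (Fin n) (Fin n) ℝ | U * Uᵀ = 1},
      ∃ τ : ∀ j, Fin (nj j) → Fin n, GoodSelection p τ ∧
        ∀ j, q.2 < |((q.1 j * U).submatrix id (τ j)).det| := by
    refine isCompact_setOf_mul_transpose_eq_one.eventually_forall_of_forall_eventually
      (P := fun (q : (∀ j, Matrix (Fin (nj j)) (Fin n) ℝ) × ℝ) U =>
        ∃ τ : ∀ j, Fin (nj j) → Fin n, GoodSelection p τ ∧
        ∀ j, q.2 < |((q.1 j * U).submatrix id (τ j)).det|) fun U hU => ?_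
    obtain ⟨τ, hg, hτ⟩ := h U hU
    have : ∀ᶠ z : ((∀ j, Matrix (Fin (nj j)) (Fin n) ℝ) × ℝ) × Matrix (Fin n) (Fin n) ℝ in
        𝓝 ((L₀, (0 : ℝ)), U), ∀ j, z.1.2 < |((z.1.1 j * z.2).submatrix id (τ j)).det| := by
      rw [eventually_all]
      intro j
      have hc1 : Continuous fun z : ((∀ j, Matrix (Fin (nj j)) (Fin n) ℝ) × ℝ) ×
          Matrix (Fin n) (Fin n) ℝ => |((z.1.1 j * z.2).submatrix id (τ j)).det| := by
        fun_prop
      have hc2 : Continuous fun z : ((∀ j, Matrix (Fin (nj j)) (Fin n) ℝ) × ℝ) ×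
          Matrix (Fin n) (Fin n) ℝ => z.1.2 := by fun_prop
      exact (hc2.tendsto _).eventually_lt (hc1.tendsto _) (abs_pos.2 (hτ j))
    filter_upwards [this] with z hz
    exact ⟨τ, hg, hz⟩
  rw [nhds_prod_eq, eventually_prod_iff] at hev
  obtain ⟨pa, hpa, pb, hpb, hab⟩ := hev
  obtain ⟨c, hc, hcb⟩ : ∃ c > 0, pb c := by
    rw [Metric.eventually_nhds_iff] at hpb
    obtain ⟨e, he, H⟩ := hpb
    exact ⟨e / 2, by positivity, H (by rw [Real.dist_eq, sub_zero, abs_of_pos (by positivity)]; linarith)⟩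
  have hentries : ∃ η > 0, ∀ L : ∀ j, Matrix (Fin (nj j)) (Fin n) ℝ,
      (∀ j i l, |L j i l - L₀ j i l| < η) → pa L := by
    have hmet : @Filter.Eventually (∀ j, Fin (nj j) → Fin n → ℝ) pa
        (@nhds (∀ j, Fin (nj j) → Fin n → ℝ) _ L₀) := hpa
    obtain ⟨e, he, H⟩ := Metric.eventually_nhds_iff.1 hmet
    refine ⟨e / 2, by positivity, fun L hL => ?_⟩
    have hd : dist (α := ∀ j, Fin (nj j) → Fin n → ℝ) (fun j i l => L j i l)
        (fun j i l => L₀ j i l) ≤ e / 2 :=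
      (dist_pi_le_iff (by positivity)).2 fun j => (dist_pi_le_iff (by positivity)).2 fun i =>
        (dist_pi_le_iff (by positivity)).2 fun l => by rw [Real.dist_eq]; exact (hL j i l).le
    exact H (lt_of_le_of_lt hd (by linarith))
  obtain ⟨η, hη, hηL⟩ := hentries
  set S := ∑ j, ∑ i, ∑ l, (|L₀ j i l| + 1) with hS
  have hS0 : 0 ≤ S := Finset.sum_nonneg fun _ _ => Finset.sum_nonneg fun _ _ =>
    Finset.sum_nonneg fun _ _ => by positivity
  refine ⟨1 + S, c, min η 1, by linarith, hc, by positivity, fun L hL U hU => ⟨fun j i l => ?_, ?_⟩⟩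
  · have hent : ∀ l, |L j i l| ≤ |L₀ j i l| + 1 := by
      intro l
      have h1 := abs_apply_le_matOpNorm (L j - L₀ j) i l
      have h2 := (hL j).trans_le (min_le_right η 1)
      rw [Matrix.sub_apply] at h1
      have h3 := abs_sub_abs_le_abs_sub (L j i l) (L₀ j i l)
      linarith
    have h4 : ∑ l, (|L₀ j i l| + 1) ≤ ∑ i, ∑ l, (|L₀ j i l| + 1) :=
      Finset.single_le_sum (f := fun i => ∑ l, (|L₀ j i l| + 1))
        (fun _ _ => Finset.sum_nonneg fun _ _ => by positivity) (Finset.mem_univ i)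
    have h5 : ∑ i, ∑ l, (|L₀ j i l| + 1) ≤ S :=
      Finset.single_le_sum (f := fun j => ∑ i, ∑ l, (|L₀ j i l| + 1))
        (fun _ _ => Finset.sum_nonneg fun _ _ => Finset.sum_nonneg fun _ _ => by positivity)
        (Finset.mem_univ j)
    calc |(L j * U) i l| ≤ ∑ r, |L j i r * U r l| := by
          rw [Matrix.mul_apply]; exact Finset.abs_sum_le_sum_abs _ _
      _ ≤ ∑ r, (|L₀ j i r| + 1) := by
          refine Finset.sum_le_sum fun r _ => ?_
          rw [abs_mul]
          have := abs_apply_le_one_of_mul_transpose hU r l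
          have := hent r
          nlinarith [abs_nonneg (L j i r), abs_nonneg (U r l)]
      _ ≤ 1 + S := by linarith
  · have hpaL : pa L := hηL L fun j i l => by
      have h1 := abs_apply_le_matOpNorm (L j - L₀ j) i l
      have h2 := (hL j).trans_le (min_le_left η 1)
      rw [Matrix.sub_apply] at h1
      linarith
    obtain ⟨τ, hg, hτ⟩ := hab hpaL hcb U hU
    exact ⟨τ, hg, fun j => (hτ j).le⟩

end Compactness

section Necessity

variable {m n : ℕ} {nj : Fin m → ℕ}

open Filter Topology

theorem nonpos_of_rpow_le {e C : ℝ} (h : ∀ r : ℝ, 1 ≤ r → r ^ e ≤ C) : e ≤ 0 := by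
  by_contra! he
  have h1 := (tendsto_rpow_atTop he).eventually_gt_atTop C
  obtain ⟨r, hr1, hr2⟩ := (h1.and (eventually_ge_atTop 1)).exists
  exact absurd (h r hr2) (not_le.2 hr1)

theorem posDef_conj_diagonal {U : Matrix (Fin n) (Fin n) ℝ} (hU : U * Uᵀ = 1) {x : Fin n → ℝ}
    (hx : ∀ i, 0 < x i) : (U * Matrix.diagonal x * Uᵀ).PosDef := by
  have h1 : (Matrix.diagonal x).PosDef := Matrix.posDef_diagonal_iff.2 hx
  have h2 := h1.mul_mul_conjTranspose_same (B := U) (by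
    intro v w hvw
    have := congrArg (fun z => Matrix.vecMul z Uᵀ) hvw
    simpa [Matrix.vecMul_vecMul, hU] using this)
  simpa using h2

theorem posDef_mul_mul_transpose {a : ℕ} {L : Matrix (Fin a) (Fin n) ℝ}
    (hL : Function.Surjective (Matrix.toEuclideanLin L)) {X : Matrix (Fin n) (Fin n) ℝ}
    (hX : X.PosDef) : (L * X * Lᵀ).PosDef := by
  have h2 := hX.mul_mul_conjTranspose_same (B := L) (by
    intro v w hvw
    have h0 : ∀ u : Fin n → ℝ, (v - w) ⬝ᵥ (L *ᵥ u) = 0 := by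
      intro u
      rw [Matrix.dotProduct_mulVec, Matrix.sub_vecMul]
      simp only at hvw
      rw [hvw, sub_self, zero_dotProduct]
    obtain ⟨u, hu⟩ := hL (WithLp.toLp 2 (v - w))
    have h3 := h0 u.ofLp
    have h4 : L *ᵥ u.ofLp = v - w := by
      have := congrArg WithLp.ofLp hu
      simpa [Matrix.toLpLin_apply] using this
    rw [h4] at h3
    exact sub_eq_zero.1 (dotProduct_self_eq_zero.1 h3))
  simpa using h2

theorem exists_minor_ne_zero {a : ℕ} {L : Matrix (Fin a) (Fin n) ℝ}
    (hL : Function.Surjective (Matrix.toEuclideanLin L)) {U : Matrix (Fin n) (Fin n) ℝ}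
    (hU : U * Uᵀ = 1) : ∃ σ : Fin a → Fin n, ((L * U).submatrix id σ).det ≠ 0 := by
  by_contra! h
  have h1 := (posDef_mul_mul_transpose hL Matrix.PosDef.one).det_pos
  have h2 := det_mul_conj_eq_minorSum L U 1
  rw [Matrix.diagonal_one', Matrix.mul_one, hU] at h2
  rw [h2] at h1
  simp [minorSum, minorTerm, h] at h1

theorem minorSum_scaleFirst_one_le {a : ℕ} (W : Matrix (Fin a) (Fin n) ℝ) {k d : ℕ}
    (h : ∀ σ : Fin a → Fin n, (W.submatrix id σ).det ≠ 0 → countLT σ k ≤ d) {r : ℝ} (hr : 1 ≤ r) :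
    minorSum W (scaleFirst k r 1) ≤ r ^ d * minorSum W 1 := by
  rw [minorSum, minorSum, Finset.mul_sum]
  refine Finset.sum_le_sum fun σ _ => ?_
  rw [minorTerm_scaleFirst]
  by_cases h0 : (W.submatrix id σ).det = 0
  · simp [minorTerm, h0]
  · exact mul_le_mul_of_nonneg_right (pow_le_pow_right₀ hr (h σ h0))
      (minorTerm_nonneg W (fun i => by simp) σ)

/-- Boundedness of the dual functional forces the rank conditions and the scaling condition. -/
theorem conditions_of_dualFunctional_le {p : Fin m → ℝ} (hp : ∀ j, 0 ≤ p j)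
    {L : ∀ j, Matrix (Fin (nj j)) (Fin n) ℝ}
    (hL : ∀ j, Function.Surjective (Matrix.toEuclideanLin (L j))) {C : ℝ}
    (hC : ∀ X : Matrix (Fin n) (Fin n) ℝ, X.PosDef → dualFunctional L p X ≤ C) :
    (n : ℝ) = ∑ j, p j * nj j ∧
    ∀ U : Matrix (Fin n) (Fin n) ℝ, U * Uᵀ = 1 → ∃ τ : ∀ j, Fin (nj j) → Fin n,
      GoodSelection p τ ∧ ∀ j, ((L j * U).submatrix id (τ j)).det ≠ 0 := by
  have hprod : ∀ k ≤ n, ∀ r : ℝ, ∏ i : Fin n, scaleFirst k r (1 : Fin n → ℝ) i = r ^ k := by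
    intro k hk r
    have := prod_scaleFirst (id : Fin n → Fin n) k r 1
    simp only [id] at this
    rw [this]
    have := Fin.card_filter_val_lt (n := n) (m := k)
    simp only [countLT, id, this, Pi.one_apply, Finset.prod_const_one, mul_one]
    congr 1; omega
  have hpos : ∀ k : ℕ, ∀ r : ℝ, 0 < r → ∀ i : Fin n, 0 < scaleFirst k r (1 : Fin n → ℝ) i := by
    intro k r hr i; unfold scaleFirst; split_ifs <;> simp [hr]
  have hmin : ∀ U : Matrix (Fin n) (Fin n) ℝ, U * Uᵀ = 1 → ∀ x : Fin n → ℝ, (∀ i, 0 < x i) →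
      ∀ j, 0 < minorSum (L j * U) x := by
    intro U hU x hx j
    obtain ⟨σ, hσ⟩ := exists_minor_ne_zero (hL j) hU
    exact minorSum_pos _ hx (abs_pos.2 hσ) le_rfl
  set F := ∏ j, ((nj j).factorial : ℝ) ^ p j with hF
  have hF0 : 0 < F := Finset.prod_pos fun j _ => Real.rpow_pos_of_pos (by positivity) _
  have key : ∀ U : Matrix (Fin n) (Fin n) ℝ, U * Uᵀ = 1 → ∀ k ≤ n, ∀ r : ℝ, 0 < r → ∀ e : ℝ,
      (∏ j, minorSum (L j * U) (scaleFirst k r 1) ^ p j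
        ≤ r ^ e * ∏ j, minorSum (L j * U) 1 ^ p j) →
      r ^ ((k : ℝ) - e) ≤ C / F * ∏ j, minorSum (L j * U) 1 ^ p j := by
    intro U hU k hk r hr e hle
    have h1 := hC _ (posDef_conj_diagonal hU (hpos k r hr))
    rw [dualFunctional_conj_diagonal L p hU (hpos k r hr), minorRatio, hprod k hk r] at h1
    have h2 : 0 < ∏ j, minorSum (L j * U) (scaleFirst k r 1) ^ p j :=
      Finset.prod_pos fun j _ => Real.rpow_pos_of_pos (hmin U hU _ (hpos k r hr) j) _
    rw [← mul_div_assoc, div_le_iff₀ h2] at h1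
    have hC0 : 0 ≤ C := by
      by_contra! hneg
      have : 0 < F * r ^ k := by positivity
      nlinarith
    rw [Real.rpow_sub hr, Real.rpow_natCast, div_le_iff₀ (Real.rpow_pos_of_pos hr _)]
    have h3 : F * r ^ k ≤ C * (r ^ e * ∏ j, minorSum (L j * U) 1 ^ p j) :=
      h1.trans (mul_le_mul_of_nonneg_left hle hC0)
    calc r ^ k = (F * r ^ k) / F := by field_simp
      _ ≤ C * (r ^ e * ∏ j, minorSum (L j * U) 1 ^ p j) / F := by gcongr
      _ = _ := by ring
  have hle : ∀ U : Matrix (Fin n) (Fin n) ℝ, U * Uᵀ = 1 → ∀ k ≤ n, ∀ d : Fin m → ℕ,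
      (∀ j, ∀ σ : Fin (nj j) → Fin n, ((L j * U).submatrix id σ).det ≠ 0 → countLT σ k ≤ d j) →
      (k : ℝ) ≤ ∑ j, p j * d j := by
    intro U hU k hk d hd
    rw [← sub_nonpos]
    refine nonpos_of_rpow_le fun r hr => key U hU k hk r (by linarith) _ ?_
    have hr0 : 0 < r := by linarith
    rw [Real.rpow_sum_of_pos hr0, ← Finset.prod_mul_distrib]
    refine Finset.prod_le_prod (fun j _ =>
      Real.rpow_nonneg (hmin U hU _ (hpos k r hr0) j).le _) fun j _ => ?_
    refine (Real.rpow_le_rpow (hmin U hU _ (hpos k r hr0) j).le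
      (minorSum_scaleFirst_one_le _ (hd j) hr) (hp j)).trans (le_of_eq ?_)
    rw [Real.mul_rpow (by positivity) (hmin U hU 1 (fun i => by simp) j).le, ← Real.rpow_natCast,
      ← Real.rpow_mul hr0.le, mul_comm (p j)]
  refine ⟨le_antisymm ?_ ?_, fun U hU => ?_⟩
  · exact hle 1 (by simp) n le_rfl nj fun j σ _ => countLT_le σ n
  · have h1 : -((n : ℝ) - ∑ j, p j * nj j) ≤ 0 := by
      refine nonpos_of_rpow_le (C := C / F * ∏ j, minorSum (L j * (1 : Matrix (Fin n) (Fin n) ℝ)) 1 ^ p j) fun r hr => ?_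
      have hr0 : 0 < r := by linarith
      rw [Real.rpow_neg hr0.le, ← Real.inv_rpow hr0.le]
      refine key 1 (by simp) n le_rfl r⁻¹ (by positivity) _ (le_of_eq ?_)
      rw [Real.rpow_sum_of_pos (by positivity), ← Finset.prod_mul_distrib]
      refine Finset.prod_congr rfl fun j _ => ?_
      have h2 : minorSum (L j * (1 : Matrix (Fin n) (Fin n) ℝ)) (scaleFirst n r⁻¹ 1)
          = r⁻¹ ^ nj j * minorSum (L j * (1 : Matrix (Fin n) (Fin n) ℝ)) 1 := by
        simp only [minorSum, Finset.mul_sum, minorTerm_scaleFirst, countLT_self]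
      rw [h2, Real.mul_rpow (by positivity) (hmin 1 (by simp) 1 (fun i => by simp) j).le,
        ← Real.rpow_natCast, ← Real.rpow_mul (by positivity), mul_comm (p j)]
    linarith
  · choose τ hτ hmax using fun j => exists_max_countLT (L j * U) (exists_minor_ne_zero (hL j) hU)
    exact ⟨τ, fun k hk => hle U hU k hk _ fun j σ hσ => hmax j σ hσ k hk, hτ⟩

end Necessity

section Duality

variable {m n : ℕ} {nj : Fin m → ℕ}

open Filter Topology

theorem exists_eq_transpose_mul_self {a : ℕ} {A : Matrix (Fin a) (Fin a) ℝ} (hA : A.PosDef) :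
    ∃ B : Matrix (Fin a) (Fin a) ℝ, A = Bᵀ * B := by
  obtain ⟨U, x, hU, hx, -, rfl⟩ := exists_eq_mul_diagonal_mul hA
  refine ⟨Matrix.diagonal (fun i => √(x i)) * Uᵀ, ?_⟩
  have hd : Matrix.diagonal x
      = Matrix.diagonal (fun i => √(x i)) * Matrix.diagonal fun i => √(x i) := by
    rw [Matrix.diagonal_mul_diagonal]
    congr 1
    ext i
    exact (Real.mul_self_sqrt (hx i).le).symm
  rw [hd]
  simp only [Matrix.transpose_mul, Matrix.transpose_transpose, Matrix.diagonal_transpose,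
    Matrix.mul_assoc]

theorem det_le_exp_trace_sub {a : ℕ} {P : Matrix (Fin a) (Fin a) ℝ} (hP : P.PosSemidef) :
    P.det ≤ Real.exp (P.trace - a) := by
  rw [hP.isHermitian.det_eq_prod_eigenvalues, hP.isHermitian.trace_eq_sum_eigenvalues]
  have h : ∑ i, hP.isHermitian.eigenvalues i - a = ∑ i, (hP.isHermitian.eigenvalues i - 1) := by
    simp
  simp only [RCLike.ofReal_real_eq_id, id]
  rw [h, Real.exp_sum]
  refine Finset.prod_le_prod (fun i _ => hP.eigenvalues_nonneg i) fun i _ => ?_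
  have := Real.add_one_le_exp (hP.isHermitian.eigenvalues i - 1)
  linarith

theorem det_mul_le_exp_trace_sub {a : ℕ} {A Y : Matrix (Fin a) (Fin a) ℝ} (hA : A.PosDef)
    (hY : Y.PosSemidef) : (A * Y).det ≤ Real.exp ((A * Y).trace - a) := by
  obtain ⟨B, rfl⟩ := exists_eq_transpose_mul_self hA
  have h := det_le_exp_trace_sub (hY.mul_mul_conjTranspose_same B)
  rw [Matrix.conjTranspose_eq_transpose_of_trivial, Matrix.trace_mul_comm, ← Matrix.mul_assoc,
    Matrix.det_mul_comm, ← Matrix.mul_assoc] at h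
  exact h

/-- The quadratic form `∑ p_j L_jᵀ A_j L_j` of a gaussian input. -/
noncomputable def gaussForm (L : ∀ j, Matrix (Fin (nj j)) (Fin n) ℝ) (p : Fin m → ℝ)
    (A : ∀ j, Matrix (Fin (nj j)) (Fin (nj j)) ℝ) : Matrix (Fin n) (Fin n) ℝ :=
  ∑ j, p j • ((L j)ᴴ * A j * L j)

theorem posSemidef_gaussForm {p : Fin m → ℝ} (hp : ∀ j, 0 ≤ p j)
    (L : ∀ j, Matrix (Fin (nj j)) (Fin n) ℝ)
    {A : ∀ j, Matrix (Fin (nj j)) (Fin (nj j)) ℝ} (hA : ∀ j, (A j).PosDef) :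
    (gaussForm L p A).PosSemidef :=
  Matrix.posSemidef_sum _ fun j _ => ((hA j).posSemidef.conjTranspose_mul_mul_same (L j)).smul (hp j)

theorem trace_gaussForm_mul (L : ∀ j, Matrix (Fin (nj j)) (Fin n) ℝ) (p : Fin m → ℝ)
    (A : ∀ j, Matrix (Fin (nj j)) (Fin (nj j)) ℝ) (X : Matrix (Fin n) (Fin n) ℝ) :
    (gaussForm L p A * X).trace = ∑ j, p j * (A j * (L j * X * (L j)ᵀ)).trace := by
  rw [gaussForm, Finset.sum_mul, Matrix.trace_sum]
  refine Finset.sum_congr rfl fun j _ => ?_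
  rw [Matrix.smul_mul, Matrix.trace_smul, smul_eq_mul, Matrix.conjTranspose_eq_transpose_of_trivial,
    Matrix.mul_assoc, Matrix.mul_assoc, Matrix.trace_mul_comm, Matrix.mul_assoc]

theorem prod_det_rpow_le {p : Fin m → ℝ} (hp : ∀ j, 0 ≤ p j)
    {L : ∀ j, Matrix (Fin (nj j)) (Fin n) ℝ}
    (hL : ∀ j, Function.Surjective (Matrix.toEuclideanLin (L j)))
    (hdim : (n : ℝ) = ∑ j, p j * nj j) {S : ℝ}
    (hS : ∀ X : Matrix (Fin n) (Fin n) ℝ, X.PosDef → dualFunctional L p X ≤ S)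
    {A : ∀ j, Matrix (Fin (nj j)) (Fin (nj j)) ℝ} (hA : ∀ j, (A j).PosDef) :
    ∏ j, (A j).det ^ p j ≤ S * (gaussForm L p A).det := by
  have key : ∀ t : ℝ, 0 < t → ∏ j, (A j).det ^ p j ≤ S * (gaussForm L p A + t • 1).det := by
    intro t ht
    have hM : (gaussForm L p A + t • 1).PosDef :=
      Matrix.PosDef.posSemidef_add (posSemidef_gaussForm hp L hA) (Matrix.PosDef.one.smul ht)
    set M := gaussForm L p A + t • 1 with hMdef
    have hX : (M⁻¹).PosDef := hM.inv
    have hMX : M * M⁻¹ = 1 := Matrix.mul_nonsing_inv _ hM.det_pos.ne'.isUnit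
    have hdet : M⁻¹.det * M.det = 1 := by
      rw [mul_comm, ← Matrix.det_mul, hMX, Matrix.det_one]
    have hY : ∀ j, (L j * M⁻¹ * (L j)ᵀ).PosDef := fun j => posDef_mul_mul_transpose (hL j) hX
    have h1 := hS _ hX
    have hpos : 0 < ∏ j, (L j * M⁻¹ * (L j)ᵀ).det ^ p j :=
      Finset.prod_pos fun j _ => Real.rpow_pos_of_pos (hY j).det_pos _
    have hS0 : 0 ≤ S := le_trans (div_nonneg hX.det_pos.le hpos.le) h1
    rw [dualFunctional, div_le_iff₀ hpos] at h1
    have htr : (gaussForm L p A * M⁻¹).trace ≤ n := by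
      have h2 : gaussForm L p A * M⁻¹ = 1 - t • M⁻¹ := by
        rw [← hMX, hMdef, add_mul]; simp
      rw [h2, Matrix.trace_sub, Matrix.trace_smul, Matrix.trace_one, Fintype.card_fin, smul_eq_mul]
      have := mul_nonneg ht.le hX.posSemidef.trace_nonneg
      linarith
    have h3 : (∏ j, (A j).det ^ p j) * ∏ j, (L j * M⁻¹ * (L j)ᵀ).det ^ p j ≤ 1 := by
      rw [← Finset.prod_mul_distrib]
      calc ∏ j, (A j).det ^ p j * (L j * M⁻¹ * (L j)ᵀ).det ^ p j
          ≤ ∏ j, Real.exp (p j * (A j * (L j * M⁻¹ * (L j)ᵀ)).trace - p j * nj j) := by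
            refine Finset.prod_le_prod (fun j _ => mul_nonneg
              (Real.rpow_nonneg (hA j).det_pos.le _) (Real.rpow_nonneg (hY j).det_pos.le _))
              fun j _ => ?_
            rw [← Real.mul_rpow (hA j).det_pos.le (hY j).det_pos.le, ← Matrix.det_mul, ← mul_sub,
              mul_comm (p j), Real.exp_mul]
            refine Real.rpow_le_rpow ?_ (det_mul_le_exp_trace_sub (hA j) (hY j).posSemidef) (hp j)
            rw [Matrix.det_mul]
            exact mul_nonneg (hA j).det_pos.le (hY j).det_pos.le
        _ ≤ 1 := by
            rw [← Real.exp_sum, Real.exp_le_one_iff, Finset.sum_sub_distrib, ← hdim,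
              ← trace_gaussForm_mul]
            linarith
    have hA0 : 0 ≤ ∏ j, (A j).det ^ p j :=
      Finset.prod_nonneg fun j _ => Real.rpow_nonneg (hA j).det_pos.le _
    calc ∏ j, (A j).det ^ p j = M⁻¹.det * (∏ j, (A j).det ^ p j) * M.det := by
          linear_combination -(∏ j, (A j).det ^ p j) * hdet
      _ ≤ (S * ∏ j, (L j * M⁻¹ * (L j)ᵀ).det ^ p j) * (∏ j, (A j).det ^ p j) * M.det := by
          have := hM.det_pos.le
          gcongr
      _ = S * ((∏ j, (A j).det ^ p j) * ∏ j, (L j * M⁻¹ * (L j)ᵀ).det ^ p j) * M.det := by ring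
      _ ≤ S * 1 * M.det := by
          have := hM.det_pos.le
          gcongr
      _ = _ := by ring
  have hlim : Tendsto (fun t : ℝ => S * (gaussForm L p A + t • 1).det) (𝓝[>] 0)
      (𝓝 (S * (gaussForm L p A).det)) := by
    have hc : Continuous fun t : ℝ => S * (gaussForm L p A + t • 1).det := by fun_prop
    have := hc.tendsto 0
    rw [zero_smul, add_zero] at this
    exact this.mono_left nhdsWithin_le_nhds
  refine ge_of_tendsto hlim ?_
  filter_upwards [self_mem_nhdsWithin] with t ht
  exact key t ht

/-- A positive matrix of trace `n` with determinant almost one is almost at most the identity. -/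
theorem dotProduct_mulVec_le_of_det {N : Matrix (Fin n) (Fin n) ℝ} (hN : N.PosDef)
    (htr : N.trace = n) {ε : ℝ} (hε : 0 ≤ ε) (hdet : 1 - ε ≤ N.det) (v : Fin n → ℝ) :
    v ⬝ᵥ (N *ᵥ v) ≤ (1 + √(2 * (1 + n + n ^ 2) * ε)) * (v ⬝ᵥ v) := by
  obtain ⟨U, x, hU, hx, -, rfl⟩ := exists_eq_mul_diagonal_mul hN
  have hU' : Uᵀ * U = 1 := mul_eq_one_comm.1 hU
  rw [det_mul_conj_diagonal U hU] at hdet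
  rw [Matrix.trace_mul_comm, ← Matrix.mul_assoc, hU', Matrix.one_mul, Matrix.trace_diagonal] at htr
  have hxi : ∀ i, x i ≤ 1 + √(2 * (1 + n + n ^ 2) * ε) := by
    intro i
    rcases le_or_gt (x i) 1 with h | h
    · exact h.trans (by have := Real.sqrt_nonneg (2 * (1 + n + n ^ 2) * ε); linarith)
    have hle : x i ≤ n := by
      rw [← htr]
      exact Finset.single_le_sum (fun k _ => (hx k).le) (Finset.mem_univ i)
    have h1 : ∏ k ∈ Finset.univ.erase i, x k ≤ Real.exp (-(x i - 1)) := by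
      calc ∏ k ∈ Finset.univ.erase i, x k ≤ ∏ k ∈ Finset.univ.erase i, Real.exp (x k - 1) :=
            Finset.prod_le_prod (fun k _ => (hx k).le) fun k _ => by
              have := Real.add_one_le_exp (x k - 1); linarith
        _ = Real.exp (-(x i - 1)) := by
            rw [← Real.exp_sum]
            congr 1
            have := Finset.add_sum_erase Finset.univ (fun k => x k - 1) (Finset.mem_univ i)
            simp only [Finset.sum_sub_distrib, htr] at this ⊢
            simp at this ⊢
            linarith
    rw [← Finset.mul_prod_erase _ _ (Finset.mem_univ i)] at hdet
    set t := x i - 1 with ht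
    have ht0 : 0 ≤ t := by linarith
    have hq := Real.quadratic_le_exp_of_nonneg ht0
    have h2 : 1 - ε ≤ (1 + t) * Real.exp (-t) :=
      hdet.trans (by rw [show x i = 1 + t by linarith]; gcongr)
    have h3 : (1 - ε) * Real.exp t ≤ 1 + t := by
      have := mul_le_mul_of_nonneg_right h2 (Real.exp_pos t).le
      rwa [mul_assoc, ← Real.exp_add, neg_add_cancel, Real.exp_zero, mul_one] at this
    have htn : t ≤ n := by linarith
    have hn0 : (0 : ℝ) ≤ n := Nat.cast_nonneg n
    have h4 : t ^ 2 ≤ 2 * (1 + n + n ^ 2) * ε := by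
      by_cases hε1 : ε ≤ 1
      · have h5 : (1 - ε) * (1 + t + t ^ 2 / 2) ≤ 1 + t :=
          (mul_le_mul_of_nonneg_left hq (by linarith)).trans h3
        have h6 : t ^ 2 ≤ n ^ 2 := pow_le_pow_left₀ ht0 htn 2
        have h7 : ε * (1 + t + t ^ 2 / 2) ≤ ε * (1 + n + n ^ 2) := by
          refine mul_le_mul_of_nonneg_left ?_ hε
          nlinarith [sq_nonneg t]
        linarith
      · have h6 : t ^ 2 ≤ n ^ 2 := pow_le_pow_left₀ ht0 htn 2
        nlinarith [sq_nonneg (n : ℝ)]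
    have := Real.le_sqrt_of_sq_le h4
    linarith
  have h1 : v ⬝ᵥ ((U * Matrix.diagonal x * Uᵀ) *ᵥ v) = ∑ i, x i * (Uᵀ *ᵥ v) i ^ 2 := by
    rw [← Matrix.mulVec_mulVec, ← Matrix.mulVec_mulVec, Matrix.dotProduct_mulVec,
      ← Matrix.mulVec_transpose]
    simp only [dotProduct, Matrix.mulVec_diagonal]
    exact Finset.sum_congr rfl fun i _ => by ring
  have h2 : v ⬝ᵥ v = ∑ i, (Uᵀ *ᵥ v) i ^ 2 := by
    have h3 : v ⬝ᵥ v = v ⬝ᵥ ((U * Uᵀ) *ᵥ v) := by rw [hU, Matrix.one_mulVec]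
    rw [h3, ← Matrix.mulVec_mulVec, Matrix.dotProduct_mulVec, ← Matrix.mulVec_transpose]
    simp only [dotProduct, sq]
  rw [h1, h2, Finset.mul_sum]
  exact Finset.sum_le_sum fun i _ => mul_le_mul_of_nonneg_right (hxi i) (sq_nonneg _)

end Duality

section FiniteConstant

variable {m n : ℕ} {nj : Fin m → ℕ}

theorem exists_eq_mul_transpose {a : ℕ} {A : Matrix (Fin a) (Fin a) ℝ} (hA : A.PosDef) :
    ∃ K : Matrix (Fin a) (Fin a) ℝ, A = K * Kᵀ := by
  obtain ⟨B, hB⟩ := exists_eq_transpose_mul_self hA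
  exact ⟨Bᵀ, by rw [Matrix.transpose_transpose, hB]⟩

theorem lintegral_comp_toEuclideanLin {a : ℕ} {K : Matrix (Fin a) (Fin a) ℝ} (hK : K.det ≠ 0)
    {f : EuclideanSpace ℝ (Fin a) → ℝ≥0∞} (hf : Measurable f) :
    ∫⁻ x, f (Matrix.toEuclideanLin K x) = ENNReal.ofReal |K.det|⁻¹ * ∫⁻ x, f x := by
  have hdet : LinearMap.det (Matrix.toEuclideanLin K) = K.det := LinearMap.det_toLpLin 2 K
  have hm : Measurable (Matrix.toEuclideanLin K) :=
    (LinearMap.continuous_of_finiteDimensional _).measurable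
  rw [← lintegral_map hf hm, Measure.map_linearMap_addHaar_eq_smul_addHaar volume
    (by rw [hdet]; exact hK), hdet, lintegral_smul_measure, abs_inv, smul_eq_mul]

theorem lintegral_eq_abs_det_mul {a : ℕ} {K : Matrix (Fin a) (Fin a) ℝ} (hK : K.det ≠ 0)
    {f : EuclideanSpace ℝ (Fin a) → ℝ≥0∞} (hf : Measurable f) :
    ∫⁻ x, f x = ENNReal.ofReal |K.det| * ∫⁻ x, f (Matrix.toEuclideanLin K x) := by
  have h : 0 < |K.det| := abs_pos.2 hK
  rw [lintegral_comp_toEuclideanLin hK hf, ← mul_assoc, ← ENNReal.ofReal_mul h.le,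
    mul_inv_cancel₀ h.ne', ENNReal.ofReal_one, one_mul]

theorem toEuclideanLin_mul_apply {a b c : ℕ} (A : Matrix (Fin a) (Fin b) ℝ)
    (B : Matrix (Fin b) (Fin c) ℝ) (x : EuclideanSpace ℝ (Fin c)) :
    Matrix.toEuclideanLin (A * B) x = Matrix.toEuclideanLin A (Matrix.toEuclideanLin B x) := by
  simp [Matrix.toLpLin_apply, Matrix.mulVec_mulVec]

theorem toEuclideanLin_one_apply {a : ℕ} (x : EuclideanSpace ℝ (Fin a)) :
    Matrix.toEuclideanLin (1 : Matrix (Fin a) (Fin a) ℝ) x = x := by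
  simp

theorem adjoint_toContinuousLinearMap_toEuclideanLin {a b : ℕ} (W : Matrix (Fin a) (Fin b) ℝ) :
    ContinuousLinearMap.adjoint (LinearMap.toContinuousLinearMap (Matrix.toEuclideanLin W))
      = LinearMap.toContinuousLinearMap (Matrix.toEuclideanLin Wᵀ) := by
  rw [← Matrix.conjTranspose_eq_transpose_of_trivial, Matrix.toEuclideanLin_conjTranspose_eq_adjoint,
    LinearMap.adjoint_toContinuousLinearMap]

theorem toEuclideanLin_adjoint_apply {a b : ℕ} {W : Matrix (Fin a) (Fin b) ℝ} (hW : W * Wᵀ = 1)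
    (y : EuclideanSpace ℝ (Fin a)) :
    LinearMap.toContinuousLinearMap (Matrix.toEuclideanLin W)
      (ContinuousLinearMap.adjoint (LinearMap.toContinuousLinearMap (Matrix.toEuclideanLin W)) y)
      = y := by
  rw [adjoint_toContinuousLinearMap_toEuclideanLin, LinearMap.coe_toContinuousLinearMap',
    LinearMap.coe_toContinuousLinearMap', ← toEuclideanLin_mul_apply, hW, toEuclideanLin_one_apply]

theorem norm_sq_toEuclideanLin {a b : ℕ} (W : Matrix (Fin a) (Fin b) ℝ)
    (x : EuclideanSpace ℝ (Fin b)) :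
    ‖Matrix.toEuclideanLin W x‖ ^ 2 = x.ofLp ⬝ᵥ ((Wᵀ * W) *ᵥ x.ofLp) := by
  rw [EuclideanSpace.real_norm_sq_eq, Matrix.dotProduct_mulVec, ← Matrix.vecMul_vecMul,
    Matrix.vecMul_transpose, ← Matrix.dotProduct_mulVec]
  simp [Matrix.toLpLin_apply, dotProduct, sq]

theorem norm_toEuclideanLin_le_of_mul_transpose {a b : ℕ} {W : Matrix (Fin a) (Fin b) ℝ}
    (hW : W * Wᵀ = 1) (x : EuclideanSpace ℝ (Fin b)) : ‖Matrix.toEuclideanLin W x‖ ≤ ‖x‖ := by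
  set T := LinearMap.toContinuousLinearMap (Matrix.toEuclideanLin W) with hT
  have h1 : ‖T x‖ ^ 2 ≤ ‖x‖ * ‖T x‖ := by
    have h2 : ‖ContinuousLinearMap.adjoint T (T x)‖ ^ 2 = ‖T x‖ ^ 2 := by
      rw [← real_inner_self_eq_norm_sq, ← real_inner_self_eq_norm_sq,
        ContinuousLinearMap.adjoint_inner_right, hT, toEuclideanLin_adjoint_apply hW]
    have h3 : ‖ContinuousLinearMap.adjoint T (T x)‖ = ‖T x‖ := by
      rwa [sq_eq_sq₀ (norm_nonneg _) (norm_nonneg _)] at h2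
    rw [← real_inner_self_eq_norm_sq, ← ContinuousLinearMap.adjoint_inner_right, ← h3]
    exact real_inner_le_norm _ _
  change ‖T x‖ ≤ ‖x‖
  by_contra! h
  nlinarith [norm_nonneg x]

theorem inv_mul_mul_mul_transpose_eq_one {a b : ℕ} {L : Matrix (Fin a) (Fin b) ℝ}
    {K : Matrix (Fin b) (Fin b) ℝ} {P : Matrix (Fin a) (Fin a) ℝ} (hP : P.det ≠ 0)
    (h : L * (K * Kᵀ) * Lᵀ = P * Pᵀ) : (P⁻¹ * (L * K)) * (P⁻¹ * (L * K))ᵀ = 1 := by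
  have h1 : P⁻¹ * P = 1 := Matrix.nonsing_inv_mul _ hP.isUnit
  calc (P⁻¹ * (L * K)) * (P⁻¹ * (L * K))ᵀ = P⁻¹ * (L * (K * Kᵀ) * Lᵀ) * (P⁻¹)ᵀ := by
        simp only [Matrix.transpose_mul, Matrix.mul_assoc]
    _ = (P⁻¹ * P) * (P⁻¹ * P)ᵀ := by rw [h]; simp only [Matrix.transpose_mul, Matrix.mul_assoc]
    _ = 1 := by rw [h1]; simp

theorem det_ne_zero_of_posDef_mul_transpose {a : ℕ} {K : Matrix (Fin a) (Fin a) ℝ}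
    (h : (K * Kᵀ).PosDef) : K.det ≠ 0 := by
  have := h.det_pos
  rw [Matrix.det_mul, Matrix.det_transpose] at this
  exact fun h0 => by simp [h0] at this

theorem dualFunctional_eq_sq {L : ∀ j, Matrix (Fin (nj j)) (Fin n) ℝ} {p : Fin m → ℝ}
    {K : Matrix (Fin n) (Fin n) ℝ} {P : ∀ j, Matrix (Fin (nj j)) (Fin (nj j)) ℝ}
    (h : ∀ j, L j * (K * Kᵀ) * (L j)ᵀ = P j * (P j)ᵀ) :
    dualFunctional L p (K * Kᵀ) = (|K.det| / ∏ j, |(P j).det| ^ p j) ^ 2 := by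
  rw [dualFunctional, div_pow, sq_abs, ← Finset.prod_pow, Matrix.det_mul, Matrix.det_transpose, sq]
  congr 1
  refine Finset.prod_congr rfl fun j _ => ?_
  rw [h, Matrix.det_mul, Matrix.det_transpose, sq, ← Real.mul_rpow (abs_nonneg _) (abs_nonneg _),
    abs_mul_abs_self]

theorem exists_dualFunctional_le_of_matBL_ne_top {p : Fin m → ℝ} (hp : ∀ j, 0 ≤ p j)
    {L : ∀ j, Matrix (Fin (nj j)) (Fin n) ℝ}
    (hL : ∀ j, Function.Surjective (Matrix.toEuclideanLin (L j))) (hfin : matBL nj L p ≠ ⊤) :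
    ∃ C, ∀ X : Matrix (Fin n) (Fin n) ℝ, X.PosDef → dualFunctional L p X ≤ C := by
  obtain ⟨C, hC, hCtop⟩ := sInf_lt_iff.1 (lt_top_iff_ne_top.2 hfin)
  let v : ℕ → ℝ≥0∞ := fun a => volume (Metric.closedBall (0 : EuclideanSpace ℝ (Fin a)) 1)
  have hv0 : ∀ a, v a ≠ 0 := fun a => (Metric.measure_closedBall_pos _ _ one_pos).ne'
  have hvt : ∀ a, v a ≠ ⊤ := fun a => measure_closedBall_lt_top.ne
  have hCt : C * ∏ j, v (nj j) ^ p j ≠ ⊤ :=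
    ENNReal.mul_ne_top hCtop.ne (ENNReal.prod_ne_top fun j _ =>
      ENNReal.rpow_ne_top_of_nonneg (hp j) (hvt _))
  refine ⟨((C * ∏ j, v (nj j) ^ p j).toReal / (v n).toReal) ^ 2, fun X hX => ?_⟩
  obtain ⟨K, rfl⟩ := exists_eq_mul_transpose hX
  have hK := det_ne_zero_of_posDef_mul_transpose hX
  have hY : ∀ j, (L j * (K * Kᵀ) * (L j)ᵀ).PosDef := fun j => posDef_mul_mul_transpose (hL j) hX
  choose P hP using fun j => exists_eq_mul_transpose (hY j)
  have hPdet : ∀ j, (P j).det ≠ 0 := fun j =>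
    det_ne_zero_of_posDef_mul_transpose (by rw [← hP]; exact hY j)
  rw [dualFunctional_eq_sq hP]
  refine pow_le_pow_left₀ (div_nonneg (abs_nonneg _) (Finset.prod_nonneg fun j _ =>
    Real.rpow_nonneg (abs_nonneg _) _)) ?_ 2
  let B : ∀ a, EuclideanSpace ℝ (Fin a) → ℝ≥0∞ := fun a =>
    (Metric.closedBall (0 : EuclideanSpace ℝ (Fin a)) 1).indicator 1
  have hB : ∀ a, Measurable (B a) := fun a => measurable_one.indicator
    Metric.isClosed_closedBall.measurableSet
  have hBv : ∀ a, ∫⁻ x, B a x = v a := fun a =>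
    lintegral_indicator_one Metric.isClosed_closedBall.measurableSet
  have hlin : ∀ {a b : ℕ} (W : Matrix (Fin a) (Fin b) ℝ), Measurable (Matrix.toEuclideanLin W) :=
    fun W => (LinearMap.continuous_of_finiteDimensional _).measurable
  let f : ∀ j, EuclideanSpace ℝ (Fin (nj j)) → ℝ≥0∞ := fun j y =>
    B _ (Matrix.toEuclideanLin (P j)⁻¹ y)
  have hf : ∀ j, Measurable (f j) := fun j => (hB _).comp (hlin _)
  have h1 := hC f hf
  have h2 : ∀ j, ∫⁻ y, f j y = ENNReal.ofReal |(P j).det| * v (nj j) := by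
    intro j
    have h3 : ((P j)⁻¹).det ≠ 0 := by
      rw [Matrix.det_nonsing_inv, Ring.inverse_eq_inv']
      exact inv_ne_zero (hPdet j)
    rw [lintegral_comp_toEuclideanLin h3 (hB _), Matrix.det_nonsing_inv, Ring.inverse_eq_inv',
      abs_inv, inv_inv, hBv]
  have h3 : ENNReal.ofReal |K.det| * v n
      ≤ ∫⁻ x, ∏ j, (f j (Matrix.toEuclideanLin (L j) x)) ^ p j := by
    rw [lintegral_eq_abs_det_mul hK (f := fun x => ∏ j, (f j (Matrix.toEuclideanLin (L j) x)) ^ p j)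
      (Finset.measurable_prod _ fun j _ => ((hf j).comp (hlin _)).pow_const _), ← hBv]
    gcongr with x
    by_cases hx : x ∈ Metric.closedBall (0 : EuclideanSpace ℝ (Fin n)) 1
    · refine (Set.indicator_le_self' (fun _ _ => zero_le) x).trans ?_
      rw [Finset.prod_eq_one]
      · rfl
      intro j _
      have h4 : Matrix.toEuclideanLin (P j)⁻¹ (Matrix.toEuclideanLin (L j)
          (Matrix.toEuclideanLin K x)) ∈ Metric.closedBall 0 1 := by
        rw [← toEuclideanLin_mul_apply, ← toEuclideanLin_mul_apply, mem_closedBall_zero_iff,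
          Matrix.mul_assoc]
        exact (norm_toEuclideanLin_le_of_mul_transpose
          (inv_mul_mul_mul_transpose_eq_one (hPdet j) (hP j)) x).trans
          (mem_closedBall_zero_iff.1 hx)
      simp only [f, B, Set.indicator_of_mem h4, Pi.one_apply, ENNReal.one_rpow]
    · simp [B, Set.indicator_of_notMem hx]
  have h4 := h3.trans h1
  simp only [h2] at h4
  have h5 : ∏ j, (ENNReal.ofReal |(P j).det| * v (nj j)) ^ p j
      = ENNReal.ofReal (∏ j, |(P j).det| ^ p j) * ∏ j, v (nj j) ^ p j := by
    rw [ENNReal.ofReal_prod_of_nonneg fun j _ => Real.rpow_nonneg (abs_nonneg _) _,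
      ← Finset.prod_mul_distrib]
    refine Finset.prod_congr rfl fun j _ => ?_
    rw [ENNReal.mul_rpow_of_nonneg _ _ (hp j), ENNReal.ofReal_rpow_of_nonneg (abs_nonneg _) (hp j)]
  rw [h5, mul_left_comm] at h4
  have h6 := ENNReal.toReal_mono (ENNReal.mul_ne_top ENNReal.ofReal_ne_top hCt) h4
  have hPp : 0 < ∏ j, |(P j).det| ^ p j :=
    Finset.prod_pos fun j _ => Real.rpow_pos_of_pos (abs_pos.2 (hPdet j)) _
  rw [ENNReal.toReal_mul, ENNReal.toReal_mul, ENNReal.toReal_ofReal (abs_nonneg _),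
    ENNReal.toReal_ofReal hPp.le] at h6
  rw [div_le_div_iff₀ hPp (ENNReal.toReal_pos (hv0 _) (hvt _))]
  linarith

end FiniteConstant

section GaussianDensity
open ProbabilityTheory InnerProductSpace Real

variable {E : Type*} [NormedAddCommGroup E] [InnerProductSpace ℝ E] [FiniteDimensional ℝ E]
  [MeasurableSpace E] [BorelSpace E]

variable (E) in
/-- The normalising constant `(2π)^(-d/2)` of the standard gaussian density. -/
noncomputable def gaussNorm : ℝ := (2 * π) ^ (-(Module.finrank ℝ E / 2 : ℝ))

theorem gaussNorm_pos (V : Type*) [NormedAddCommGroup V] [InnerProductSpace ℝ V] :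
    0 < gaussNorm V := rpow_pos_of_pos (by positivity) _

variable (E) in
theorem stdGaussian_eq_withDensity :
    stdGaussian E = volume.withDensity
      fun x => ENNReal.ofReal (gaussNorm E * rexp (-(1 / 2) * ‖x‖ ^ 2)) := by
  have hg := gaussNorm_pos E
  have hi : Integrable fun x : E => gaussNorm E * rexp (-(1 / 2) * ‖x‖ ^ 2) := by
    refine Integrable.const_mul ?_ _
    have h := (GaussianFourier.integrable_cexp_neg_mul_sq_norm_add (V := E) (b := 1 / 2)
      (by norm_num) 0 0).norm
    refine h.congr (Filter.Eventually.of_forall fun x => ?_)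
    have h1 : -(1 / 2 : ℂ) * ‖x‖ ^ 2 = ((-(1 / 2) * ‖x‖ ^ 2 : ℝ) : ℂ) := by push_cast; rfl
    simp only [zero_mul, add_zero, Complex.norm_exp, h1, Complex.ofReal_re]
  have := isFiniteMeasure_withDensity_ofReal hi.2
  apply Measure.ext_of_charFun
  ext t
  rw [charFun_stdGaussian, charFun_apply, integral_withDensity_eq_integral_toReal_smul
    (by fun_prop) (Filter.Eventually.of_forall fun x => ENNReal.ofReal_lt_top)]
  have h1 : ∀ x : E, (ENNReal.ofReal (gaussNorm E * rexp (-(1 / 2) * ‖x‖ ^ 2))).toReal •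
      Complex.exp (inner ℝ x t * Complex.I) = (gaussNorm E : ℂ) *
        Complex.exp (-(1 / 2 : ℂ) * ‖x‖ ^ 2 + Complex.I * inner ℝ t x) := by
    intro x
    rw [ENNReal.toReal_ofReal (by positivity), Complex.real_smul, Complex.exp_add,
      real_inner_comm, mul_comm Complex.I]
    push_cast
    ring
  simp_rw [h1]
  rw [integral_const_mul, GaussianFourier.integral_cexp_neg_mul_sq_norm_add (by norm_num)]
  have h2 : ((π : ℂ) / (1 / 2)) ^ (Module.finrank ℝ E / 2 : ℂ)
      = (((2 * π) ^ (Module.finrank ℝ E / 2 : ℝ) : ℝ) : ℂ) := by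
    rw [Complex.ofReal_cpow (by positivity)]
    push_cast
    congr 1
    ring
  rw [h2, ← mul_assoc, ← Complex.ofReal_mul, gaussNorm, ← Real.rpow_add (by positivity),
    neg_add_cancel, Real.rpow_zero, Complex.ofReal_one, one_mul]
  congr 1
  rw [Complex.I_sq]
  ring

theorem lintegral_stdGaussian_le {G : E → ℝ≥0∞} (hG : Measurable G) :
    ∫⁻ x, G x ∂(stdGaussian E) ≤ ENNReal.ofReal (gaussNorm E) * ∫⁻ x, G x := by
  rw [stdGaussian_eq_withDensity, lintegral_withDensity_eq_lintegral_mul _ (by fun_prop) hG,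
    ← lintegral_const_mul _ hG]
  refine lintegral_mono fun x => ?_
  rw [Pi.mul_apply]
  gcongr
  refine mul_le_of_le_one_right (gaussNorm_pos E).le (exp_le_one_iff.2 ?_)
  nlinarith [sq_nonneg ‖x‖]

theorem setLIntegral_closedBall_le_stdGaussian {G : E → ℝ≥0∞} (hG : Measurable G) (T : ℝ) :
    ∫⁻ x in Metric.closedBall 0 T, G x
      ≤ ENNReal.ofReal ((gaussNorm E)⁻¹ * rexp (T ^ 2 / 2)) * ∫⁻ x, G x ∂(stdGaussian E) := by
  have hg := gaussNorm_pos E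
  rw [stdGaussian_eq_withDensity, lintegral_withDensity_eq_lintegral_mul _ (by fun_prop) hG,
    ← lintegral_const_mul _ (by fun_prop),
    ← lintegral_indicator Metric.isClosed_closedBall.measurableSet]
  refine lintegral_mono fun x => ?_
  by_cases hx : x ∈ Metric.closedBall (0 : E) T
  · rw [Set.indicator_of_mem hx, Pi.mul_apply, ← mul_assoc, ← ENNReal.ofReal_mul (by positivity)]
    refine le_mul_of_one_le_left zero_le ?_
    rw [ENNReal.one_le_ofReal]
    have h1 : (gaussNorm E)⁻¹ * rexp (T ^ 2 / 2) * (gaussNorm E * rexp (-(1 / 2) * ‖x‖ ^ 2))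
        = rexp (T ^ 2 / 2 + -(1 / 2) * ‖x‖ ^ 2) := by
      rw [exp_add]
      field_simp
    rw [h1, one_le_exp_iff]
    have h2 := mem_closedBall_zero_iff.1 hx
    have := pow_le_pow_left₀ (norm_nonneg x) h2 2
    linarith
  · rw [Set.indicator_of_notMem hx]
    exact zero_le

/-- A localised Brascamp–Lieb inequality for almost geometric data. -/
theorem setLIntegral_closedBall_prod_le {m : ℕ} {F : Fin m → Type*}
    [∀ j, NormedAddCommGroup (F j)] [∀ j, InnerProductSpace ℝ (F j)]
    [∀ j, FiniteDimensional ℝ (F j)] [∀ j, MeasurableSpace (F j)] [∀ j, BorelSpace (F j)]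
    (W : ∀ j, E →L[ℝ] F j) (hW : ∀ j y, W j ((W j).adjoint y) = y) {p : Fin m → ℝ}
    (hp : ∀ j, 0 ≤ p j) {l : ℝ} (hl : 1 ≤ l)
    (hWp : ∀ x, ∑ j, p j * ‖W j x‖ ^ 2 ≤ l * ‖x‖ ^ 2) {k : ℝ} (hk : 1 ≤ k)
    {g : ∀ j, F j → ℝ≥0∞} (hg : ∀ j, Measurable (g j)) (hgk : ∀ j y, g j y ≤ ENNReal.ofReal k)
    (T : ℝ) :
    ∫⁻ z in Metric.closedBall 0 T, ∏ j, g j (W j z) ^ p j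
      ≤ ENNReal.ofReal ((gaussNorm E)⁻¹ * rexp (T ^ 2 / 2)) *
        ∏ j, (ENNReal.ofReal (k ^ (l - 1) * gaussNorm (F j)) * ∫⁻ y, g j y) ^ (p j / l) := by
  have hl0 : 0 < l := by linarith
  have hgt : ∀ j y, g j y ≠ ⊤ := fun j y => ne_top_of_le_ne_top ENNReal.ofReal_ne_top (hgk j y)
  let w : ∀ j, F j → ℝ := fun j y => (g j y).toReal ^ (l / 2)
  have hw2 : ∀ j y, ENNReal.ofReal (w j y ^ 2) = g j y ^ l := by
    intro j y
    rw [← Real.rpow_natCast, ← Real.rpow_mul ENNReal.toReal_nonneg, Nat.cast_ofNat,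
      div_mul_cancel₀ l two_ne_zero, ← ENNReal.ofReal_rpow_of_nonneg ENNReal.toReal_nonneg hl0.le,
      ENNReal.ofReal_toReal (hgt j y)]
  have hwm : ∀ j, MemLp (w j) 2 (stdGaussian (F j)) := by
    intro j
    refine MemLp.of_bound (((hg j).ennreal_toReal.pow_const _).aestronglyMeasurable)
      (k ^ (l / 2)) (Filter.Eventually.of_forall fun y => ?_)
    rw [Real.norm_of_nonneg (Real.rpow_nonneg ENNReal.toReal_nonneg _)]
    exact Real.rpow_le_rpow ENNReal.toReal_nonneg
      (ENNReal.toReal_le_of_le_ofReal (by linarith) (hgk j y)) (by linarith)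
  have hGL := lintegral_stdGaussian_prod_le W hW (fun j => p j / l)
    (fun j => div_nonneg (hp j) hl0.le) (fun x => by
      have h := hWp x
      have h2 : ∑ j, p j / l * ‖W j x‖ ^ 2 = (∑ j, p j * ‖W j x‖ ^ 2) / l := by
        rw [Finset.sum_div]
        exact Finset.sum_congr rfl fun j _ => by ring
      rw [h2, div_le_iff₀ hl0]
      linarith) w hwm
  simp only [hw2] at hGL
  have h1 : ∀ z, ∏ j, (g j (W j z) ^ l) ^ (p j / l) = ∏ j, g j (W j z) ^ p j := fun z =>
    Finset.prod_congr rfl fun j _ => by rw [← ENNReal.rpow_mul, mul_div_cancel₀ _ hl0.ne']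
  simp only [h1] at hGL
  refine (setLIntegral_closedBall_le_stdGaussian (Finset.measurable_prod _ fun j _ =>
    ((hg j).comp (W j).continuous.measurable).pow_const _) T).trans ?_
  gcongr
  refine hGL.trans ?_
  gcongr with j
  · exact div_nonneg (hp j) hl0.le
  calc ∫⁻ y, g j y ^ l ∂(stdGaussian (F j))
      ≤ ENNReal.ofReal (gaussNorm (F j)) * ∫⁻ y, g j y ^ l :=
        lintegral_stdGaussian_le ((hg j).pow_const _)
    _ ≤ ENNReal.ofReal (gaussNorm (F j)) * ∫⁻ y, ENNReal.ofReal (k ^ (l - 1)) * g j y := by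
        gcongr with y
        rw [← ENNReal.ofReal_rpow_of_nonneg (by linarith) (by linarith)]
        have h2 : g j y ^ l = g j y ^ (l - 1) * g j y := by
          conv_rhs => rw [← ENNReal.rpow_one (g j y), ← ENNReal.rpow_mul, one_mul]
          rw [← ENNReal.rpow_add_of_nonneg _ _ (by linarith) zero_le_one, sub_add_cancel]
        rw [h2]
        gcongr
        exact hgk j y
    _ = _ := by
        rw [lintegral_const_mul _ (hg j), ← mul_assoc, ← ENNReal.ofReal_mul (gaussNorm_pos _).le,
          mul_comm (gaussNorm _)]

end GaussianDensity

section NearMaximizer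

variable {m n : ℕ} {nj : Fin m → ℕ}

theorem gapLoss_pow_le_exp {p : Fin m → ℝ} (hp : ∀ j, 0 ≤ p j) (nj : Fin m → ℕ) (n : ℕ)
    {B c R : ℝ} (hR : 0 < R) :
    gapLoss nj n p B c R ^ n
      ≤ Real.exp (n * (∑ j, p j * ((n : ℝ) ^ nj j * exchangeConst (nj j) B c ^ 2)) / R) := by
  have h1 : gapLoss nj n p B c R
      ≤ Real.exp ((∑ j, p j * ((n : ℝ) ^ nj j * exchangeConst (nj j) B c ^ 2)) / R) := by
    rw [Finset.sum_div, Real.exp_sum]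
    unfold gapLoss
    have h0 : ∀ j, 0 ≤ (n : ℝ) ^ nj j * exchangeConst (nj j) B c ^ 2 / R := fun j => by positivity
    refine Finset.prod_le_prod (fun j _ => Real.rpow_nonneg (by linarith [h0 j]) _) fun j _ => ?_
    rw [show p j * ((n : ℝ) ^ nj j * exchangeConst (nj j) B c ^ 2) / R
      = ((n : ℝ) ^ nj j * exchangeConst (nj j) B c ^ 2 / R) * p j by ring, Real.exp_mul]
    refine Real.rpow_le_rpow (by linarith [h0 j]) ?_ (hp j)
    rw [add_comm]
    exact Real.add_one_le_exp _
  calc gapLoss nj n p B c R ^ n ≤ _ ^ n :=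
        pow_le_pow_left₀ (zero_le_one.trans (one_le_gapLoss hp nj n hR)) h1 n
    _ = _ := by rw [← Real.exp_nat_mul, mul_div_assoc]

theorem abs_mul_diagonal_mul_transpose_le {a : ℕ} {W : Matrix (Fin a) (Fin n) ℝ} {B M : ℝ}
    (hB : 0 ≤ B) (hW : ∀ i l, |W i l| ≤ B) {x : Fin n → ℝ} (hx : ∀ i, 0 ≤ x i)
    (hxM : ∀ i, x i ≤ M) (i l : Fin a) :
    |(W * Matrix.diagonal x * Wᵀ) i l| ≤ n * B ^ 2 * M := by
  rw [Matrix.mul_apply]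
  refine (Finset.abs_sum_le_sum_abs _ _).trans ?_
  calc ∑ k, |(W * Matrix.diagonal x) i k * Wᵀ k l| ≤ ∑ _k : Fin n, B ^ 2 * M := by
        refine Finset.sum_le_sum fun k _ => ?_
        rw [Matrix.mul_diagonal, Matrix.transpose_apply, abs_mul, abs_mul, abs_of_nonneg (hx k)]
        calc |W i k| * x k * |W l k| ≤ B * M * B := by
              have := hx k
              have := hxM k
              gcongr
              · exact mul_nonneg hB (this.trans' (hx k))
              · exact hW i k
              · exact hW l k
          _ = B ^ 2 * M := by ring
    _ = n * B ^ 2 * M := by simp; ring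

theorem exists_near_maximizer {p : Fin m → ℝ} (hp : ∀ j, 0 ≤ p j) {B c : ℝ} (hB : 1 ≤ B)
    (hc : 0 < c) (hdim : (n : ℝ) = ∑ j, p j * nj j) :
    ∃ (Q : ℝ) (N : ℕ), 1 ≤ Q ∧ ∀ L : ∀ j, Matrix (Fin (nj j)) (Fin n) ℝ, UniformlyGood L p B c →
      ∀ S : ℝ, 0 < S → (∀ S' < S, ∃ X : Matrix (Fin n) (Fin n) ℝ, X.PosDef ∧
        S' < dualFunctional L p X) →
      ∀ ε : ℝ, 0 < ε → ε ≤ 1 → ∃ K : Matrix (Fin n) (Fin n) ℝ, (K * Kᵀ).PosDef ∧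
        (∀ y, ‖y‖ ≤ ‖Matrix.toEuclideanLin K y‖) ∧ (1 - ε) * S ≤ dualFunctional L p (K * Kᵀ) ∧
        ∀ j, (L j * (K * Kᵀ) * (L j)ᵀ).det ≤ Q / ε ^ N ∧
          (∀ i l, |(L j * (K * Kᵀ) * (L j)ᵀ) i l| ≤ Q / ε ^ N) ∧
          ∀ i l, |(L j * (K * Kᵀ) * (L j)ᵀ)⁻¹ i l| ≤ Q / ε ^ N := by
  set A := n * ∑ j, p j * ((n : ℝ) ^ nj j * exchangeConst (nj j) B c ^ 2) with hA
  have hA0 : 0 ≤ A := mul_nonneg (Nat.cast_nonneg n)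
    (Finset.sum_nonneg fun j _ => mul_nonneg (hp j) (by positivity))
  set q := 1 + ∑ j, exchangeConst (nj j) B c ^ 2 + 2 * A with hq
  have hqj : ∀ j, exchangeConst (nj j) B c ^ 2 ≤ ∑ j, exchangeConst (nj j) B c ^ 2 := fun j =>
    Finset.single_le_sum (f := fun j => exchangeConst (nj j) B c ^ 2)
      (fun _ _ => sq_nonneg _) (Finset.mem_univ j)
  have hq0 : 0 ≤ ∑ j, exchangeConst (nj j) B c ^ 2 := Finset.sum_nonneg fun _ _ => sq_nonneg _
  have hq1 : 1 ≤ q := by linarith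
  set s := ∑ j, nj j with hs
  have hsj : ∀ j, nj j ≤ s := fun j => Finset.single_le_sum (f := nj) (fun _ _ => Nat.zero_le _)
    (Finset.mem_univ j)
  set b := (1 + n * B ^ 2) * q ^ n with hb
  have hb1 : 1 ≤ b := one_le_mul_of_one_le_of_one_le
    (by have : 0 ≤ n * B ^ 2 := by positivity
        linarith) (one_le_pow₀ hq1)
  set F : ℝ := (s.factorial : ℝ) with hF
  have hF1 : 1 ≤ F := by
    rw [hF]; exact_mod_cast Nat.one_le_iff_ne_zero.2 (Nat.factorial_ne_zero s)
  have hc2 : 0 < (c ^ 2)⁻¹ := by positivity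
  refine ⟨(1 + F * (c ^ 2)⁻¹) * (F * b ^ (s + 1)), n * (s + 1), ?_, ?_⟩
  · refine one_le_mul_of_one_le_of_one_le ?_ (one_le_mul_of_one_le_of_one_le hF1 (one_le_pow₀ hb1))
    have := mul_nonneg (zero_le_one.trans hF1) hc2.le
    linarith
  intro L hL S hS0 hS ε hε hε1
  set R := q / ε with hR
  have hqR : q ≤ R := by rw [hR, le_div_iff₀ hε]; nlinarith
  have hR1 : 1 ≤ R := hq1.trans hqR
  have hR0 : 0 < R := zero_lt_one.trans_le hR1
  obtain ⟨X, hX, hSX⟩ := hS ((1 - ε / 2) * S) (by nlinarith)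
  obtain ⟨U, x, hU, hx1, hxR, hle⟩ := exists_dualFunctional_le hp hB hc hL hdim hR1
    (fun j => by linarith [hqj j]) hX
  have hx0 : ∀ i, 0 < x i := fun i => zero_lt_one.trans_le (hx1 i)
  have hU' : Uᵀ * U = 1 := mul_eq_one_comm.1 hU
  have hd : Matrix.diagonal x
      = Matrix.diagonal (fun i => √(x i)) * Matrix.diagonal fun i => √(x i) := by
    rw [Matrix.diagonal_mul_diagonal]
    congr 1
    ext i
    exact (Real.mul_self_sqrt (hx0 i).le).symm
  set K := U * Matrix.diagonal (fun i => √(x i)) with hK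
  have hKX : K * Kᵀ = U * Matrix.diagonal x * Uᵀ := by
    rw [hd, hK]
    simp only [Matrix.transpose_mul, Matrix.diagonal_transpose, Matrix.mul_assoc]
  have hKK : Kᵀ * K = Matrix.diagonal x := by
    rw [hd, hK, Matrix.transpose_mul, Matrix.diagonal_transpose, Matrix.mul_assoc,
      ← Matrix.mul_assoc Uᵀ, hU', Matrix.one_mul]
  refine ⟨K, hKX ▸ posDef_conj_diagonal hU hx0, fun y => ?_, ?_, fun j => ?_⟩
  · rw [← sq_le_sq₀ (norm_nonneg _) (norm_nonneg _), norm_sq_toEuclideanLin, hKK,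
      EuclideanSpace.real_norm_sq_eq]
    simp only [dotProduct, Matrix.mulVec_diagonal]
    exact Finset.sum_le_sum fun i _ => by nlinarith [sq_nonneg (y i), hx1 i]
  · rw [hKX]
    set D := dualFunctional L p (U * Matrix.diagonal x * Uᵀ)
    have h1 : gapLoss nj n p B c R ^ n ≤ Real.exp (ε / 2) := by
      refine (gapLoss_pow_le_exp hp nj n hR0).trans (Real.exp_le_exp.2 ?_)
      rw [← hA, hR, div_div_eq_mul_div, div_le_div_iff₀ (by linarith) two_pos]
      nlinarith
    have h2 : 0 < gapLoss nj n p B c R ^ n :=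
      pow_pos (zero_lt_one.trans_le (one_le_gapLoss hp nj n hR0)) n
    have h3 : 0 < D := by
      have h4 : 0 < (1 - ε / 2) * S := mul_pos (by linarith) hS0
      exact (mul_pos_iff_of_pos_left h2).1 (h4.trans (hSX.trans_le hle))
    have h5 : (1 - ε / 2) * S ≤ Real.exp (ε / 2) * D :=
      (hSX.le.trans hle).trans (mul_le_mul_of_nonneg_right h1 h3.le)
    have h6 : 1 - ε / 2 ≤ Real.exp (-(ε / 2)) := by
      have := Real.add_one_le_exp (-(ε / 2)); linarith
    calc (1 - ε) * S ≤ (1 - ε / 2) * ((1 - ε / 2) * S) := by nlinarith [sq_nonneg ε]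
      _ ≤ Real.exp (-(ε / 2)) * (Real.exp (ε / 2) * D) :=
          mul_le_mul h6 h5 (mul_nonneg (by linarith) hS0.le) (Real.exp_pos _).le
      _ = D := by rw [← mul_assoc, ← Real.exp_add, neg_add_cancel, Real.exp_zero, one_mul]
  · set Y := L j * (K * Kᵀ) * (L j)ᵀ with hY
    have hYW : Y = (L j * U) * Matrix.diagonal x * (L j * U)ᵀ := by
      rw [hY, hKX, Matrix.transpose_mul]
      simp only [Matrix.mul_assoc]
    set β := (1 + n * B ^ 2) * R ^ n with hβ
    have hβ1 : 1 ≤ β := one_le_mul_of_one_le_of_one_le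
      (by have : 0 ≤ n * B ^ 2 := by positivity
          linarith) (one_le_pow₀ hR1)
    have hβb : β ^ (s + 1) = b ^ (s + 1) / ε ^ (n * (s + 1)) := by
      rw [hβ, hR, hb, div_pow, ← mul_div_assoc, div_pow, pow_mul]
    have hYe : ∀ i l, |Y i l| ≤ β := fun i l => by
      rw [hYW]
      refine (abs_mul_diagonal_mul_transpose_le (by linarith) ((hL U hU).1 j)
        (fun i => (hx0 i).le) hxR i l).trans ?_
      have : 0 ≤ R ^ n := by positivity
      rw [hβ]
      nlinarith
    have hpow : (nj j).factorial * β ^ nj j ≤ F * β ^ (s + 1) := by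
      refine mul_le_mul ?_ (pow_le_pow_right₀ hβ1 ((hsj j).trans (Nat.le_succ s))) (by positivity)
        (by positivity)
      rw [hF]; exact_mod_cast Nat.factorial_le (hsj j)
    have hbig : ∀ t, t ≤ F * β ^ (s + 1) →
        t ≤ (1 + F * (c ^ 2)⁻¹) * (F * b ^ (s + 1)) / ε ^ (n * (s + 1)) := by
      intro t ht
      rw [mul_div_assoc, mul_div_assoc, ← hβb]
      have : 0 ≤ F * (c ^ 2)⁻¹ * (F * β ^ (s + 1)) := by positivity
      linarith
    have hdet := hL.le_det hc hU hx1 j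
    rw [← hKX, ← hY] at hdet
    have hfac : 0 < ((nj j).factorial : ℝ) := by exact_mod_cast Nat.factorial_pos _
    have hdet0 : 0 < Y.det := lt_of_lt_of_le (by positivity) hdet
    refine ⟨hbig _ (((le_abs_self _).trans (abs_det_le Y hYe)).trans hpow), fun i l => hbig _
      ((hYe i l).trans ?_), fun i l => ?_⟩
    · calc β ≤ β ^ (s + 1) := le_self_pow₀ hβ1 (Nat.succ_ne_zero s)
        _ ≤ F * β ^ (s + 1) := le_mul_of_one_le_left (by positivity) hF1
    · rw [Matrix.inv_def, Ring.inverse_eq_inv', Matrix.smul_apply, smul_eq_mul, abs_mul,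
        abs_of_pos (inv_pos.2 hdet0), mul_div_assoc, mul_div_assoc, ← hβb]
      have h1 : Y.det⁻¹ ≤ F * (c ^ 2)⁻¹ := by
        rw [inv_le_comm₀ hdet0 (by positivity), mul_inv, inv_inv]
        refine le_trans ?_ hdet
        gcongr
        rw [hF]; exact_mod_cast Nat.factorial_le (hsj j)
      have h2 := (abs_adjugate_le Y hβ1 hYe i l).trans hpow
      calc Y.det⁻¹ * |Y.adjugate i l| ≤ (F * (c ^ 2)⁻¹) * (F * β ^ (s + 1)) :=
            mul_le_mul h1 h2 (abs_nonneg _) (by positivity)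
        _ ≤ _ := by
            have : 0 ≤ F * β ^ (s + 1) := by positivity
            linarith

end NearMaximizer

section DualInput

variable {m n : ℕ} {nj : Fin m → ℕ}

theorem dualFunctional_smul {L : ∀ j, Matrix (Fin (nj j)) (Fin n) ℝ} {p : Fin m → ℝ}
    (hL : ∀ j, Function.Surjective (Matrix.toEuclideanLin (L j)))
    (hdim : (n : ℝ) = ∑ j, p j * nj j) {t : ℝ} (ht : 0 < t) {X : Matrix (Fin n) (Fin n) ℝ}
    (hX : X.PosDef) : dualFunctional L p (t • X) = dualFunctional L p X := by
  have h1 : ∏ j, ((t ^ nj j) ^ p j : ℝ) = t ^ n := by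
    rw [← Real.rpow_natCast t n, hdim, Real.rpow_sum_of_pos ht]
    refine Finset.prod_congr rfl fun j _ => ?_
    rw [← Real.rpow_natCast, ← Real.rpow_mul ht.le, mul_comm]
  have h2 : ∀ j, (L j * (t • X) * (L j)ᵀ).det ^ p j
      = (t ^ nj j) ^ p j * (L j * X * (L j)ᵀ).det ^ p j := fun j => by
    rw [Matrix.mul_smul, Matrix.smul_mul, Matrix.det_smul, Fintype.card_fin,
      Real.mul_rpow (by positivity) (posDef_mul_mul_transpose (hL j) hX).det_pos.le]
  simp_rw [dualFunctional, h2]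
  rw [Finset.prod_mul_distrib, h1, Matrix.det_smul, Fintype.card_fin,
    mul_div_mul_left _ _ (pow_pos ht n).ne']

/-- The gaussian input `A_j = (L_j X L_jᵀ)⁻¹` attached to `X`. -/
noncomputable def dualInput (L : ∀ j, Matrix (Fin (nj j)) (Fin n) ℝ)
    (X : Matrix (Fin n) (Fin n) ℝ) (j : Fin m) : Matrix (Fin (nj j)) (Fin (nj j)) ℝ :=
  (L j * X * (L j)ᵀ)⁻¹

theorem posDef_dualInput {L : ∀ j, Matrix (Fin (nj j)) (Fin n) ℝ}
    (hL : ∀ j, Function.Surjective (Matrix.toEuclideanLin (L j))) {X : Matrix (Fin n) (Fin n) ℝ}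
    (hX : X.PosDef) (j : Fin m) : (dualInput L X j).PosDef :=
  (posDef_mul_mul_transpose (hL j) hX).inv

theorem trace_gaussForm_dualInput_mul {L : ∀ j, Matrix (Fin (nj j)) (Fin n) ℝ} {p : Fin m → ℝ}
    (hL : ∀ j, Function.Surjective (Matrix.toEuclideanLin (L j)))
    (hdim : (n : ℝ) = ∑ j, p j * nj j) {X : Matrix (Fin n) (Fin n) ℝ} (hX : X.PosDef) :
    (gaussForm L p (dualInput L X) * X).trace = n := by
  rw [trace_gaussForm_mul, hdim]
  refine Finset.sum_congr rfl fun j _ => ?_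
  rw [dualInput, Matrix.nonsing_inv_mul _
    (posDef_mul_mul_transpose (hL j) hX).det_pos.ne'.isUnit, Matrix.trace_one, Fintype.card_fin]

theorem dualFunctional_eq_mul_prod {L : ∀ j, Matrix (Fin (nj j)) (Fin n) ℝ} {p : Fin m → ℝ}
    (hL : ∀ j, Function.Surjective (Matrix.toEuclideanLin (L j)))
    {X : Matrix (Fin n) (Fin n) ℝ} (hX : X.PosDef) :
    dualFunctional L p X = X.det * ∏ j, (dualInput L X j).det ^ p j := by
  rw [dualFunctional, div_eq_mul_inv, ← Finset.prod_inv_distrib]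
  congr 1
  refine Finset.prod_congr rfl fun j _ => ?_
  rw [dualInput, Matrix.det_nonsing_inv, Ring.inverse_eq_inv',
    Real.inv_rpow (posDef_mul_mul_transpose (hL j) hX).det_pos.le]

theorem sum_mul_norm_sq_le {L : ∀ j, Matrix (Fin (nj j)) (Fin n) ℝ} {p : Fin m → ℝ}
    (hp : ∀ j, 0 ≤ p j) (hL : ∀ j, Function.Surjective (Matrix.toEuclideanLin (L j)))
    (hdim : (n : ℝ) = ∑ j, p j * nj j) {S : ℝ} (hS0 : 0 < S)
    (hS : ∀ X : Matrix (Fin n) (Fin n) ℝ, X.PosDef → dualFunctional L p X ≤ S)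
    {K : Matrix (Fin n) (Fin n) ℝ} (hK : (K * Kᵀ).PosDef)
    {P : ∀ j, Matrix (Fin (nj j)) (Fin (nj j)) ℝ}
    (hP : ∀ j, L j * (K * Kᵀ) * (L j)ᵀ = P j * (P j)ᵀ) {ε : ℝ} (hε : 0 ≤ ε) (hε1 : ε < 1)
    (hKS : (1 - ε) * S ≤ dualFunctional L p (K * Kᵀ)) (z : EuclideanSpace ℝ (Fin n)) :
    ∑ j, p j * ‖Matrix.toEuclideanLin ((P j)⁻¹ * (L j * K)) z‖ ^ 2
      ≤ (1 + √(2 * (1 + n + n ^ 2) * ε)) * ‖z‖ ^ 2 := by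
  set A := dualInput L (K * Kᵀ) with hA
  set N := Kᵀ * gaussForm L p A * K with hN
  have hNtr : N.trace = n := by
    rw [hN, Matrix.mul_assoc, Matrix.trace_mul_comm, Matrix.mul_assoc]
    exact trace_gaussForm_dualInput_mul hL hdim hK
  have hNdet : 1 - ε ≤ N.det := by
    have h1 := prod_det_rpow_le hp hL hdim hS (posDef_dualInput hL hK)
    have h2 : N.det = (K * Kᵀ).det * (gaussForm L p A).det := by
      rw [hN]; simp only [Matrix.det_mul]; ring
    rw [dualFunctional_eq_mul_prod hL hK] at hKS
    have h3 := hKS.trans (mul_le_mul_of_nonneg_left h1 hK.det_pos.le)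
    rw [h2]
    refine le_of_mul_le_mul_right (h3.trans_eq ?_) hS0
    ring
  have hNpos : N.PosDef := by
    have h := (posSemidef_gaussForm hp L (posDef_dualInput hL hK)).conjTranspose_mul_mul_same K
    rw [Matrix.conjTranspose_eq_transpose_of_trivial] at h
    exact h.posDef_iff_det_ne_zero.2 (by linarith : 0 < N.det).ne'
  have hz := dotProduct_mulVec_le_of_det hNpos hNtr hε hNdet z.ofLp
  have hzz : z.ofLp ⬝ᵥ z.ofLp = ‖z‖ ^ 2 := by
    rw [EuclideanSpace.real_norm_sq_eq]; simp [dotProduct, sq]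
  rw [hzz] at hz
  refine le_trans (le_of_eq ?_) hz
  have hW : ∀ j, ((P j)⁻¹ * (L j * K))ᵀ * ((P j)⁻¹ * (L j * K)) = Kᵀ * ((L j)ᴴ * A j * L j) * K := by
    intro j
    rw [hA, dualInput, hP, Matrix.mul_inv_rev, ← Matrix.transpose_nonsing_inv,
      Matrix.conjTranspose_eq_transpose_of_trivial]
    simp only [Matrix.transpose_mul, Matrix.mul_assoc]
  have hNs : N = ∑ j, p j • (((P j)⁻¹ * (L j * K))ᵀ * ((P j)⁻¹ * (L j * K))) := by
    rw [hN, gaussForm, Finset.mul_sum, Finset.sum_mul]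
    refine Finset.sum_congr rfl fun j _ => ?_
    rw [hW, Matrix.mul_smul, Matrix.smul_mul]
  rw [hNs, Matrix.sum_mulVec, dotProduct_sum]
  refine Finset.sum_congr rfl fun j _ => ?_
  rw [norm_sq_toEuclideanLin, Matrix.smul_mulVec, dotProduct_smul, smul_eq_mul]

end DualInput

section Localized

variable {m n : ℕ} {nj : Fin m → ℕ}

theorem gaussNorm_euclideanSpace (n : ℕ) :
    gaussNorm (EuclideanSpace ℝ (Fin n)) = (2 * Real.pi) ^ (-(n / 2 : ℝ)) := by
  rw [gaussNorm, finrank_euclideanSpace_fin]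

theorem gaussNorm_eq_prod {p : Fin m → ℝ} (hdim : (n : ℝ) = ∑ j, p j * nj j) :
    gaussNorm (EuclideanSpace ℝ (Fin n))
      = ∏ j, gaussNorm (EuclideanSpace ℝ (Fin (nj j))) ^ p j := by
  simp_rw [gaussNorm_euclideanSpace]
  rw [hdim, Finset.sum_div, ← Finset.sum_neg_distrib, Real.rpow_sum_of_pos (by positivity)]
  refine Finset.prod_congr rfl fun j _ => ?_
  rw [← Real.rpow_mul (by positivity)]
  congr 1
  ring

theorem setLIntegral_closedBall_le_of_factor {L : ∀ j, Matrix (Fin (nj j)) (Fin n) ℝ}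
    {p : Fin m → ℝ} (hp : ∀ j, 0 ≤ p j) (hdim : (n : ℝ) = ∑ j, p j * nj j)
    {K : Matrix (Fin n) (Fin n) ℝ} (hK : K.det ≠ 0)
    {P : ∀ j, Matrix (Fin (nj j)) (Fin (nj j)) ℝ} (hP0 : ∀ j, (P j).det ≠ 0)
    (hP : ∀ j, L j * (K * Kᵀ) * (L j)ᵀ = P j * (P j)ᵀ) {l : ℝ} (hl : 1 ≤ l)
    (hWp : ∀ z, ∑ j, p j * ‖Matrix.toEuclideanLin ((P j)⁻¹ * (L j * K)) z‖ ^ 2 ≤ l * ‖z‖ ^ 2)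
    {s : ℝ} (hs : 0 < s) (hKs : ∀ z, s * ‖z‖ ≤ ‖Matrix.toEuclideanLin K z‖)
    {k : ℝ} (hk : 1 ≤ k) {f : ∀ j, EuclideanSpace ℝ (Fin (nj j)) → ℝ≥0∞}
    (hf : ∀ j, Measurable (f j)) (hfk : ∀ j y, f j y ≤ ENNReal.ofReal k)
    (hf1 : ∀ j, ∫⁻ y, f j y ≤ 1) (r : ℝ) :
    ∫⁻ x in Metric.closedBall 0 r, ∏ j, f j (Matrix.toEuclideanLin (L j) x) ^ p j
      ≤ ENNReal.ofReal (Real.exp ((r / s) ^ 2 / 2) * (|K.det| / ∏ j, |(P j).det| ^ p j) *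
          (∏ j, (k * |(P j).det| / gaussNorm (EuclideanSpace ℝ (Fin (nj j)))) ^ p j)
            ^ (1 - 1 / l)) := by
  have hl0 : 0 < l := by linarith
  have hk0 : 0 < k := by linarith
  have hPa : ∀ j, 0 < |(P j).det| := fun j => abs_pos.2 (hP0 j)
  have hm : ∀ {a b : ℕ} (M : Matrix (Fin a) (Fin b) ℝ), Measurable (Matrix.toEuclideanLin M) :=
    fun M => (LinearMap.continuous_of_finiteDimensional _).measurable
  set G : EuclideanSpace ℝ (Fin n) → ℝ≥0∞ :=
    fun x => ∏ j, f j (Matrix.toEuclideanLin (L j) x) ^ p j with hG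
  have hGm : Measurable G := Finset.measurable_prod _ fun j _ =>
    ((hf j).comp (hm _)).pow_const _
  set g : ∀ j, EuclideanSpace ℝ (Fin (nj j)) → ℝ≥0∞ :=
    fun j y => f j (Matrix.toEuclideanLin (P j) y) with hg
  have hGK : ∀ z, G (Matrix.toEuclideanLin K z)
      = ∏ j, g j (LinearMap.toContinuousLinearMap
        (Matrix.toEuclideanLin ((P j)⁻¹ * (L j * K))) z) ^ p j := by
    intro z
    refine Finset.prod_congr rfl fun j _ => ?_
    rw [hg, LinearMap.coe_toContinuousLinearMap']
    simp only
    rw [← toEuclideanLin_mul_apply, ← toEuclideanLin_mul_apply, ← Matrix.mul_assoc,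
      Matrix.mul_nonsing_inv _ (hP0 j).isUnit, Matrix.one_mul]
  have h1 : ∫⁻ x in Metric.closedBall 0 r, G x ≤ ENNReal.ofReal |K.det| *
      ∫⁻ z in Metric.closedBall 0 (r / s), G (Matrix.toEuclideanLin K z) := by
    rw [← lintegral_indicator Metric.isClosed_closedBall.measurableSet,
      ← lintegral_indicator Metric.isClosed_closedBall.measurableSet,
      lintegral_eq_abs_det_mul hK (hGm.indicator Metric.isClosed_closedBall.measurableSet)]
    gcongr with z
    by_cases hz : Matrix.toEuclideanLin K z ∈ Metric.closedBall 0 r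
    · have hz' : z ∈ Metric.closedBall (0 : EuclideanSpace ℝ (Fin n)) (r / s) := by
        rw [mem_closedBall_zero_iff] at hz ⊢
        rw [le_div_iff₀ hs, mul_comm]
        exact (hKs z).trans hz
      rw [Set.indicator_of_mem hz, Set.indicator_of_mem hz']
    · rw [Set.indicator_of_notMem hz]
      exact zero_le
  have h2 := setLIntegral_closedBall_prod_le
    (fun j => LinearMap.toContinuousLinearMap (Matrix.toEuclideanLin ((P j)⁻¹ * (L j * K))))
    (fun j y => toEuclideanLin_adjoint_apply (inv_mul_mul_mul_transpose_eq_one (hP0 j) (hP j)) y)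
    hp hl hWp hk (g := g) (fun j => (hf j).comp (hm _)) (fun j y => hfk j _) (r / s)
  simp_rw [hGK] at h1
  refine (h1.trans (mul_le_mul_right h2 _)).trans ?_
  set γ : Fin m → ℝ := fun j => gaussNorm (EuclideanSpace ℝ (Fin (nj j))) with hγ
  have hγ0 : ∀ j, 0 < γ j := fun j => gaussNorm_pos _
  have h3 : ∀ j, (ENNReal.ofReal (k ^ (l - 1) * γ j) * ∫⁻ y, g j y) ^ (p j / l)
      ≤ ENNReal.ofReal ((k ^ (l - 1) * γ j * |(P j).det|⁻¹) ^ (p j / l)) := by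
    intro j
    rw [← ENNReal.ofReal_rpow_of_nonneg (by have := hγ0 j; positivity)
      (div_nonneg (hp j) hl0.le)]
    refine ENNReal.rpow_le_rpow ?_ (div_nonneg (hp j) hl0.le)
    rw [hg, lintegral_comp_toEuclideanLin (hP0 j) (hf j),
      ENNReal.ofReal_mul (p := k ^ (l - 1) * γ j) (by have := hγ0 j; positivity)]
    exact mul_le_mul_right (mul_le_of_le_one_right' (hf1 j)) _
  refine (mul_le_mul_right (mul_le_mul_right (Finset.prod_le_prod' fun j _ => h3 j) _) _).trans ?_
  rw [← ENNReal.ofReal_prod_of_nonneg (fun j _ => by have := hγ0 j; positivity),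
    ← ENNReal.ofReal_mul (by have := gaussNorm_pos (EuclideanSpace ℝ (Fin n)); positivity),
    ← ENNReal.ofReal_mul (abs_nonneg _)]
  refine ENNReal.ofReal_le_ofReal (le_of_eq ?_)
  rw [gaussNorm_eq_prod hdim, ← Real.finsetProd_rpow _ _ (fun j _ => by
    have := hγ0 j; have := hPa j; positivity)]
  have h4 : ∀ j, (k ^ (l - 1) * γ j * |(P j).det|⁻¹) ^ (p j / l)
      = γ j ^ p j * (|(P j).det| ^ p j)⁻¹ * ((k * |(P j).det| / γ j) ^ p j) ^ (1 - 1 / l) := by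
    intro j
    have a := hγ0 j
    have b := hPa j
    rw [Real.mul_rpow (by positivity) (by positivity), Real.mul_rpow (by positivity) (by positivity),
      ← Real.rpow_mul hk0.le, ← Real.rpow_mul (by positivity),
      Real.div_rpow (by positivity) (by positivity), Real.mul_rpow (by positivity) (by positivity),
      ← Real.rpow_neg b.le, Real.inv_rpow b.le, ← Real.rpow_neg b.le]
    rw [show (l - 1) * (p j / l) = p j * (1 - 1 / l) by field_simp,
      show p j / l = p j + -(p j * (1 - 1 / l)) by field_simp; ring, Real.rpow_add a,
      Real.rpow_neg a.le, neg_add, Real.rpow_add b, neg_neg]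
    ring
  simp_rw [h4, Finset.prod_mul_distrib, Finset.prod_inv_distrib]
  have h5 : ∏ j, gaussNorm (EuclideanSpace ℝ (Fin (nj j))) ^ p j ≠ 0 :=
    (Finset.prod_pos fun j _ => Real.rpow_pos_of_pos (hγ0 j) _).ne'
  simp only [hγ]
  field_simp

end Localized

section Limit
open Filter Topology

variable {m n : ℕ} {nj : Fin m → ℕ}

theorem tendsto_prod_div_pow_rpow {p H : Fin m → ℝ} (hH : ∀ j, 0 < H j) (N : ℕ) {c : ℝ}
    (hc : 0 ≤ c) :
    Tendsto (fun ε : ℝ => (∏ j, (H j / ε ^ N) ^ p j) ^ (1 - 1 / (1 + √(c * ε)))) (𝓝[>] 0)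
      (𝓝 1) := by
  have hid : Tendsto (fun ε : ℝ => ε) (𝓝[>] 0) (𝓝 0) := tendsto_nhdsWithin_of_tendsto_nhds tendsto_id
  have hl : Tendsto (fun ε : ℝ => 1 + √(c * ε)) (𝓝[>] 0) (𝓝 1) := by
    have h : Tendsto (fun ε : ℝ => 1 + √(c * ε)) (𝓝[>] 0) (𝓝 (1 + √(c * 0))) :=
      ((hid.const_mul c).sqrt).const_add 1
    simpa using h
  have hθ : Tendsto (fun ε : ℝ => 1 - 1 / (1 + √(c * ε))) (𝓝[>] 0) (𝓝 0) := by
    have h := (tendsto_const_nhds (x := (1 : ℝ))).sub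
      ((tendsto_const_nhds (x := (1 : ℝ))).div hl one_ne_zero)
    simpa using h
  have hlog : Tendsto (fun ε : ℝ => Real.log ε * (1 - 1 / (1 + √(c * ε)))) (𝓝[>] 0) (𝓝 0) := by
    have h1 := (tendsto_log_mul_rpow_nhdsGT_zero (r := 1 / 2) (by norm_num)).mul
      ((tendsto_const_nhds (x := √c)).div hl one_ne_zero)
    rw [zero_mul] at h1
    refine h1.congr' ?_
    filter_upwards [self_mem_nhdsWithin] with ε hε
    have : 0 ≤ √c * √ε := by positivity
    simp only [Pi.div_apply]
    rw [Real.sqrt_mul hc, ← Real.sqrt_eq_rpow]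
    field_simp
    ring
  set C := ∏ j, H j ^ p j with hC
  have hC0 : 0 < C := Finset.prod_pos fun j _ => Real.rpow_pos_of_pos (hH j) _
  have h2 := ((tendsto_const_nhds (x := C)).rpow hθ (Or.inl hC0.ne')).mul
    ((hlog.const_mul (-(N * ∑ j, p j))).rexp)
  rw [mul_zero, Real.exp_zero, Real.rpow_zero, mul_one] at h2
  refine h2.congr' ?_
  filter_upwards [self_mem_nhdsWithin] with ε hε
  have hε : 0 < ε := hε
  have h3 : ∏ j, (H j / ε ^ N) ^ p j = C * ε ^ (-(N * ∑ j, p j)) := by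
    rw [Finset.mul_sum, ← Finset.sum_neg_distrib, Real.rpow_sum_of_pos hε, hC,
      ← Finset.prod_mul_distrib]
    refine Finset.prod_congr rfl fun j _ => ?_
    rw [Real.div_rpow (hH j).le (by positivity), div_eq_mul_inv, ← Real.rpow_natCast,
      ← Real.rpow_mul hε.le, ← Real.rpow_neg hε.le]
  rw [h3, Real.mul_rpow hC0.le (by positivity), ← Real.rpow_mul hε.le, Real.rpow_def_of_pos hε]
  congr 2
  ring

theorem setLIntegral_closedBall_le_sqrt {L : ∀ j, Matrix (Fin (nj j)) (Fin n) ℝ}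
    {p : Fin m → ℝ} (hp : ∀ j, 0 ≤ p j)
    (hL : ∀ j, Function.Surjective (Matrix.toEuclideanLin (L j)))
    (hdim : (n : ℝ) = ∑ j, p j * nj j) {B c : ℝ} (hB : 1 ≤ B) (hc : 0 < c)
    (hg : UniformlyGood L p B c) {S : ℝ} (hS0 : 0 < S)
    (hS : ∀ X : Matrix (Fin n) (Fin n) ℝ, X.PosDef → dualFunctional L p X ≤ S)
    (hS' : ∀ S' < S, ∃ X : Matrix (Fin n) (Fin n) ℝ, X.PosDef ∧ S' < dualFunctional L p X)
    {k : ℝ} (hk : 1 ≤ k) {f : ∀ j, EuclideanSpace ℝ (Fin (nj j)) → ℝ≥0∞}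
    (hf : ∀ j, Measurable (f j)) (hfk : ∀ j y, f j y ≤ ENNReal.ofReal k)
    (hf1 : ∀ j, ∫⁻ y, f j y ≤ 1) (r : ℝ) :
    ∫⁻ x in Metric.closedBall 0 r, ∏ j, f j (Matrix.toEuclideanLin (L j) x) ^ p j
      ≤ ENNReal.ofReal √S := by
  obtain ⟨Q, N, hQ, hnear⟩ := exists_near_maximizer (nj := nj) hp hB hc hdim
  have hk0 : 0 < k := by linarith
  set γ : Fin m → ℝ := fun j => gaussNorm (EuclideanSpace ℝ (Fin (nj j))) with hγ
  have hγ0 : ∀ j, 0 < γ j := fun j => gaussNorm_pos _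
  set d := ∑ j, nj j with hd
  have hdj : ∀ j, nj j ≤ d := fun j => Finset.single_le_sum (f := nj) (fun _ _ => Nat.zero_le _)
    (Finset.mem_univ j)
  set a : ℝ := 2 * (1 + n + n ^ 2) with ha
  have ha0 : 0 ≤ a := by positivity
  have hlim : Tendsto (fun ε : ℝ => ENNReal.ofReal (Real.exp (r ^ 2 * ε / 2) * √S *
      (∏ j, ((k * Q / γ j) / ε ^ (N + d)) ^ p j) ^ (1 - 1 / (1 + √(a * ε))))) (𝓝[>] 0)
      (𝓝 (ENNReal.ofReal √S)) := by
    refine ENNReal.tendsto_ofReal ?_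
    have h1 : Tendsto (fun ε : ℝ => Real.exp (r ^ 2 * ε / 2)) (𝓝[>] 0) (𝓝 1) := by
      have : Tendsto (fun ε : ℝ => Real.exp (r ^ 2 * ε / 2)) (𝓝 0) (𝓝 (Real.exp (r ^ 2 * 0 / 2))) :=
        (by fun_prop : Continuous fun ε : ℝ => Real.exp (r ^ 2 * ε / 2)).tendsto 0
      simp only [mul_zero, zero_div, Real.exp_zero] at this
      exact tendsto_nhdsWithin_of_tendsto_nhds this
    have h2 := (h1.mul_const √S).mul (tendsto_prod_div_pow_rpow (p := p)
      (H := fun j => k * Q / γ j) (fun j => by have := hγ0 j; positivity) (N + d) ha0)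
    simpa using h2
  refine ge_of_tendsto hlim ?_
  filter_upwards [Ioo_mem_nhdsGT (zero_lt_one' ℝ)] with ε ⟨hε0, hε1⟩
  obtain ⟨K, hK, hKn, hKS, hKd⟩ := hnear L hg S hS0 hS' ε hε0 hε1.le
  set s := √(1 / ε) with hs
  have hs0 : 0 < s := Real.sqrt_pos.2 (by positivity)
  have hs2 : s * s = 1 / ε := Real.mul_self_sqrt (by positivity)
  have hK' : (s • K) * (s • K)ᵀ = (1 / ε) • (K * Kᵀ) := by
    rw [Matrix.transpose_smul, Matrix.smul_mul, Matrix.mul_smul, smul_smul, hs2]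
  have hKpos : ((s • K) * (s • K)ᵀ).PosDef := hK' ▸ hK.smul (by positivity)
  choose P hP using fun j => exists_eq_mul_transpose (posDef_mul_mul_transpose (hL j) hKpos)
  have hPd : ∀ j, (P j).det ^ 2 = (L j * ((s • K) * (s • K)ᵀ) * (L j)ᵀ).det := fun j => by
    rw [hP, Matrix.det_mul, Matrix.det_transpose, sq]
  have hP0 : ∀ j, (P j).det ≠ 0 := fun j h => by
    have := (posDef_mul_mul_transpose (hL j) hKpos).det_pos
    rw [← hPd, h] at this
    simp at this
  have hPb : ∀ j, |(P j).det| ≤ Q / ε ^ (N + d) := by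
    intro j
    have hε' : 1 ≤ 1 / ε := by rw [le_div_iff₀ hε0]; linarith
    have h1 : |(P j).det| ^ 2 ≤ Q / ε ^ (N + d) := by
      rw [sq_abs, hPd, hK', Matrix.mul_smul, Matrix.smul_mul, Matrix.det_smul, Fintype.card_fin]
      calc (1 / ε) ^ nj j * (L j * (K * Kᵀ) * (L j)ᵀ).det ≤ (1 / ε) ^ d * (Q / ε ^ N) :=
            mul_le_mul (pow_le_pow_right₀ hε' (hdj j)) (hKd j).1
              (posDef_mul_mul_transpose (hL j) hK).det_pos.le (by positivity)
        _ = Q / ε ^ (N + d) := by rw [one_div, inv_pow, pow_add]; field_simp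
    have h2 : 1 ≤ Q / ε ^ (N + d) := by
      rw [le_div_iff₀ (by positivity), one_mul]
      exact (pow_le_one₀ hε0.le hε1.le).trans hQ
    nlinarith [abs_nonneg (P j).det]
  have hdual : dualFunctional L p ((s • K) * (s • K)ᵀ) = dualFunctional L p (K * Kᵀ) := by
    rw [hK', dualFunctional_smul hL hdim (by positivity) hK]
  have hl : 1 ≤ 1 + √(a * ε) := le_add_of_nonneg_right (Real.sqrt_nonneg _)
  refine (setLIntegral_closedBall_le_of_factor hp hdim (det_ne_zero_of_posDef_mul_transpose hKpos)
    hP0 hP hl (sum_mul_norm_sq_le hp hL hdim hS0 hS hKpos hP hε0.le hε1 (hdual ▸ hKS)) hs0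
    (fun z => ?_) hk hf hfk hf1 r).trans (ENNReal.ofReal_le_ofReal ?_)
  · rw [map_smul, LinearMap.smul_apply, norm_smul, Real.norm_of_nonneg hs0.le]
    exact mul_le_mul_of_nonneg_left (hKn z) hs0.le
  have hrs : (r / s) ^ 2 / 2 = r ^ 2 * ε / 2 := by
    rw [div_pow, sq s, hs2, one_div, div_inv_eq_mul]
  rw [hrs]
  have hθ : 0 ≤ 1 - 1 / (1 + √(a * ε)) := by
    rw [sub_nonneg, div_le_one (by linarith)]
    exact hl
  have hbase : ∀ j, 0 ≤ k * |(P j).det| / γ j := fun j => by have := hγ0 j; positivity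
  have hprod0 : 0 ≤ ∏ j, (k * |(P j).det| / γ j) ^ p j :=
    Finset.prod_nonneg fun j _ => Real.rpow_nonneg (hbase j) _
  refine mul_le_mul (mul_le_mul_of_nonneg_left ?_ (Real.exp_pos _).le) ?_
    (Real.rpow_nonneg hprod0 _) (by positivity)
  · refine Real.le_sqrt_of_sq_le ?_
    rw [← dualFunctional_eq_sq hP]
    exact hS _ hKpos
  · refine Real.rpow_le_rpow hprod0 (Finset.prod_le_prod
      (fun j _ => Real.rpow_nonneg (hbase j) _) fun j _ => ?_) hθ
    refine Real.rpow_le_rpow (hbase j) ?_ (hp j)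
    calc k * |(P j).det| / γ j ≤ k * (Q / ε ^ (N + d)) / γ j :=
          div_le_div_of_nonneg_right (mul_le_mul_of_nonneg_left (hPb j) hk0.le) (hγ0 j).le
      _ = k * Q / γ j / ε ^ (N + d) := by ring

end Limit

section Reduction
open Filter Topology

variable {m n : ℕ} {nj : Fin m → ℕ}

theorem prod_iSup_le_of_monotone {ι : Type*} (s : Finset ι) {a : ι → ℕ → ℝ≥0∞}
    (ha : ∀ i, Monotone (a i)) : ∏ i ∈ s, ⨆ k, a i k ≤ ⨆ k, ∏ i ∈ s, a i k := by
  classical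
  induction s using Finset.induction_on with
  | empty => simp
  | insert i s hi ih =>
    rw [Finset.prod_insert hi]
    refine (mul_le_mul_right ih _).trans ?_
    rw [ENNReal.iSup_mul]
    refine iSup_le fun k => ?_
    rw [ENNReal.mul_iSup]
    refine iSup_le fun l => le_iSup_of_le (max k l) ?_
    rw [Finset.prod_insert hi]
    exact mul_le_mul' (ha i (le_max_left _ _))
      (Finset.prod_le_prod' fun j _ => ha j (le_max_right _ _))

theorem iSup_rpow_of_monotone {a : ℕ → ℝ≥0∞} {p : ℝ} (hp : 0 ≤ p) :
    (⨆ k, a k) ^ p = ⨆ k, a k ^ p :=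
  Monotone.map_ciSup_of_continuousAt (f := fun x : ℝ≥0∞ => x ^ p)
    ENNReal.continuous_rpow_const.continuousAt (fun _ _ h => ENNReal.rpow_le_rpow h hp)
    (OrderTop.bddAbove _)

theorem lintegral_eq_iSup_closedBall {E : Type*} [NormedAddCommGroup E] [MeasurableSpace E]
    (μ : Measure E) (G : E → ℝ≥0∞) :
    ∫⁻ x, G x ∂μ = ⨆ r : ℕ, ∫⁻ x in Metric.closedBall 0 r, G x ∂μ := by
  rw [← setLIntegral_iUnion_of_directed G (Monotone.directed_le fun a b h =>
    Metric.closedBall_subset_closedBall (by exact_mod_cast h)), Metric.iUnion_closedBall_nat,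
    Measure.restrict_univ]

section Measurability

variable {p : Fin m → ℝ} (L : ∀ j, Matrix (Fin (nj j)) (Fin n) ℝ)

theorem measurable_prod_comp_toEuclideanLin {f : ∀ j, EuclideanSpace ℝ (Fin (nj j)) → ℝ≥0∞}
    (hf : ∀ j, Measurable (f j)) :
    Measurable fun x => ∏ j, f j (Matrix.toEuclideanLin (L j) x) ^ p j :=
  Finset.measurable_prod _ fun j _ =>
    ((hf j).comp (LinearMap.continuous_of_finiteDimensional _).measurable).pow_const _

end Measurability

variable {L : ∀ j, Matrix (Fin (nj j)) (Fin n) ℝ} {p : Fin m → ℝ} {C : ℝ≥0∞}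

theorem setLIntegral_closedBall_le_mul_prod (hp : ∀ j, 0 ≤ p j) (hC : C ≠ ⊤)
    (h : ∀ k : ℝ, 1 ≤ k → ∀ f : ∀ j, EuclideanSpace ℝ (Fin (nj j)) → ℝ≥0∞,
      (∀ j, Measurable (f j)) → (∀ j y, f j y ≤ ENNReal.ofReal k) → (∀ j, ∫⁻ y, f j y ≤ 1) →
      ∀ r : ℝ, ∫⁻ x in Metric.closedBall 0 r, ∏ j, f j (Matrix.toEuclideanLin (L j) x) ^ p j ≤ C)
    {f : ∀ j, EuclideanSpace ℝ (Fin (nj j)) → ℝ≥0∞} (hf : ∀ j, Measurable (f j)) {κ : ℝ≥0∞}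
    (hκ : κ ≠ ⊤) (hfκ : ∀ j y, f j y ≤ κ) (hfi : ∀ j, ∫⁻ y, f j y ≠ ⊤) (r : ℝ) :
    ∫⁻ x in Metric.closedBall 0 r, ∏ j, f j (Matrix.toEuclideanLin (L j) x) ^ p j
      ≤ C * ∏ j, (∫⁻ y, f j y) ^ p j := by
  have key : ∀ e : ℝ≥0∞, e ≠ 0 → e ≠ ⊤ →
      ∫⁻ x in Metric.closedBall 0 r, ∏ j, f j (Matrix.toEuclideanLin (L j) x) ^ p j
        ≤ C * ∏ j, ((∫⁻ y, f j y) + e) ^ p j := by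
    intro e he het
    set c : Fin m → ℝ≥0∞ := fun j => (∫⁻ y, f j y) + e with hc
    have hc0 : ∀ j, c j ≠ 0 := fun j => by simp [hc, he]
    have hct : ∀ j, c j ≠ ⊤ := fun j => ENNReal.add_ne_top.2 ⟨hfi j, het⟩
    have hκ' : e⁻¹ * κ ≠ ⊤ := ENNReal.mul_ne_top (ENNReal.inv_ne_top.2 he) hκ
    have h1 := h (max 1 (e⁻¹ * κ).toReal) (le_max_left _ _) (fun j y => (c j)⁻¹ * f j y)
      (fun j => (hf j).const_mul _) (fun j y => ?_) (fun j => ?_) r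
    · have h2 : ∀ x, ∏ j, f j (Matrix.toEuclideanLin (L j) x) ^ p j = (∏ j, c j ^ p j) *
          ∏ j, ((c j)⁻¹ * f j (Matrix.toEuclideanLin (L j) x)) ^ p j := fun x => by
        rw [← Finset.prod_mul_distrib]
        refine Finset.prod_congr rfl fun j _ => ?_
        rw [← ENNReal.mul_rpow_of_nonneg _ _ (hp j), ← mul_assoc,
          ENNReal.mul_inv_cancel (hc0 j) (hct j), one_mul]
      simp_rw [h2]
      rw [lintegral_const_mul _ (measurable_prod_comp_toEuclideanLin L
        fun j => (hf j).const_mul _), mul_comm C]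
      exact mul_le_mul_right h1 _
    · refine le_trans ?_ (ENNReal.ofReal_le_ofReal (le_max_right _ _))
      rw [ENNReal.ofReal_toReal hκ']
      exact mul_le_mul' (ENNReal.inv_le_inv.2 le_add_self) (hfκ j y)
    · rw [lintegral_const_mul _ (hf j)]
      calc (c j)⁻¹ * ∫⁻ y, f j y ≤ (c j)⁻¹ * c j := mul_le_mul_right le_self_add _
        _ = 1 := ENNReal.inv_mul_cancel (hc0 j) (hct j)
  have hlim : Tendsto (fun i : ℕ => C * ∏ j, ((∫⁻ y, f j y) + (i : ℝ≥0∞)⁻¹) ^ p j) atTop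
      (𝓝 (C * ∏ j, (∫⁻ y, f j y) ^ p j)) := by
    refine ENNReal.Tendsto.const_mul (ENNReal.tendsto_finsetProd_of_ne_top _ (fun j _ => ?_)
      fun j _ => ENNReal.rpow_ne_top_of_nonneg (hp j) (hfi j)) (Or.inr hC)
    have h1 := (tendsto_const_nhds (x := ∫⁻ y, f j y)).add ENNReal.tendsto_inv_nat_nhds_zero
    rw [add_zero] at h1
    exact (ENNReal.continuous_rpow_const.tendsto _).comp h1
  refine ge_of_tendsto hlim ?_
  filter_upwards [eventually_ge_atTop 1] with i hi
  exact key _ (by simp) (by simp; omega)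

theorem matBL_le_of_setLIntegral_closedBall_le (hp : ∀ j, 0 ≤ p j) (hC : C ≠ ⊤)
    (h : ∀ k : ℝ, 1 ≤ k → ∀ f : ∀ j, EuclideanSpace ℝ (Fin (nj j)) → ℝ≥0∞,
      (∀ j, Measurable (f j)) → (∀ j y, f j y ≤ ENNReal.ofReal k) → (∀ j, ∫⁻ y, f j y ≤ 1) →
      ∀ r : ℝ, ∫⁻ x in Metric.closedBall 0 r, ∏ j, f j (Matrix.toEuclideanLin (L j) x) ^ p j ≤ C) :
    matBL nj L p ≤ C := by
  refine sInf_le fun f hf => ?_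
  rw [lintegral_eq_iSup_closedBall]
  refine iSup_le fun r => ?_
  set F : ∀ j, ℕ → EuclideanSpace ℝ (Fin (nj j)) → ℝ≥0∞ :=
    fun j k => (Metric.closedBall 0 k).indicator fun y => min (f j y) k with hF
  have hFm : ∀ j k, Measurable (F j k) := fun j k =>
    ((hf j).min measurable_const).indicator Metric.isClosed_closedBall.measurableSet
  have hFmono : ∀ j y, Monotone fun k => F j k y := fun j y a b hab => by
    have hsub : Metric.closedBall (0 : EuclideanSpace ℝ (Fin (nj j))) a ⊆ Metric.closedBall 0 b :=
      Metric.closedBall_subset_closedBall (by exact_mod_cast hab)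
    have hmin : min (f j y) (a : ℝ≥0∞) ≤ min (f j y) b := min_le_min_left _ (by exact_mod_cast hab)
    by_cases hy : y ∈ Metric.closedBall (0 : EuclideanSpace ℝ (Fin (nj j))) a
    · simpa only [hF, Set.indicator_of_mem hy, Set.indicator_of_mem (hsub hy)] using hmin
    · simp only [hF, Set.indicator_of_notMem hy, zero_le]
  have hFf : ∀ j k y, F j k y ≤ f j y := fun j k y =>
    Set.indicator_le (fun _ _ => min_le_left _ _) y
  have hFk : ∀ j k y, F j k y ≤ k := fun j k y => Set.indicator_le (fun _ _ => min_le_right _ _) y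
  have hFsup : ∀ j y, f j y ≤ ⨆ k, F j k y := by
    intro j y
    obtain ⟨k₀, hk₀⟩ := exists_nat_ge ‖y‖
    have hmem : ∀ k ≥ k₀, F j k y = min (f j y) k := fun k hk => Set.indicator_of_mem
      (mem_closedBall_zero_iff.2 (hk₀.trans (by exact_mod_cast hk))) _
    refine le_of_forall_lt fun t ht => ?_
    obtain ⟨k, hk⟩ := ENNReal.exists_nat_gt (ht.ne_top)
    refine lt_iSup_iff.2 ⟨max k k₀, ?_⟩
    rw [hmem _ (le_max_right _ _)]
    exact lt_min ht (hk.trans_le (by exact_mod_cast le_max_left k k₀))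
  have hpt : ∀ x, ∏ j, f j (Matrix.toEuclideanLin (L j) x) ^ p j
      ≤ ⨆ k, ∏ j, F j k (Matrix.toEuclideanLin (L j) x) ^ p j := fun x =>
    (Finset.prod_le_prod' fun j _ => (ENNReal.rpow_le_rpow (hFsup j _) (hp j)).trans_eq
      (iSup_rpow_of_monotone (hp j))).trans
      (prod_iSup_le_of_monotone _ fun j _ _ hab => ENNReal.rpow_le_rpow (hFmono j _ hab) (hp j))
  refine (lintegral_mono hpt).trans ?_
  rw [lintegral_iSup (fun k => measurable_prod_comp_toEuclideanLin L fun j => hFm j k)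
    (fun a b hab x => Finset.prod_le_prod' fun j _ => ENNReal.rpow_le_rpow (hFmono j _ hab) (hp j))]
  refine iSup_le fun k => ?_
  refine (setLIntegral_closedBall_le_mul_prod hp hC h (fun j => hFm j k) (ENNReal.natCast_ne_top k)
    (fun j => hFk j k) (fun j => ?_) r).trans (mul_le_mul_right (Finset.prod_le_prod' fun j _ =>
      ENNReal.rpow_le_rpow (lintegral_mono (hFf j k)) (hp j)) _)
  rw [hF, lintegral_indicator Metric.isClosed_closedBall.measurableSet]
  refine ne_top_of_le_ne_top ?_ (setLIntegral_mono measurable_const fun y _ => min_le_right _ _)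
  rw [setLIntegral_const]
  exact ENNReal.mul_ne_top (ENNReal.natCast_ne_top k) measure_closedBall_lt_top.ne

end Reduction

section Effective

variable {m n : ℕ} {nj : Fin m → ℕ}

theorem matOpNorm_le_of_abs_apply_le {a b : ℕ} {A : Matrix (Fin a) (Fin b) ℝ} {M : ℝ}
    (hM : 0 ≤ M) (hA : ∀ i l, |A i l| ≤ M) : matOpNorm A ≤ a * b * M := by
  refine ContinuousLinearMap.opNorm_le_bound _ (by positivity) fun x => ?_
  rw [LinearMap.coe_toContinuousLinearMap', ← sq_le_sq₀ (norm_nonneg _) (by positivity),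
    EuclideanSpace.real_norm_sq_eq]
  have hi : ∀ i, (Matrix.toEuclideanLin A x i) ^ 2 ≤ (b * M * ‖x‖) ^ 2 := by
    intro i
    rw [← sq_abs]
    refine pow_le_pow_left₀ (abs_nonneg _) ?_ 2
    change |∑ l, A i l * x l| ≤ _
    refine (Finset.abs_sum_le_sum_abs _ _).trans ?_
    calc ∑ l, |A i l * x l| ≤ ∑ _l : Fin b, M * ‖x‖ := by
          refine Finset.sum_le_sum fun l _ => ?_
          rw [abs_mul]
          exact mul_le_mul (hA i l) (PiLp.norm_apply_le x l) (abs_nonneg _) hM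
      _ = b * M * ‖x‖ := by simp; ring
  calc ∑ i, (Matrix.toEuclideanLin A x i) ^ 2 ≤ ∑ _i : Fin a, (b * M * ‖x‖) ^ 2 :=
        Finset.sum_le_sum fun i _ => hi i
    _ = a * (b * M * ‖x‖) ^ 2 := by simp
    _ ≤ (a : ℝ) ^ 2 * (b * M * ‖x‖) ^ 2 := by
        refine mul_le_mul_of_nonneg_right ?_ (sq_nonneg _)
        exact_mod_cast Nat.le_self_pow two_ne_zero a
    _ = (a * b * M * ‖x‖) ^ 2 := by ring

theorem matBLg_eq_sqrt {L : ∀ j, Matrix (Fin (nj j)) (Fin n) ℝ} {p : Fin m → ℝ}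
    {A : ∀ j, Matrix (Fin (nj j)) (Fin (nj j)) ℝ} (hA : ∀ j, (A j).PosDef) :
    matBLg nj L p A = √((∏ j, (A j).det ^ p j) / (gaussForm L p A).det) := by
  have h0 : ∀ j, 0 ≤ (A j).det ^ p j := fun j => Real.rpow_nonneg (hA j).det_pos.le _
  rw [Real.sqrt_div (Finset.prod_nonneg fun j _ => h0 j), matBLg, Real.sqrt_eq_rpow,
    Real.sqrt_eq_rpow, ← Real.finsetProd_rpow _ _ fun j _ => h0 j]
  congr 1
  refine Finset.prod_congr rfl fun j _ => ?_
  rw [← Real.rpow_mul (hA j).det_pos.le, mul_one_div]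

theorem det_gaussForm_pos {L : ∀ j, Matrix (Fin (nj j)) (Fin n) ℝ} {p : Fin m → ℝ}
    (hp : ∀ j, 0 ≤ p j) (hL : ∀ j, Function.Surjective (Matrix.toEuclideanLin (L j)))
    (hdim : (n : ℝ) = ∑ j, p j * nj j) {S : ℝ} (hS0 : 0 < S)
    (hS : ∀ X : Matrix (Fin n) (Fin n) ℝ, X.PosDef → dualFunctional L p X ≤ S)
    {A : ∀ j, Matrix (Fin (nj j)) (Fin (nj j)) ℝ} (hA : ∀ j, (A j).PosDef) :
    0 < (gaussForm L p A).det := by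
  have h := prod_det_rpow_le hp hL hdim hS hA
  exact (mul_pos_iff_of_pos_left hS0).1
    ((Finset.prod_pos fun j _ => Real.rpow_pos_of_pos (hA j).det_pos _).trans_le h)

theorem matBLg_le_sqrt {L : ∀ j, Matrix (Fin (nj j)) (Fin n) ℝ} {p : Fin m → ℝ}
    (hp : ∀ j, 0 ≤ p j) (hL : ∀ j, Function.Surjective (Matrix.toEuclideanLin (L j)))
    (hdim : (n : ℝ) = ∑ j, p j * nj j) {S : ℝ} (hS0 : 0 < S)
    (hS : ∀ X : Matrix (Fin n) (Fin n) ℝ, X.PosDef → dualFunctional L p X ≤ S)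
    {A : ∀ j, Matrix (Fin (nj j)) (Fin (nj j)) ℝ} (hA : ∀ j, (A j).PosDef) :
    matBLg nj L p A ≤ √S := by
  rw [matBLg_eq_sqrt hA]
  refine Real.sqrt_le_sqrt ?_
  rw [div_le_iff₀ (det_gaussForm_pos hp hL hdim hS0 hS hA)]
  exact prod_det_rpow_le hp hL hdim hS hA

theorem sqrt_dualFunctional_le_matBLg {L : ∀ j, Matrix (Fin (nj j)) (Fin n) ℝ} {p : Fin m → ℝ}
    (hp : ∀ j, 0 ≤ p j) (hL : ∀ j, Function.Surjective (Matrix.toEuclideanLin (L j)))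
    (hdim : (n : ℝ) = ∑ j, p j * nj j) {S : ℝ} (hS0 : 0 < S)
    (hS : ∀ X : Matrix (Fin n) (Fin n) ℝ, X.PosDef → dualFunctional L p X ≤ S)
    {X : Matrix (Fin n) (Fin n) ℝ} (hX : X.PosDef) :
    √(dualFunctional L p X) ≤ matBLg nj L p (dualInput L X) := by
  have hA := posDef_dualInput hL hX
  rw [matBLg_eq_sqrt hA]
  refine Real.sqrt_le_sqrt ?_
  rw [le_div_iff₀ (det_gaussForm_pos hp hL hdim hS0 hS hA), dualFunctional_eq_mul_prod hL hX]
  have h := det_mul_le_exp_trace_sub hX (posSemidef_gaussForm hp L hA)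
  rw [Matrix.trace_mul_comm, trace_gaussForm_dualInput_mul hL hdim hX, sub_self, Real.exp_zero,
    Matrix.det_mul] at h
  have h0 : 0 ≤ ∏ j, (dualInput L X j).det ^ p j :=
    Finset.prod_nonneg fun j _ => Real.rpow_nonneg (hA j).det_pos.le _
  calc X.det * (∏ j, (dualInput L X j).det ^ p j) * (gaussForm L p (dualInput L X)).det
      = X.det * (gaussForm L p (dualInput L X)).det * ∏ j, (dualInput L X j).det ^ p j := by ring
    _ ≤ 1 * ∏ j, (dualInput L X j).det ^ p j := mul_le_mul_of_nonneg_right h h0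
    _ = _ := one_mul _

theorem exists_isLUB_dualFunctional {L : ∀ j, Matrix (Fin (nj j)) (Fin n) ℝ} {p : Fin m → ℝ}
    (hL : ∀ j, Function.Surjective (Matrix.toEuclideanLin (L j)))
    (hC : ∃ C, ∀ X : Matrix (Fin n) (Fin n) ℝ, X.PosDef → dualFunctional L p X ≤ C) :
    ∃ S, 0 < S ∧ (∀ X : Matrix (Fin n) (Fin n) ℝ, X.PosDef → dualFunctional L p X ≤ S) ∧
      ∀ S' < S, ∃ X : Matrix (Fin n) (Fin n) ℝ, X.PosDef ∧ S' < dualFunctional L p X := by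
  obtain ⟨C, hC⟩ := hC
  set s : Set ℝ := {t | ∃ X : Matrix (Fin n) (Fin n) ℝ, X.PosDef ∧ t = dualFunctional L p X}
    with hs
  have hbdd : BddAbove s := ⟨C, by rintro _ ⟨X, hX, rfl⟩; exact hC X hX⟩
  have hne : dualFunctional L p (1 : Matrix (Fin n) (Fin n) ℝ) ∈ s := ⟨1, Matrix.PosDef.one, rfl⟩
  have hpos : 0 < dualFunctional L p (1 : Matrix (Fin n) (Fin n) ℝ) :=
    div_pos Matrix.PosDef.one.det_pos (Finset.prod_pos fun j _ =>
      Real.rpow_pos_of_pos (posDef_mul_mul_transpose (hL j) Matrix.PosDef.one).det_pos _)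
  refine ⟨sSup s, hpos.trans_le (le_csSup hbdd hne), fun X hX => le_csSup hbdd ⟨X, hX, rfl⟩,
    fun S' hS' => ?_⟩
  obtain ⟨_, ⟨X, hX, rfl⟩, h⟩ := exists_lt_of_lt_csSup ⟨_, hne⟩ hS'
  exact ⟨X, hX, h⟩

end Effective

/-- **Corollary (effective Lieb theorem, local uniform form).**
If `(L₀,p)` is a Brascamp–Lieb datum with finite constant, then there are `N ∈ ℕ`,
`δ₀ > 0` and a neighbourhood of `L₀` such that for all `δ ∈ (0,δ₀)` and all surjective
`L` in that neighbourhood, the supremum of `BL_g(L,p;A)` over positive definite `A` with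
`‖A_j‖ < δ^{-N}` and `‖A_j^{-1}‖ < δ^{-N}` is at least `(1−δ) · BL(L,p)`. -/
theorem effective_lieb_corollary {m n : ℕ} (nj : Fin m → ℕ) (p : Fin m → ℝ)
    (hp : ∀ j, p j ∈ Set.Icc (0 : ℝ) 1)
    (L₀ : ∀ j, Matrix (Fin (nj j)) (Fin n) ℝ)
    (hL₀ : ∀ j, Function.Surjective (Matrix.toEuclideanLin (L₀ j)))
    (hfin : matBL nj L₀ p ≠ ⊤) :
    ∃ (N : ℕ) (δ₀ η : ℝ), 0 < δ₀ ∧ 0 < η ∧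
      ∀ δ ∈ Set.Ioo (0 : ℝ) δ₀,
      ∀ L : ∀ j, Matrix (Fin (nj j)) (Fin n) ℝ,
        (∀ j, Function.Surjective (Matrix.toEuclideanLin (L j))) →
        (∀ j, matOpNorm (L j - L₀ j) < η) →
        ENNReal.ofReal (1 - δ) * matBL nj L p
          ≤ ENNReal.ofReal (sSup {x : ℝ | ∃ A : ∀ j, Matrix (Fin (nj j)) (Fin (nj j)) ℝ,
              (∀ j, (A j).PosDef) ∧
              (∀ j, matOpNorm (A j) < δ ^ (-(N : ℝ))) ∧
              (∀ j, matOpNorm ((A j)⁻¹) < δ ^ (-(N : ℝ))) ∧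
              x = matBLg nj L p A}) := by
  have hp0 : ∀ j, 0 ≤ p j := fun j => (hp j).1
  obtain ⟨C₀, hC₀⟩ := exists_dualFunctional_le_of_matBL_ne_top hp0 hL₀ hfin
  obtain ⟨hdim, hsel⟩ := conditions_of_dualFunctional_le hp0 hL₀ hC₀
  obtain ⟨B, c, η, hB, hc, hη, hgood⟩ := exists_uniformlyGood L₀ hsel
  obtain ⟨Q, N, hQ, hnear⟩ := exists_near_maximizer (nj := nj) hp0 hB hc hdim
  set d := ∑ j, nj j with hd
  have hdj : ∀ j, nj j ≤ d := fun j => Finset.single_le_sum (f := nj) (fun _ _ => Nat.zero_le _)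
    (Finset.mem_univ j)
  have hq0 : 0 ≤ (d : ℝ) * d * Q := by positivity
  refine ⟨N + 1, 1 / (d * d * Q + 1), η, by positivity, hη, ?_⟩
  intro δ ⟨hδ0, hδ⟩ L hL hLη
  rw [lt_div_iff₀ (by positivity)] at hδ
  have hδ1 : δ < 1 := by nlinarith
  have hg := hgood L hLη
  obtain ⟨S, hS0, hS, hS'⟩ :=
    exists_isLUB_dualFunctional hL (exists_dualFunctional_bound hp0 hB hc hg hdim)
  have hBL : matBL nj L p ≤ ENNReal.ofReal √S :=
    matBL_le_of_setLIntegral_closedBall_le hp0 ENNReal.ofReal_ne_top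
      fun k hk f hf hfk hf1 r => setLIntegral_closedBall_le_sqrt hp0 hL hdim hB hc hg hS0 hS hS'
        hk hf hfk hf1 r
  obtain ⟨K, hK, -, hKS, hKd⟩ := hnear L hg S hS0 hS' δ hδ0 hδ1.le
  have hsmall : ∀ {j} {A : Matrix (Fin (nj j)) (Fin (nj j)) ℝ}, (∀ i l, |A i l| ≤ Q / δ ^ N) →
      matOpNorm A < δ ^ (-((N + 1 : ℕ) : ℝ)) := by
    intro j A hA
    have hM : 0 ≤ Q / δ ^ N := by positivity
    rw [Real.rpow_neg hδ0.le, Real.rpow_natCast]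
    calc matOpNorm A ≤ nj j * nj j * (Q / δ ^ N) := matOpNorm_le_of_abs_apply_le hM hA
      _ ≤ d * d * (Q / δ ^ N) := by
          have : (nj j : ℝ) ≤ d := by exact_mod_cast hdj j
          gcongr
      _ = (δ * (d * d * Q)) / δ ^ (N + 1) := by rw [pow_succ]; field_simp
      _ < 1 / δ ^ (N + 1) := by
          refine div_lt_div_of_pos_right ?_ (by positivity)
          linarith
      _ = (δ ^ (N + 1))⁻¹ := one_div _
  have hbdd : BddAbove {x : ℝ | ∃ A : ∀ j, Matrix (Fin (nj j)) (Fin (nj j)) ℝ,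
      (∀ j, (A j).PosDef) ∧ (∀ j, matOpNorm (A j) < δ ^ (-((N + 1 : ℕ) : ℝ))) ∧
      (∀ j, matOpNorm ((A j)⁻¹) < δ ^ (-((N + 1 : ℕ) : ℝ))) ∧ x = matBLg nj L p A} := by
    refine ⟨√S, ?_⟩
    rintro _ ⟨A, hA, -, -, rfl⟩
    exact matBLg_le_sqrt hp0 hL hdim hS0 hS hA
  have hmem := le_csSup hbdd ⟨dualInput L (K * Kᵀ), posDef_dualInput hL hK,
    fun j => hsmall (hKd j).2.2, fun j => hsmall (by
      rw [dualInput, Matrix.nonsing_inv_nonsing_inv _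
        (posDef_mul_mul_transpose (hL j) hK).det_pos.ne'.isUnit]
      exact (hKd j).2.1), rfl⟩
  have hsqrt : (1 - δ) * √S ≤ √(dualFunctional L p (K * Kᵀ)) := by
    refine Real.le_sqrt_of_sq_le (le_trans ?_ hKS)
    rw [mul_pow, Real.sq_sqrt hS0.le]
    refine mul_le_mul_of_nonneg_right ?_ hS0.le
    nlinarith
  calc ENNReal.ofReal (1 - δ) * matBL nj L p ≤ ENNReal.ofReal (1 - δ) * ENNReal.ofReal √S :=
        mul_le_mul_right hBL _
    _ = ENNReal.ofReal ((1 - δ) * √S) := (ENNReal.ofReal_mul (by linarith)).symm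
    _ ≤ _ := ENNReal.ofReal_le_ofReal (hsqrt.trans
      ((sqrt_dualFunctional_le_matBLg hp0 hL hdim hS0 hS hK).trans hmem))
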